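/- (Rigidity of spacetimes in the plane.) Let T > 0 and let (𝓜, u) be a conformal Ricci flow spacetime in the ambient space ℂ × (0,T) which is complete, expanding, continuous and initially determined, and whose slices exhaust the plane: ⋃_{t ∈ (0,T)} 𝓜_t = ℂ. Then 𝓜 = ℂ × (0,T). -/

import Mathlib

open Set MeasureTheory Filter Metric

/-- The Euclidean Laplacian of `f : ℂ → ℝ` at `z`, i.e. `∂²f/∂x² + ∂²f/∂y²`. -/
noncomputable def lap (f : ℂ → ℝ) (z : ℂ) : ℝ :=
  iteratedFDeriv ℝ 2 f z ![1, 1] + iteratedFDeriv ℝ 2 f z ![Complex.I, Complex.I]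

/-- The time-timeSlice of a spacetime `M ⊆ ℂ × ℝ` at time `t`. -/
def timeSlice (M : Set (ℂ × ℝ)) (t : ℝ) : Set ℂ := {z | (z, t) ∈ M}

/-- The conformal distance on `Ω` induced by a conformal factor `v`: the infimum of
`v`-lengths of `C¹` paths in `Ω` joining `x` to `y`. -/
noncomputable def confDist (v : ℂ → ℝ) (Ω : Set ℂ) (x y : ℂ) : ℝ :=
  sInf {L : ℝ | ∃ γ : ℝ → ℂ, ContDiffOn ℝ 1 γ (Icc 0 1) ∧
    (∀ s ∈ Icc (0:ℝ) 1, γ s ∈ Ω) ∧ γ 0 = x ∧ γ 1 = y ∧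
    L = ∫ s in (0:ℝ)..1, Real.sqrt (v (γ s)) * ‖derivWithin γ (Icc 0 1) s‖}

/-- The conformal ball of centre `p` and radius `ρ` in `Ω` for the metric `v|dz|²`. -/
def confBall (v : ℂ → ℝ) (Ω : Set ℂ) (p : ℂ) (ρ : ℝ) : Set ℂ :=
  {z ∈ connectedComponentIn Ω p | confDist v Ω p z < ρ}

/-- The conformal metric `v|dz|²` is complete on `Ω`: every connected component of `Ω` is a
complete metric space with respect to the induced distance `confDist v Ω`. -/
def ConfComplete (v : ℂ → ℝ) (Ω : Set ℂ) : Prop :=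
  ∀ x₀ ∈ Ω, ∀ x : ℕ → ℂ, (∀ n, x n ∈ connectedComponentIn Ω x₀) →
    (∀ ε : ℝ, 0 < ε → ∃ N : ℕ, ∀ m ≥ N, ∀ n ≥ N, confDist v Ω (x m) (x n) < ε) →
    ∃ l ∈ connectedComponentIn Ω x₀,
      Tendsto (fun n => confDist v Ω (x n) l) atTop (nhds 0)

/-- A conformal Ricci flow spacetime in the ambient space `ℂ × (0,T)`:
`M` is a connected open subset of `ℂ × (0,T)` with non-empty time-slices, and `u` is a smooth
positive conformal factor on `M` solving the logarithmic fast diffusion equation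
`∂u/∂t = Δ log u`. -/
structure ConfRFS (T : ℝ) (M : Set (ℂ × ℝ)) (u : ℂ → ℝ → ℝ) : Prop where
  sub : M ⊆ {p : ℂ × ℝ | p.2 ∈ Ioo 0 T}
  opn : IsOpen M
  conn : IsConnected M
  nonempty : ∀ t ∈ Ioo (0:ℝ) T, (timeSlice M t).Nonempty
  pos : ∀ p ∈ M, 0 < u p.1 p.2
  smooth : ContDiffOn ℝ (⊤ : ℕ∞) (fun p : ℂ × ℝ => u p.1 p.2) M
  lfde : ∀ p ∈ M, deriv (u p.1) p.2 = lap (fun z => Real.log (u z p.2)) p.1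

/-- A conformal Ricci flow spacetime is complete if the metric `u(·,t)|dz|²` is complete on the
timeSlice `M_t` for every `t ∈ (0,T)`. -/
def ConfRFSComplete (T : ℝ) (M : Set (ℂ × ℝ)) (u : ℂ → ℝ → ℝ) : Prop :=
  ∀ t ∈ Ioo (0:ℝ) T, ConfComplete (fun z => u z t) (timeSlice M t)

/-- There is a time-preserving path in `M` from time `s` to the point `(z,t)`. -/
def TimePreservingFrom (M : Set (ℂ × ℝ)) (s : ℝ) (z : ℂ) (t : ℝ) : Prop :=
  ∃ γ : ℝ → ℂ, ContinuousOn γ (Icc s t) ∧ (∀ r ∈ Icc s t, (γ r, r) ∈ M) ∧ γ t = z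

/-- The hindsight function of a spacetime `M`. -/
noncomputable def hindsight (M : Set (ℂ × ℝ)) (z : ℂ) (t : ℝ) : ℝ :=
  sInf {s : ℝ | 0 < s ∧ s ≤ t ∧ TimePreservingFrom M s z t}

/-- A spacetime is initially determined if its hindsight function vanishes identically. -/
def InitiallyDetermined (M : Set (ℂ × ℝ)) : Prop :=
  ∀ p ∈ M, hindsight M p.1 p.2 = 0

/-- A spacetime in `ℂ × (0,T)` is expanding if worldlines persist until the final time. -/
def Expanding (T : ℝ) (M : Set (ℂ × ℝ)) : Prop :=
  ∀ (z : ℂ) (t t' : ℝ), (z, t) ∈ M → t ≤ t' → t' < T → (z, t') ∈ M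

/-- An expanding spacetime is continuous if each timeSlice is the interior of the intersection of
all later slices. -/
def ContinuousSpacetime (T : ℝ) (M : Set (ℂ × ℝ)) : Prop :=
  ∀ s ∈ Ioo (0:ℝ) T, timeSlice M s = interior (⋂ t ∈ Ioo s T, timeSlice M t)

/-- The vanishing time of the point `(z,t)`: the supremum of the connected component containing
`t` of the set of times at which `z` belongs to the spacetime. -/
noncomputable def vanishTime (M : Set (ℂ × ℝ)) (z : ℂ) (t : ℝ) : ℝ :=
  sSup (connectedComponentIn {r : ℝ | (z, r) ∈ M} t)

/-- The `v`-length of the restriction of `γ` to `[a, b]`. -/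
noncomputable def curveLength (v : ℂ → ℝ) (γ : ℝ → ℂ) (a b : ℝ) : ℝ :=
  ∫ s in a..b, Real.sqrt (v (γ s)) * ‖deriv γ s‖

/-- `y` can be reached from `x` by a `C¹` path inside `Ω` of `v`-length at most `L`. -/
def Reach (v : ℂ → ℝ) (Ω : Set ℂ) (x y : ℂ) (L : ℝ) : Prop :=
  ∃ γ : ℝ → ℂ, ContDiff ℝ 1 γ ∧ (∀ s ∈ Icc (0:ℝ) 1, γ s ∈ Ω) ∧ γ 0 = x ∧ γ 1 = y ∧
    curveLength v γ 0 1 ≤ L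

section Curves

variable {v : ℂ → ℝ} {Ω : Set ℂ} {γ : ℝ → ℂ} {x y z : ℂ} {a b L L' : ℝ}

lemma curveLength_nonneg (hab : a ≤ b) : 0 ≤ curveLength v γ a b :=
  intervalIntegral.integral_nonneg hab fun s _ => by positivity

lemma continuousOn_speed (hv : ContinuousOn v Ω) (hγ : ContDiff ℝ 1 γ) {S : Set ℝ}
    (hS : ∀ s ∈ S, γ s ∈ Ω) :
    ContinuousOn (fun s => Real.sqrt (v (γ s)) * ‖deriv γ s‖) S :=
  ((hv.comp hγ.continuous.continuousOn hS).sqrt).mul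
    (hγ.continuous_deriv le_rfl).norm.continuousOn

lemma intervalIntegrable_speed (hv : ContinuousOn v Ω) (hγ : ContDiff ℝ 1 γ) (hab : a ≤ b)
    (hS : ∀ s ∈ Icc a b, γ s ∈ Ω) :
    IntervalIntegrable (fun s => Real.sqrt (v (γ s)) * ‖deriv γ s‖) volume a b :=
  ContinuousOn.intervalIntegrable (by
    rw [uIcc_of_le hab]; exact continuousOn_speed hv hγ hS)

lemma curveLength_add (hv : ContinuousOn v Ω) (hγ : ContDiff ℝ 1 γ) {c : ℝ} (hab : a ≤ b)
    (hbc : b ≤ c) (hS : ∀ s ∈ Icc a c, γ s ∈ Ω) :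
    curveLength v γ a b + curveLength v γ b c = curveLength v γ a c :=
  intervalIntegral.integral_add_adjacent_intervals
    (intervalIntegrable_speed hv hγ hab fun s hs => hS s ⟨hs.1, hs.2.trans hbc⟩)
    (intervalIntegrable_speed hv hγ hbc fun s hs => hS s ⟨hab.trans hs.1, hs.2⟩)

lemma Reach.mono (h : Reach v Ω x y L) (hL : L ≤ L') : Reach v Ω x y L' := by
  obtain ⟨γ, h1, h2, h3, h4, h5⟩ := h
  exact ⟨γ, h1, h2, h3, h4, h5.trans hL⟩

lemma Reach.nonneg (h : Reach v Ω x y L) : 0 ≤ L := by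
  obtain ⟨γ, h1, h2, h3, h4, h5⟩ := h
  exact (curveLength_nonneg zero_le_one).trans h5

lemma Reach.mem_right (h : Reach v Ω x y L) : y ∈ Ω := by
  obtain ⟨γ, h1, h2, h3, h4, h5⟩ := h
  exact h4 ▸ h2 1 (by simp)

lemma Reach.refl (hx : x ∈ Ω) (hL : 0 ≤ L) : Reach v Ω x x L :=
  ⟨fun _ => x, contDiff_const, fun _ _ => hx, rfl, rfl, by simpa [curveLength] using hL⟩

/-- Length of a curve precomposed with a nondecreasing parameter change. -/
lemma curveLength_comp (hv : ContinuousOn v Ω) (hγ : ContDiff ℝ 1 γ) {φ : ℝ → ℝ}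
    (hφ : ContDiff ℝ 1 φ) (hmono : Monotone φ) (hab : a ≤ b)
    (hS : ∀ s ∈ Icc (φ a) (φ b), γ s ∈ Ω) :
    curveLength v (γ ∘ φ) a b = curveLength v γ (φ a) (φ b) := by
  unfold curveLength
  have hmaps : ∀ s ∈ Icc a b, φ s ∈ Icc (φ a) (φ b) := fun s hs => ⟨hmono hs.1, hmono hs.2⟩
  rw [← intervalIntegral.integral_comp_mul_deriv''' (a := a) (b := b) (f := φ) (f' := deriv φ)
    (g := fun s => Real.sqrt (v (γ s)) * ‖deriv γ s‖)]
  · refine intervalIntegral.integral_congr fun s _ => ?_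
    have h1 : deriv (γ ∘ φ) s = deriv φ s • deriv γ (φ s) :=
      deriv.scomp s (hγ.differentiable one_ne_zero _) (hφ.differentiable one_ne_zero _)
    have h2 : 0 ≤ deriv φ s := hmono.deriv_nonneg
    rw [h1, norm_smul, Real.norm_of_nonneg h2]
    simp only [Function.comp]; ring
  · exact hφ.continuous.continuousOn
  · intro s _
    exact (hφ.differentiable one_ne_zero s).hasDerivAt.hasDerivWithinAt
  · refine (continuousOn_speed hv hγ hS).mono ?_
    rintro _ ⟨s, hs, rfl⟩
    rw [min_eq_left hab, max_eq_right hab] at hs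
    exact hmaps s (Ioo_subset_Icc_self hs)
  · refine ((continuousOn_speed hv hγ hS).mono ?_).integrableOn_compact
      (isCompact_uIcc.image hφ.continuous)
    rintro _ ⟨s, hs, rfl⟩
    rw [uIcc_of_le hab] at hs
    exact hmaps s hs
  · refine ContinuousOn.integrableOn_compact isCompact_uIcc ?_
    refine ContinuousOn.mul ((continuousOn_speed hv hγ hS).comp hφ.continuous.continuousOn ?_)
      (hφ.continuous_deriv le_rfl).continuousOn
    intro s hs
    rw [uIcc_of_le hab] at hs
    exact hmaps s hs

lemma Reach.of_interval (hv : ContinuousOn v Ω) (hγ : ContDiff ℝ 1 γ) (hab : a ≤ b)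
    (hS : ∀ s ∈ Icc a b, γ s ∈ Ω) (hL : curveLength v γ a b ≤ L) :
    Reach v Ω (γ a) (γ b) L := by
  have hφ : ContDiff ℝ 1 (fun s : ℝ => a + (b - a) * s) := by fun_prop
  have hmono : Monotone (fun s : ℝ => a + (b - a) * s) := fun s t hst => by
    have : 0 ≤ b - a := by linarith
    simp only; gcongr
  refine ⟨γ ∘ (fun s => a + (b - a) * s), hγ.comp hφ, ?_, by simp, by simp, ?_⟩
  · intro s hs
    exact hS _ ⟨by nlinarith [hs.1], by nlinarith [hs.2]⟩
  · rw [curveLength_comp hv hγ hφ hmono zero_le_one (by simpa using hS)]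
    simpa using hL

lemma Reach.symm (h : Reach v Ω x y L) : Reach v Ω y x L := by
  obtain ⟨γ, h1, h2, h3, h4, h5⟩ := h
  refine ⟨fun s => γ (1 - s), h1.comp (by fun_prop), fun s hs => h2 _ ⟨by linarith [hs.2],
    by linarith [hs.1]⟩, by simpa, by simpa, ?_⟩
  refine le_trans (le_of_eq ?_) h5
  unfold curveLength
  have := intervalIntegral.integral_comp_sub_left (a := 0) (b := 1)
    (fun s => Real.sqrt (v (γ s)) * ‖deriv γ s‖) 1
  simp only [sub_self, sub_zero] at this
  rw [← this]
  refine intervalIntegral.integral_congr fun s _ => ?_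
  simp only [deriv_comp_const_sub, norm_neg]

lemma Reach.trans (hv : ContinuousOn v Ω) (h : Reach v Ω x y L) (h' : Reach v Ω y z L') :
    Reach v Ω x z (L + L') := by
  obtain ⟨γ, h1, h2, h3, h4, h5⟩ := h
  obtain ⟨δ, g1, g2, g3, g4, g5⟩ := h'
  set φ : ℝ → ℝ := fun s => Real.smoothTransition (2 * s) with hφ
  set ψ : ℝ → ℝ := fun s => Real.smoothTransition (2 * s - 1) with hψ
  have cφ : ContDiff ℝ 1 φ := Real.smoothTransition.contDiff.comp (by fun_prop)
  have cψ : ContDiff ℝ 1 ψ := Real.smoothTransition.contDiff.comp (by fun_prop)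
  have mφ : Monotone φ := fun s t hst => Real.smoothTransition.monotone (by linarith)
  have mψ : Monotone ψ := fun s t hst => Real.smoothTransition.monotone (by linarith)
  have e1 : ∀ s ≤ (1/2 : ℝ), ψ s = 0 := fun s hs =>
    Real.smoothTransition.zero_of_nonpos (by linarith)
  have e2 : ∀ s, (1/2 : ℝ) ≤ s → φ s = 1 := fun s hs =>
    Real.smoothTransition.one_of_one_le (by linarith)
  have e3 : φ 0 = 0 := Real.smoothTransition.zero_of_nonpos (by norm_num)
  have e4 : ψ 1 = 1 := Real.smoothTransition.one_of_one_le (by norm_num)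
  set σ : ℝ → ℂ := fun s => γ (φ s) + δ (ψ s) - y with hσ
  have cσ : ContDiff ℝ 1 σ := ((h1.comp cφ).add (g1.comp cψ)).sub contDiff_const
  have s1 : ∀ s ≤ (1/2 : ℝ), σ s = (γ ∘ φ) s := fun s hs => by simp [hσ, e1 s hs, g3]
  have s2 : ∀ s, (1/2 : ℝ) ≤ s → σ s = (δ ∘ ψ) s := fun s hs => by simp [hσ, e2 s hs, h4]
  have hmem : ∀ s ∈ Icc (0:ℝ) 1, σ s ∈ Ω := by
    intro s _
    rcases le_total s (1/2) with h | h
    · rw [s1 s h]; exact h2 _ ⟨Real.smoothTransition.nonneg _, Real.smoothTransition.le_one _⟩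
    · rw [s2 s h]; exact g2 _ ⟨Real.smoothTransition.nonneg _, Real.smoothTransition.le_one _⟩
  refine ⟨σ, cσ, hmem, by rw [s1 0 (by norm_num)]; simp [e3, h3],
    by rw [s2 1 (by norm_num)]; simp [e4, g4], ?_⟩
  rw [← curveLength_add hv cσ (b := 1/2) (by norm_num) (by norm_num) hmem]
  refine add_le_add ?_ ?_
  · have : curveLength v σ 0 (1/2) = curveLength v (γ ∘ φ) 0 (1/2) := by
      refine intervalIntegral.integral_congr_ae' ?_ ?_
      · filter_upwards [compl_mem_ae_iff.2 (measure_singleton (1/2:ℝ))] with s hs hs'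
        have hlt : s < 1/2 := lt_of_le_of_ne hs'.2 hs
        have hev : σ =ᶠ[nhds s] (γ ∘ φ) := by
          filter_upwards [Iio_mem_nhds hlt] with r hr using s1 r (le_of_lt hr)
        rw [hev.deriv_eq, hev.eq_of_nhds]
      · refine Eventually.of_forall fun s hs => absurd (hs.1.trans_le hs.2) (by norm_num)
    rw [this, curveLength_comp hv h1 cφ mφ (by norm_num)
      (by rw [e3, e2 _ le_rfl]; exact h2), e3, e2 _ le_rfl]
    exact h5
  · have : curveLength v σ (1/2) 1 = curveLength v (δ ∘ ψ) (1/2) 1 := by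
      refine intervalIntegral.integral_congr_ae' ?_ ?_
      · refine Eventually.of_forall fun s hs => ?_
        have hev : σ =ᶠ[nhds s] (δ ∘ ψ) := by
          filter_upwards [Ioi_mem_nhds hs.1] with r hr using s2 r (le_of_lt hr)
        rw [hev.deriv_eq, hev.eq_of_nhds]
      · refine Eventually.of_forall fun s hs => absurd (hs.1.trans_le hs.2) (by norm_num)
    rw [this, curveLength_comp hv g1 cψ mψ (by norm_num)
      (by rw [e4, e1 _ le_rfl]; exact g2), e4, e1 _ le_rfl]
    exact g5

lemma Reach.split (hv : ContinuousOn v Ω) (ha : 0 ≤ a) (hb : 0 ≤ b)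
    (h : Reach v Ω x z (a + b)) : ∃ y, Reach v Ω x y a ∧ Reach v Ω y z b := by
  obtain ⟨γ, h1, h2, h3, h4, h5⟩ := h
  by_cases hle : curveLength v γ 0 1 ≤ a
  · exact ⟨z, ⟨γ, h1, h2, h3, h4, hle⟩, Reach.refl (h4 ▸ h2 1 (by simp)) hb⟩
  have hc : ContinuousOn (fun s => curveLength v γ 0 s) (Icc 0 1) := by
    have := intervalIntegral.continuousOn_primitive_interval
      (μ := volume) (f := fun s => Real.sqrt (v (γ s)) * ‖deriv γ s‖) (a := 0) (b := 1) (by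
      rw [uIcc_of_le zero_le_one]
      exact (continuousOn_speed hv h1 h2).integrableOn_compact isCompact_Icc)
    rwa [uIcc_of_le zero_le_one] at this
  obtain ⟨s, hs, hsa⟩ := intermediate_value_Icc zero_le_one hc
    (show a ∈ Icc _ _ from ⟨by simpa [curveLength] using ha, (not_le.1 hle).le⟩)
  simp only at hsa
  have hadd := curveLength_add hv h1 hs.1 hs.2 h2
  refine ⟨γ s, ?_, ?_⟩
  · rw [← h3]
    exact Reach.of_interval hv h1 hs.1 (fun r hr => h2 r ⟨hr.1, hr.2.trans hs.2⟩) hsa.le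
  · rw [← h4]
    exact Reach.of_interval hv h1 hs.2 (fun r hr => h2 r ⟨hs.1.trans hr.1, hr.2⟩) (by linarith)

/-- The length of a straight segment. -/
lemma reach_segment {m : ℝ} (hv : ContinuousOn v Ω)
    (hseg : ∀ s ∈ Icc (0:ℝ) 1, x + s * (y - x) ∈ Ω ∧ v (x + s * (y - x)) ≤ m) :
    Reach v Ω x y (Real.sqrt m * ‖y - x‖) := by
  have hd : ∀ s : ℝ, HasDerivAt (fun s : ℝ => x + s * (y - x)) (y - x) s := fun s => by
    simpa using (((hasDerivAt_id s).ofReal_comp).mul_const (y - x)).const_add x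
  have hc : ContDiff ℝ 1 (fun s : ℝ => x + s * (y - x)) := by
    refine contDiff_const.add (ContDiff.mul ?_ contDiff_const)
    exact Complex.ofRealCLM.contDiff
  refine ⟨_, hc, fun s hs => (hseg s hs).1, by simp, by simp, ?_⟩
  unfold curveLength
  have : ∫ s in (0:ℝ)..1, Real.sqrt m * ‖y - x‖ = Real.sqrt m * ‖y - x‖ := by simp
  rw [← this]
  refine intervalIntegral.integral_mono_on zero_le_one
    (intervalIntegrable_speed hv hc zero_le_one fun s hs => (hseg s hs).1) (by simp) ?_
  intro s hs
  rw [(hd s).deriv]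
  gcongr
  exact (hseg s hs).2

lemma reach_of_mem_closedBall {m ρ : ℝ} (hv : ContinuousOn v Ω)
    (hB : ∀ w ∈ closedBall x ρ, w ∈ Ω ∧ v w ≤ m) (hy : y ∈ closedBall x ρ) :
    Reach v Ω x y (Real.sqrt m * ‖y - x‖) := by
  refine reach_segment hv fun s hs => hB _ ?_
  rw [mem_closedBall, dist_eq_norm] at hy ⊢
  simp only [add_sub_cancel_left, norm_mul, Complex.norm_real, Real.norm_of_nonneg hs.1]
  nlinarith [hs.1, hs.2, norm_nonneg (y - x)]

/-- Short paths starting in a small ball stay in a slightly larger one. -/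
lemma Reach.dist_lt {m e : ℝ} (hv : ContinuousOn v Ω) (hm : 0 < m) (he : 0 < e)
    (hB : ∀ w ∈ closedBall x e, m ≤ v w) (h : Reach v Ω x y L) (hL : L < Real.sqrt m * e) :
    dist y x < e := by
  obtain ⟨γ, h1, h2, h3, h4, h5⟩ := h
  by_contra hcon
  rw [not_lt] at hcon
  set S := {s ∈ Icc (0:ℝ) 1 | e ≤ dist (γ s) x} with hS
  have hSc : IsCompact S := by
    refine isCompact_Icc.of_isClosed_subset ?_ (sep_subset _ _)
    exact isClosed_Icc.inter (isClosed_le continuous_const (h1.continuous.dist continuous_const))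
  obtain ⟨s, hsS, hs⟩ := hSc.exists_isLeast ⟨1, by simp, by rw [h4]; exact hcon⟩
  have hs0 := hsS.1.1
  have hball : ∀ r ∈ Icc 0 s, γ r ∈ closedBall x e := by
    have hcl : Icc 0 s ⊆ {r | dist (γ r) x ≤ e} := by
      rcases hs0.eq_or_lt with h0 | h0
      · rw [← h0]; simp only [Icc_self, singleton_subset_iff, mem_ofPred_eq, h3, dist_self]
        exact he.le
      · rw [← closure_Ico h0.ne]
        refine closure_minimal (fun r hr => ?_)
          (isClosed_le (h1.continuous.dist continuous_const) continuous_const)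
        by_contra hr'
        exact absurd (hs ⟨⟨hr.1, hr.2.le.trans hsS.1.2⟩, (not_le.1 hr').le⟩) (not_le.2 hr.2)
    exact fun r hr => hcl hr
  have hΩ : ∀ r ∈ Icc 0 s, γ r ∈ Ω := fun r hr => h2 r ⟨hr.1, hr.2.trans hsS.1.2⟩
  have hle : curveLength v γ 0 s ≤ curveLength v γ 0 1 := by
    rw [← curveLength_add hv h1 hs0 hsS.1.2 h2]
    linarith [curveLength_nonneg (v := v) (γ := γ) hsS.1.2]
  have hnorm : e ≤ ∫ r in (0:ℝ)..s, ‖deriv γ r‖ := by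
    have hI : IntervalIntegrable (deriv γ) volume 0 s :=
      (h1.continuous_deriv le_rfl).intervalIntegrable _ _
    have := intervalIntegral.integral_deriv_eq_sub (f := γ) (a := 0) (b := s)
      (fun r _ => h1.differentiable one_ne_zero r) hI
    calc e ≤ dist (γ s) x := hsS.2
      _ = ‖∫ r in (0:ℝ)..s, deriv γ r‖ := by rw [this, h3, dist_eq_norm]
      _ ≤ _ := intervalIntegral.norm_integral_le_integral_norm hs0
  have : Real.sqrt m * e ≤ curveLength v γ 0 s := by
    calc Real.sqrt m * e ≤ Real.sqrt m * ∫ r in (0:ℝ)..s, ‖deriv γ r‖ := by gcongr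
      _ = ∫ r in (0:ℝ)..s, Real.sqrt m * ‖deriv γ r‖ := by
        rw [intervalIntegral.integral_const_mul]
      _ ≤ _ := by
        refine intervalIntegral.integral_mono_on hs0 ?_
          (intervalIntegrable_speed hv h1 hs0 hΩ) fun r hr => ?_
        · exact (continuous_const.mul (h1.continuous_deriv le_rfl).norm).intervalIntegrable _ _
        · gcongr
          exact hB _ (hball r hr)
  linarith

end Curves

section HopfRinow

variable {v : ℂ → ℝ} {Ω : Set ℂ} {γ : ℝ → ℂ} {x y z : ℂ} {a b L L' : ℝ}

lemma exists_contDiff_extension (hγ : ContDiffOn ℝ 1 γ (Icc 0 1)) :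
    ∃ σ : ℝ → ℂ, ContDiff ℝ 1 σ ∧ EqOn σ γ (Icc 0 1) := by
  set g := derivWithin γ (Icc (0:ℝ) 1)
  have hg : ContinuousOn g (Icc 0 1) :=
    hγ.continuousOn_derivWithin (uniqueDiffOn_Icc zero_lt_one) le_rfl
  set G : ℝ → ℂ := IccExtend zero_le_one ((Icc (0:ℝ) 1).domRestrict g)
  have hG : Continuous G := (continuousOn_iff_continuous_domRestrict.1 hg).Icc_extend'
  have hGg : ∀ s ∈ Icc (0:ℝ) 1, G s = g s := fun s hs => by
    simp only [G, IccExtend_of_mem _ _ hs]; rfl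
  have hder : ∀ s, HasDerivAt (fun s => γ 0 + ∫ r in (0:ℝ)..s, G r) (G s) s := fun s =>
    (intervalIntegral.integral_hasDerivAt_right (hG.intervalIntegrable _ _)
      (hG.stronglyMeasurableAtFilter _ _) hG.continuousAt).const_add _
  refine ⟨fun s => γ 0 + ∫ r in (0:ℝ)..s, G r, ?_, fun s hs => ?_⟩
  · rw [contDiff_one_iff_deriv]
    refine ⟨fun s => (hder s).differentiableAt, ?_⟩
    rw [show deriv (fun s => γ 0 + ∫ r in (0:ℝ)..s, G r) = G from funext fun s => (hder s).deriv]
    exact hG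
  · have := intervalIntegral.integral_eq_sub_of_hasDerivAt_of_le (f := γ) (f' := G) hs.1
      (hγ.continuousOn.mono (Icc_subset_Icc_right hs.2)) (fun r hr => ?_)
      (hG.intervalIntegrable _ _)
    · simp only [this]; ring
    · have hr' : r ∈ Ioo (0:ℝ) 1 := ⟨hr.1, hr.2.trans_le hs.2⟩
      rw [hGg r (Ioo_subset_Icc_self hr')]
      exact ((hγ.differentiableOn one_ne_zero) r
        (Ioo_subset_Icc_self hr')).hasDerivWithinAt.hasDerivAt (Icc_mem_nhds hr'.1 hr'.2)

lemma integral_derivWithin_eq_curveLength {σ : ℝ → ℂ} (h : EqOn σ γ (Icc 0 1)) :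
    ∫ s in (0:ℝ)..1, Real.sqrt (v (γ s)) * ‖derivWithin γ (Icc 0 1) s‖ =
      curveLength v σ 0 1 := by
  refine intervalIntegral.integral_congr_ae' ?_ ?_
  · filter_upwards [compl_mem_ae_iff.2 (measure_singleton (1:ℝ))] with s hs hs'
    have hlt : s < 1 := lt_of_le_of_ne hs'.2 hs
    have hn : Icc (0:ℝ) 1 ∈ nhds s := Icc_mem_nhds hs'.1 hlt
    have hev : γ =ᶠ[nhds s] σ := by
      filter_upwards [hn] with r hr using (h hr).symm
    rw [derivWithin_of_mem_nhds hn, hev.deriv_eq, hev.eq_of_nhds]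
  · exact Eventually.of_forall fun s hs => absurd (hs.1.trans_le hs.2) (by norm_num)

lemma Reach.confDist_le (h : Reach v Ω x y L) : confDist v Ω x y ≤ L := by
  obtain ⟨γ, h1, h2, h3, h4, h5⟩ := h
  rw [confDist]
  refine (csInf_le (a := ∫ s in (0:ℝ)..1, Real.sqrt (v (γ s)) * ‖derivWithin γ (Icc 0 1) s‖)
    ⟨0, ?_⟩ (by exact ⟨γ, h1.contDiffOn, h2, h3, h4, rfl⟩)).trans ?_
  · rintro _ ⟨σ, -, -, -, -, rfl⟩
    exact intervalIntegral.integral_nonneg zero_le_one fun s _ => by positivity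
  · rw [integral_derivWithin_eq_curveLength (fun _ _ => rfl)]; exact h5

lemma reach_of_confDist_lt (h0 : Reach v Ω x y L') (h : confDist v Ω x y < L) :
    Reach v Ω x y L := by
  obtain ⟨γ, h1, h2, h3, h4, -⟩ := h0
  rw [confDist] at h
  obtain ⟨_, ⟨σ, g1, g2, g3, g4, rfl⟩, hlt⟩ := exists_lt_of_csInf_lt (by
    exact ⟨_, γ, h1.contDiffOn, h2, h3, h4, rfl⟩) h
  obtain ⟨σ', c1, c2⟩ := exists_contDiff_extension g1
  rw [integral_derivWithin_eq_curveLength c2] at hlt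
  exact ⟨σ', c1, fun s hs => c2 hs ▸ g2 s hs, by rw [c2 (by simp), g3],
    by rw [c2 (by simp), g4], hlt.le⟩

lemma Reach.mem_component (h : Reach v Ω x y L) : y ∈ connectedComponentIn Ω x := by
  obtain ⟨γ, h1, h2, h3, h4, -⟩ := h
  have hp : IsPreconnected (γ '' Icc 0 1) :=
    isPreconnected_Icc.image _ h1.continuous.continuousOn
  exact hp.subset_connectedComponentIn ⟨0, by simp, h3⟩ (image_subset_iff.2 h2)
    ⟨1, by simp, h4⟩

/-- Points close to `x` are reached from `x` by short paths. -/
lemma eventually_reach (hΩ : IsOpen Ω) (hv : ContinuousOn v Ω) (hx : x ∈ Ω) (hL : 0 < L) :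
    ∀ᶠ y in nhds x, Reach v Ω x y L := by
  have hcont : ∀ᶠ y in nhds x, v y < v x + 1 :=
    (hv.continuousAt (hΩ.mem_nhds hx)).eventually_lt_const (by linarith)
  obtain ⟨ρ, hρ, hB⟩ := nhds_basis_closedBall.eventually_iff.1 (hcont.and (hΩ.mem_nhds hx))
  have hlim : Tendsto (fun y : ℂ => Real.sqrt (v x + 1) * ‖y - x‖) (nhds x) (nhds 0) := by
    have : Continuous (fun y : ℂ => Real.sqrt (v x + 1) * ‖y - x‖) := by fun_prop
    simpa using this.tendsto x
  filter_upwards [hlim.eventually_lt_const hL, closedBall_mem_nhds x hρ] with y hy hyB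
  exact (reach_of_mem_closedBall hv (fun w hw => ⟨(hB hw).2, (hB hw).1.le⟩) hyB).mono hy.le

lemma exists_reach_of_mem_component (hΩ : IsOpen Ω) (hv : ContinuousOn v Ω)
    (h : y ∈ connectedComponentIn Ω x) : ∃ L, Reach v Ω x y L := by
  have hx : x ∈ Ω := by
    by_contra hx
    rw [connectedComponentIn_eq_empty hx] at h
    exact h
  have hpre : IsPreconnected (connectedComponentIn Ω x) := isPreconnected_connectedComponentIn
  set S := {z | ∃ L, Reach v Ω x z L} with hS
  have hopen : IsOpen S := by
    rw [isOpen_iff_mem_nhds]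
    rintro z ⟨L, hL⟩
    filter_upwards [eventually_reach hΩ hv hL.mem_right zero_lt_one] with w hw
    exact ⟨_, hL.trans hv hw⟩
  have hsub : connectedComponentIn Ω x ⊆ S := by
    refine hpre.subset_of_closure_inter_subset hopen
      ⟨x, mem_connectedComponentIn hx, 0, Reach.refl hx le_rfl⟩ ?_
    rintro z ⟨hz, hzc⟩
    have hzΩ := connectedComponentIn_subset _ _ hzc
    obtain ⟨w, hw, L, hL⟩ := mem_closure_iff_nhds.1 hz _
      (eventually_reach hΩ hv hzΩ zero_lt_one)
    exact ⟨_, hL.trans hv (Reach.symm hw)⟩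
  exact hsub h

/-- Paths shorter than a uniform constant starting near `x` do not leave a small ball. -/
lemma exists_confining_radius (hv : ContinuousOn v Ω) (hpos : ∀ z ∈ Ω, 0 < v z) {e : ℝ}
    (he : 0 < e) (heΩ : closedBall x (2 * e) ⊆ Ω) :
    ∃ r > 0, ∀ y ∈ closedBall x e, ∀ z, Reach v Ω y z r → dist z y < e := by
  obtain ⟨w, hw, hmin⟩ := (isCompact_closedBall x (2 * e)).exists_isMinOn
    ⟨x, by simp [he.le]⟩ (hv.mono heΩ)
  have hm := hpos w (heΩ hw)
  refine ⟨Real.sqrt (v w) * e / 2, by positivity, fun y hy z h => ?_⟩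
  refine h.dist_lt hv hm he (fun ζ hζ => hmin ?_) ?_
  · rw [mem_closedBall] at *
    linarith [dist_triangle ζ y x]
  · have : 0 < Real.sqrt (v w) * e := by positivity
    linarith

/-- `Good v Ω x r`: all points reached from `x` by paths of length `r` stay in a compact set. -/
def Good (v : ℂ → ℝ) (Ω : Set ℂ) (x : ℂ) (r : ℝ) : Prop :=
  ∃ K : Set ℂ, IsCompact K ∧ K ⊆ Ω ∧ ∀ z, Reach v Ω x z r → z ∈ K

lemma Good.mono (h : Good v Ω x L) (hL : L' ≤ L) : Good v Ω x L' := by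
  obtain ⟨K, h1, h2, h3⟩ := h
  exact ⟨K, h1, h2, fun z hz => h3 z (hz.mono hL)⟩

lemma eventually_good (hΩ : IsOpen Ω) (hv : ContinuousOn v Ω) (hpos : ∀ z ∈ Ω, 0 < v z)
    (hx : x ∈ Ω) : ∃ e > 0, ∃ r > 0, (∀ y ∈ closedBall x e, Good v Ω y r) ∧
      ∀ y, Reach v Ω x y r → y ∈ closedBall x e := by
  obtain ⟨ρ, hρ, hB⟩ := nhds_basis_closedBall.mem_iff.1 (hΩ.mem_nhds hx)
  have hB' : closedBall x (2 * (ρ / 2)) ⊆ Ω := by convert hB using 2; ring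
  obtain ⟨r, hr, h⟩ := exists_confining_radius hv hpos (half_pos hρ) hB'
  refine ⟨ρ / 2, half_pos hρ, r, hr, fun y hy => ⟨_, isCompact_closedBall x (2 * (ρ / 2)), hB',
    fun z hz => ?_⟩, fun y hy => ?_⟩
  · have h1 := h y hy z hz
    rw [mem_closedBall] at *
    linarith [dist_triangle z y x]
  · exact (h x (mem_closedBall_self (half_pos hρ).le) y hy).le

lemma Good.extend (hΩ : IsOpen Ω) (hv : ContinuousOn v Ω) {A : ℝ} (hA : 0 < A) (ha : 0 ≤ a)
    (haA : a ≤ A) (h : ∀ y, Reach v Ω x y A → Good v Ω y (A / 2)) (hg : Good v Ω x a) :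
    Good v Ω x (a + A / 4) := by
  obtain ⟨K, hK, hKΩ, hKz⟩ := hg
  set Y := {y | Reach v Ω x y a}
  have hYK : closure Y ⊆ K := closure_minimal hKz hK.isClosed
  have hYc : IsCompact (closure Y) := hK.of_isClosed_subset isClosed_closure hYK
  have key : ∃ K' : Set ℂ, IsCompact K' ∧ K' ⊆ Ω ∧
      ∀ y ∈ closure Y, ∀ z, Reach v Ω y z (A / 4) → z ∈ K' := by
    refine hYc.induction_on (p := fun s => ∃ K' : Set ℂ, IsCompact K' ∧ K' ⊆ Ω ∧
      ∀ y ∈ s, ∀ z, Reach v Ω y z (A / 4) → z ∈ K') ?_ ?_ ?_ ?_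
    · exact ⟨∅, isCompact_empty, empty_subset _, by simp⟩
    · rintro s t hst ⟨K', h1, h2, h3⟩
      exact ⟨K', h1, h2, fun y hy => h3 y (hst hy)⟩
    · rintro s t ⟨K', h1, h2, h3⟩ ⟨K'', g1, g2, g3⟩
      refine ⟨K' ∪ K'', h1.union g1, union_subset h2 g2, ?_⟩
      rintro y (hy | hy) z hz
      · exact Or.inl (h3 y hy z hz)
      · exact Or.inr (g3 y hy z hz)
    · intro y hy
      have hyΩ : y ∈ Ω := hKΩ (hYK hy)
      have hev := eventually_reach hΩ hv hyΩ (show 0 < A / 16 by positivity)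
      obtain ⟨y', hy', hy'Y⟩ := mem_closure_iff_nhds.1 hy _ hev
      obtain ⟨K', h1, h2, h3⟩ := h y' (Reach.mono hy'Y haA)
      refine ⟨_, mem_nhdsWithin_of_mem_nhds hev, K', h1, h2, fun w hw z hz => h3 z ?_⟩
      exact (((Reach.symm hy').trans hv hw).trans hv hz).mono (by linarith)
  obtain ⟨K', h1, h2, h3⟩ := key
  refine ⟨K', h1, h2, fun z hz => ?_⟩
  obtain ⟨y, hy, hyz⟩ := Reach.split hv ha (by positivity) hz
  exact h3 y (subset_closure hy) z hyz

lemma exists_not_good (hΩ : IsOpen Ω) (hv : ContinuousOn v Ω) {A : ℝ} (hA : 0 < A)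
    (hx : x ∈ Ω) (h : ¬ Good v Ω x A) : ∃ y, Reach v Ω x y A ∧ ¬ Good v Ω y (A / 2) := by
  by_contra! hcon
  have h0 := hcon x (Reach.refl hx hA.le)
  have h1 := Good.extend hΩ hv hA (by positivity) (by linarith) hcon h0
  have h2 := Good.extend hΩ hv hA (by positivity) (by linarith) hcon h1
  exact h (h2.mono (by linarith))

/-- Hopf–Rinow: in a complete conformal metric, paths of bounded length from a given point stay
in a compact set. -/
theorem good_of_confComplete (hΩ : IsOpen Ω) (hv : ContinuousOn v Ω) (hpos : ∀ z ∈ Ω, 0 < v z)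
    (hc : ConfComplete v Ω) (hx : x ∈ Ω) (A : ℝ) : Good v Ω x A := by
  wlog hA : 0 < A generalizing A
  · exact (this 1 one_pos).mono (by linarith)
  by_contra hbad
  have step : ∀ p : {p : ℂ × ℝ // 0 < p.2 ∧ p.1 ∈ Ω ∧ ¬ Good v Ω p.1 p.2},
      ∃ q : {p : ℂ × ℝ // 0 < p.2 ∧ p.1 ∈ Ω ∧ ¬ Good v Ω p.1 p.2},
        q.1.2 = p.1.2 / 2 ∧ Reach v Ω p.1.1 q.1.1 p.1.2 := by
    rintro ⟨⟨y, r⟩, hr, hy, hg⟩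
    obtain ⟨z, hz, hgz⟩ := exists_not_good hΩ hv hr hy hg
    exact ⟨⟨⟨z, r / 2⟩, half_pos hr, hz.mem_right, hgz⟩, rfl, hz⟩
  choose f hf1 hf2 using step
  set p : ℕ → {p : ℂ × ℝ // 0 < p.2 ∧ p.1 ∈ Ω ∧ ¬ Good v Ω p.1 p.2} :=
    fun n => f^[n] ⟨⟨x, A⟩, hA, hx, hbad⟩ with hp
  have hp1 : ∀ n, p (n + 1) = f (p n) := fun n => Function.iterate_succ_apply' f n _
  have hr : ∀ n, (p n).1.2 = A / 2 ^ n := by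
    intro n
    induction n with
    | zero => simp [hp]
    | succ n ih => rw [hp1, hf1, ih]; field_simp; ring
  have hreach : ∀ m k, Reach v Ω (p m).1.1 (p (m + k)).1.1 (2 * A / 2 ^ m - 2 * A / 2 ^ (m + k)) := by
    intro m k
    induction k with
    | zero => simpa using Reach.refl (p m).2.2.1 le_rfl
    | succ k ih =>
      have := hf2 (p (m + k))
      rw [← hp1, hr] at this
      refine (ih.trans hv this).mono (le_of_eq ?_)
      rw [← add_assoc, pow_succ]; field_simp; ring
  have hreach' : ∀ N m n, N ≤ m → N ≤ n → Reach v Ω (p m).1.1 (p n).1.1 (2 * A / 2 ^ N) := by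
    intro N m n hm hn
    wlog hmn : m ≤ n generalizing m n
    · exact (this n m hn hm (by omega)).symm
    obtain ⟨k, rfl⟩ := Nat.exists_eq_add_of_le hmn
    refine (hreach m k).mono ?_
    have h1 : 0 ≤ 2 * A / 2 ^ (m + k) := by positivity
    have h2 : 2 * A / 2 ^ m ≤ 2 * A / 2 ^ N := by
      gcongr
      norm_num
    linarith
  have hlim : Tendsto (fun N : ℕ => 2 * A / 2 ^ N) atTop (nhds 0) := by
    have := (tendsto_pow_atTop_nhds_zero_of_lt_one (r := (1/2 : ℝ)) (by norm_num)
      (by norm_num)).const_mul (2 * A)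
    simpa [div_eq_mul_inv] using this
  obtain ⟨l, hl, hlt⟩ := hc x hx (fun n => (p n).1.1)
    (fun n => (hreach' 0 0 n le_rfl (Nat.zero_le n)).mem_component) (fun ε hε => by
      obtain ⟨N, hN⟩ := (hlim.eventually_lt_const hε).exists
      exact ⟨N, fun m hm n hn => (hreach' N m n hm hn).confDist_le.trans_lt hN⟩)
  have hlΩ := connectedComponentIn_subset _ _ hl
  obtain ⟨e, he, r, hr0, hgood, hconf⟩ := eventually_good hΩ hv hpos hlΩ
  obtain ⟨n, hn1, hn2⟩ := ((hlt.eventually_lt_const hr0).and (hlim.eventually_lt_const hr0)).exists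
  obtain ⟨L, hL⟩ := exists_reach_of_mem_component hΩ hv hl
  have hnl : Reach v Ω (p n).1.1 l r := reach_of_confDist_lt
    ((hreach' 0 n 0 (Nat.zero_le n) le_rfl).trans hv hL) hn1
  refine (p n).2.2.2 ((hgood _ (hconf _ hnl.symm)).mono ?_)
  rw [hr]
  have : 0 < A / 2 ^ n := by positivity
  have : 2 * A / 2 ^ n = 2 * (A / 2 ^ n) := by ring
  linarith

end HopfRinow

section Tube

variable {T : ℝ} {M : Set (ℂ × ℝ)} {u : ℂ → ℝ → ℝ}

lemma ConfRFS.isOpen_timeSlice (hR : ConfRFS T M u) (t : ℝ) : IsOpen (timeSlice M t) :=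
  hR.opn.preimage (by fun_prop : Continuous fun z : ℂ => (z, t))

lemma ConfRFS.continuousOn_slice (hR : ConfRFS T M u) (t : ℝ) :
    ContinuousOn (fun z => u z t) (timeSlice M t) :=
  hR.smooth.continuousOn.comp (f := fun z : ℂ => (z, t)) (by fun_prop) fun _ hz => hz

/-- A path of controlled length which starts in `K` and is forced to stay in `K` as long as it
stays in the larger set `K'` ends in `K'`. -/
lemma Reach.mem_of_confined {v v' : ℂ → ℝ} {Ω Ω' K K' : Set ℂ} {x z : ℂ} {A A' c : ℝ}
    (hv : ContinuousOn v Ω) (hv' : ContinuousOn v' Ω') (hc : 0 ≤ c) (hA : c * A ≤ A')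
    (hK' : IsClosed K') (hKK : K ⊆ interior K') (hΩ' : K' ⊆ Ω') (hx : x ∈ K)
    (hvv : ∀ w ∈ K', Real.sqrt (v' w) ≤ c * Real.sqrt (v w))
    (hK : ∀ w, Reach v' Ω' x w A' → w ∈ K) (h : Reach v Ω x z A) : z ∈ K' := by
  obtain ⟨γ, h1, h2, h3, h4, h5⟩ := h
  by_contra hcon
  set S := {s ∈ Icc (0:ℝ) 1 | γ s ∈ (interior K')ᶜ} with hS
  have hSc : IsCompact S := by
    refine isCompact_Icc.of_isClosed_subset ?_ (fun s hs => hs.1)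
    exact isClosed_Icc.inter (isOpen_interior.isClosed_compl.preimage h1.continuous)
  obtain ⟨s, hsS, hs⟩ := hSc.exists_isLeast
    ⟨1, by simp, by rw [h4]; exact fun hi => hcon (interior_subset hi)⟩
  have hs0 := hsS.1.1
  have hball : ∀ r ∈ Icc 0 s, γ r ∈ K' := by
    have hcl : Icc 0 s ⊆ γ ⁻¹' K' := by
      rcases hs0.eq_or_lt with h0 | h0
      · rw [← h0]
        simp only [Icc_self, singleton_subset_iff, mem_preimage, h3]
        exact interior_subset (hKK hx)
      · rw [← closure_Ico h0.ne]
        refine closure_minimal (fun r hr => ?_) (hK'.preimage h1.continuous)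
        by_contra hr'
        exact absurd (hs ⟨⟨hr.1, hr.2.le.trans hsS.1.2⟩, fun hi => hr' (mem_preimage.2 (interior_subset hi))⟩)
          (not_le.2 hr.2)
    exact fun r hr => hcl hr
  have hΩ : ∀ r ∈ Icc 0 s, γ r ∈ Ω := fun r hr => h2 r ⟨hr.1, hr.2.trans hsS.1.2⟩
  have hle : curveLength v γ 0 s ≤ curveLength v γ 0 1 := by
    rw [← curveLength_add hv h1 hs0 hsS.1.2 h2]
    linarith [curveLength_nonneg (v := v) (γ := γ) hsS.1.2]
  have hlen : curveLength v' γ 0 s ≤ c * curveLength v γ 0 s := by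
    unfold curveLength
    rw [← intervalIntegral.integral_const_mul]
    refine intervalIntegral.integral_mono_on hs0
      (intervalIntegrable_speed hv' h1 hs0 fun r hr => hΩ' (hball r hr))
      ((intervalIntegrable_speed hv h1 hs0 hΩ).const_mul c) fun r hr => ?_
    rw [← mul_assoc]
    gcongr
    exact hvv _ (hball r hr)
  have hreach : Reach v' Ω' x (γ s) A' := by
    rw [← h3]
    refine Reach.of_interval hv' h1 hs0 (fun r hr => hΩ' (hball r hr)) ?_
    calc _ ≤ c * curveLength v γ 0 s := hlen
      _ ≤ c * A := by gcongr; linarith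
      _ ≤ A' := hA
  exact hsS.2 (hKK (hK _ hreach))

/-- In a complete expanding spacetime, the points reached by paths of bounded length from a fixed
point during a compact time interval form a relatively compact subset of the spacetime. -/
theorem exists_tube (hR : ConfRFS T M u) (hC : ConfRFSComplete T M u) (hE : Expanding T M)
    {z₀ : ℂ} {s₀ t₁ : ℝ} (hz₀ : (z₀, s₀) ∈ M) (ht₁ : t₁ < T) (A : ℝ) :
    ∃ K : Set (ℂ × ℝ), IsCompact K ∧ K ⊆ M ∧ ∀ t ∈ Icc s₀ t₁, ∀ z,
      Reach (fun z => u z t) (timeSlice M t) z₀ z A → (z, t) ∈ K := by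
  wlog hA : 0 < A generalizing A
  · obtain ⟨K, h1, h2, h3⟩ := this 1 one_pos
    exact ⟨K, h1, h2, fun t ht z hz => h3 t ht z (hz.mono (by linarith))⟩
  refine (isCompact_Icc (a := s₀) (b := t₁)).induction_on (p := fun S => ∃ K : Set (ℂ × ℝ),
    IsCompact K ∧ K ⊆ M ∧ ∀ t ∈ S, ∀ z,
      Reach (fun z => u z t) (timeSlice M t) z₀ z A → (z, t) ∈ K) ?_ ?_ ?_ ?_
  · exact ⟨∅, isCompact_empty, empty_subset _, by simp⟩
  · rintro s t hst ⟨K', h1, h2, h3⟩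
    exact ⟨K', h1, h2, fun y hy => h3 y (hst hy)⟩
  · rintro s t ⟨K', h1, h2, h3⟩ ⟨K'', g1, g2, g3⟩
    refine ⟨K' ∪ K'', h1.union g1, union_subset h2 g2, ?_⟩
    rintro y (hy | hy) z hz
    · exact Or.inl (h3 y hy z hz)
    · exact Or.inr (g3 y hy z hz)
  · intro t' ht'
    have hz' : z₀ ∈ timeSlice M t' := hE _ _ _ hz₀ ht'.1 (ht'.2.trans_lt ht₁)
    have hI : t' ∈ Ioo 0 T := hR.sub hz'
    obtain ⟨K, hK, hKM, hKr⟩ := good_of_confComplete (hR.isOpen_timeSlice t')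
      (hR.continuousOn_slice t') (fun z hz => hR.pos _ hz) (hC t' hI) hz' (A + 1)
    obtain ⟨K', hK', hKK', hK'M⟩ := exists_compact_between hK (hR.isOpen_timeSlice t') hKM
    have hev : ∀ᶠ t in nhds t', ∀ z ∈ K', (z, t) ∈ M ∧
        Real.sqrt (u z t') ≤ (A + 1) / A * Real.sqrt (u z t) := by
      refine hK'.eventually_forall_of_forall_eventually
        (P := fun t z => (z, t) ∈ M ∧ Real.sqrt (u z t') ≤ (A + 1) / A * Real.sqrt (u z t))
        fun z hz => ?_
      have hzM : (z, t') ∈ M := hK'M hz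
      have hsw : Tendsto (fun q : ℝ × ℂ => (q.2, q.1)) (nhds (t', z)) (nhds (z, t')) :=
        Continuous.tendsto' (by fun_prop) _ _ rfl
      have hu1 : Tendsto (fun q : ℝ × ℂ => Real.sqrt (u q.2 q.1)) (nhds (t', z))
          (nhds (Real.sqrt (u z t'))) :=
        (((hR.smooth.continuousOn.continuousAt (hR.opn.mem_nhds hzM)).sqrt).tendsto).comp hsw
      have hu2 : Tendsto (fun q : ℝ × ℂ => Real.sqrt (u q.2 t')) (nhds (t', z))
          (nhds (Real.sqrt (u z t'))) := by
        have h1 : ContinuousAt (fun z => Real.sqrt (u z t')) z :=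
          ((hR.continuousOn_slice t').continuousAt
            ((hR.isOpen_timeSlice t').mem_nhds hzM)).sqrt
        exact Tendsto.comp (f := fun q : ℝ × ℂ => q.2) h1 (Continuous.tendsto' (by fun_prop) _ _ rfl)
      refine (hsw.eventually (hR.opn.mem_nhds hzM)).and ?_
      have hs : 0 < Real.sqrt (u z t') := Real.sqrt_pos.2 (hR.pos _ hzM)
      have := (hu1.const_mul ((A + 1) / A)).sub hu2
      refine (this.eventually_const_lt (u := 0) ?_).mono fun q hq => by linarith
      have h1 : (A + 1) / A - 1 = 1 / A := by field_simp; ring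
      have : (A + 1) / A * Real.sqrt (u z t') - Real.sqrt (u z t') = 1 / A * Real.sqrt (u z t') := by
        rw [← h1]; ring
      rw [this]; positivity
    obtain ⟨δ, hδ, hδM⟩ := nhds_basis_closedBall.mem_iff.1 hev
    refine ⟨_, mem_nhdsWithin_of_mem_nhds (closedBall_mem_nhds t' hδ), K' ×ˢ closedBall t' δ,
      hK'.prod (isCompact_closedBall _ _), fun q hq => (hδM hq.2 q.1 hq.1).1,
      fun t ht z hz => ⟨?_, ht⟩⟩
    refine Reach.mem_of_confined (hR.continuousOn_slice t) (hR.continuousOn_slice t')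
      (by positivity : 0 ≤ (A + 1) / A) (by field_simp; exact le_rfl) hK'.isClosed hKK' hK'M
      (hKr _ (Reach.refl hz' (by positivity))) (fun w hw => (hδM ht w hw).2) hKr hz

end Tube

section Taylor

lemma taylor_two_bound {φ φ' φ'' : ℝ → ℝ} {C : ℝ}
    (h1 : ∀ s ∈ Icc (0:ℝ) 1, HasDerivAt φ (φ' s) s)
    (h2 : ∀ s ∈ Icc (0:ℝ) 1, HasDerivAt φ' (φ'' s) s)
    (h3 : ∀ s ∈ Icc (0:ℝ) 1, |φ'' s - φ'' 0| ≤ C) :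
    |φ 1 - φ 0 - φ' 0 - φ'' 0 / 2| ≤ C := by
  have hC : 0 ≤ C := (abs_nonneg _).trans (h3 0 (by simp))
  have step1 : ∀ s ∈ Icc (0:ℝ) 1, |φ' s - φ' 0 - s * φ'' 0| ≤ C := fun s hs => by
    have := (convex_Icc (0:ℝ) 1).norm_image_sub_le_of_norm_hasDerivWithin_le
      (f := fun s => φ' s - s * φ'' 0) (f' := fun s => φ'' s - φ'' 0) (C := C) (x := 0) (y := s)
      (fun r hr => by
        have e := ((h2 r hr).sub ((hasDerivAt_id r).mul_const (φ'' 0))).hasDerivWithinAt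
          (s := Icc 0 1)
        rw [one_mul] at e
        exact e)
      (fun r hr => by simpa using h3 r hr) (by simp) hs
    simp only [Real.norm_eq_abs, sub_zero, zero_mul, abs_of_nonneg hs.1] at this
    calc |φ' s - φ' 0 - s * φ'' 0| = |φ' s - s * φ'' 0 - φ' 0| := by ring_nf
      _ ≤ C * s := this
      _ ≤ C := by nlinarith [hs.2]
  have := (convex_Icc (0:ℝ) 1).norm_image_sub_le_of_norm_hasDerivWithin_le
      (f := fun s => φ s - s * φ' 0 - s ^ 2 / 2 * φ'' 0)
      (f' := fun s => φ' s - φ' 0 - s * φ'' 0) (C := C) (x := 0) (y := 1)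
      (fun r hr => by
        have e := (((h1 r hr).sub ((hasDerivAt_id r).mul_const (φ' 0))).sub
          ((((hasDerivAt_id r).pow 2).div_const 2).mul_const (φ'' 0))).hasDerivWithinAt (s := Icc 0 1)
        have h : φ' r - φ' 0 - r * φ'' 0 =
            φ' r - 1 * φ' 0 - (2:ℕ) * id r ^ (2 - 1) * 1 / 2 * φ'' 0 := by simp
        rw [h]
        exact e)
      (fun r hr => by simpa using step1 r hr) (by simp) (by simp)
  simp only [Real.norm_eq_abs] at this
  calc _ = |φ 1 - 1 * φ' 0 - 1 ^ 2 / 2 * φ'' 0 - (φ 0 - 0 * φ' 0 - 0 ^ 2 / 2 * φ'' 0)| := by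
        ring_nf
    _ ≤ C * |1 - 0| := this
    _ = C := by norm_num

variable {E : Type*} [NormedAddCommGroup E] [NormedSpace ℝ E]

lemma exists_bound_and_lipschitz {F : Type*} [NormedAddCommGroup F] [NormedSpace ℝ F] {g : E → F}
    {M K : Set E} (hM : IsOpen M) (hg : ContDiffOn ℝ (⊤ : ℕ∞) g M) (hK : IsCompact K)
    (hKM : K ⊆ M) :
    ∃ C, (∀ x ∈ K, ‖g x‖ ≤ C) ∧ ∀ p r, closedBall p r ⊆ K →
      ∀ x ∈ closedBall p r, ∀ y ∈ closedBall p r, ‖g y - g x‖ ≤ C * ‖y - x‖ := by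
  have hg1 : ContDiffOn ℝ (⊤ : ℕ∞) (fderiv ℝ g) M := hg.fderiv_of_isOpen hM (by simp)
  obtain ⟨C1, hC1⟩ := hK.exists_bound_of_continuousOn (hg.continuousOn.mono hKM)
  obtain ⟨C2, hC2⟩ := hK.exists_bound_of_continuousOn (hg1.continuousOn.mono hKM)
  refine ⟨max C1 C2, fun x hx => (hC1 x hx).trans (le_max_left _ _), fun p r hp x hx y hy => ?_⟩
  refine (convex_closedBall p r).norm_image_sub_le_of_norm_hasFDerivWithin_le
    (f' := fderiv ℝ g) (fun w hw => ?_) (fun w hw => ?_) hx hy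
  · exact ((hg.contDiffAt (hM.mem_nhds (hKM (hp hw)))).differentiableAt
      (by simp)).hasFDerivAt.hasFDerivWithinAt
  · exact (hC2 w (hp hw)).trans (le_max_right _ _)

/-- Second order Taylor expansion, uniformly on compact sets. -/
theorem exists_taylor [FiniteDimensional ℝ E] {f : E → ℝ} {M K : Set E} (hM : IsOpen M)
    (hf : ContDiffOn ℝ (⊤ : ℕ∞) f M) (hK : IsCompact K) (hKM : K ⊆ M) :
    ∃ C ≥ (0:ℝ), ∃ δ > (0:ℝ), ∀ p ∈ K, ‖fderiv ℝ f p‖ ≤ C ∧ ‖fderiv ℝ (fderiv ℝ f) p‖ ≤ C ∧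
      ∀ v, ‖v‖ ≤ δ → p + v ∈ M ∧
        |f (p + v) - f p - fderiv ℝ f p v - fderiv ℝ (fderiv ℝ f) p v v / 2| ≤ C * ‖v‖ ^ 3 := by
  have : ProperSpace E := FiniteDimensional.proper ℝ E
  obtain ⟨δ, hδ, hδM⟩ := hK.exists_cthickening_subset_open hM hKM
  set K' := cthickening δ K
  have hK' : IsCompact K' := hK.cthickening
  have hKK' : K ⊆ K' := self_subset_cthickening K
  have hf1 : ContDiffOn ℝ (⊤ : ℕ∞) (fderiv ℝ f) M := hf.fderiv_of_isOpen hM (by simp)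
  have hf2 : ContDiffOn ℝ (⊤ : ℕ∞) (fderiv ℝ (fderiv ℝ f)) M := hf1.fderiv_of_isOpen hM (by simp)
  obtain ⟨C1, hC1, -⟩ := exists_bound_and_lipschitz hM hf1 hK' hδM
  obtain ⟨C2, hC2, hC3⟩ := exists_bound_and_lipschitz hM hf2 hK' hδM
  refine ⟨max 0 (max C1 C2), le_max_left _ _, δ, hδ, fun p hp =>
    ⟨(hC1 p (hKK' hp)).trans (by simp), (hC2 p (hKK' hp)).trans (by simp), fun v hv => ?_⟩⟩
  set C := max 0 (max C1 C2)
  have hball : closedBall p δ ⊆ K' := closedBall_subset_cthickening hp δ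
  have hmem : ∀ s ∈ Icc (0:ℝ) 1, p + s • v ∈ closedBall p δ := fun s hs => by
    rw [mem_closedBall, dist_eq_norm, add_sub_cancel_left, norm_smul, Real.norm_of_nonneg hs.1]
    nlinarith [hs.2, norm_nonneg v]
  have hnh : ∀ s ∈ Icc (0:ℝ) 1, M ∈ nhds (p + s • v) := fun s hs =>
    hM.mem_nhds (hδM (hball (hmem s hs)))
  have hline : ∀ s : ℝ, HasDerivAt (fun s : ℝ => p + s • v) v s := fun s => by
    simpa using ((hasDerivAt_id s).smul_const v).const_add p
  refine ⟨by simpa using hδM (hball (hmem 1 (by simp))), ?_⟩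
  have := taylor_two_bound (φ := fun s => f (p + s • v))
    (φ' := fun s => fderiv ℝ f (p + s • v) v)
    (φ'' := fun s => fderiv ℝ (fderiv ℝ f) (p + s • v) v v) (C := C * ‖v‖ ^ 3)
    (fun s hs => ((hf.contDiffAt (hnh s hs)).differentiableAt (by simp)).hasFDerivAt.comp_hasDerivAt
      s (hline s))
    (fun s hs => by
      have := ((hf1.contDiffAt (hnh s hs)).differentiableAt (by simp)).hasFDerivAt.comp_hasDerivAt
        s (hline s)
      simpa using this.clm_apply (hasDerivAt_const s v))
    (fun s hs => by
      have hD : ‖fderiv ℝ (fderiv ℝ f) (p + s • v) - fderiv ℝ (fderiv ℝ f) (p + (0:ℝ) • v)‖ ≤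
          C * ‖(p + s • v) - (p + (0:ℝ) • v)‖ :=
        (hC3 p δ hball _ (hmem 0 (by simp)) _ (hmem s hs)).trans (by gcongr; simp [C])
      have hs' : ‖(p + s • v) - (p + (0:ℝ) • v)‖ ≤ ‖v‖ := by
        rw [zero_smul, add_zero, add_sub_cancel_left, norm_smul, Real.norm_of_nonneg hs.1]
        nlinarith [hs.2, norm_nonneg v]
      have hC0 : 0 ≤ C := le_max_left _ _
      rw [← sub_apply, ← sub_apply, ← Real.norm_eq_abs]
      calc _ ≤ ‖(fderiv ℝ (fderiv ℝ f) (p + s • v) - fderiv ℝ (fderiv ℝ f) (p + (0:ℝ) • v))‖ * ‖v‖ * ‖v‖ :=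
            ContinuousLinearMap.le_opNorm₂ _ _ _
        _ ≤ (C * ‖v‖) * ‖v‖ * ‖v‖ := by
            gcongr
            exact hD.trans (by gcongr)
        _ = _ := by ring)
  simpa using this

end Taylor

section FourPoints

variable {f : ℂ × ℝ → ℝ} {M : Set (ℂ × ℝ)}

lemma lap_slice {z : ℂ} {t : ℝ} (hM : IsOpen M) (hf : ContDiffOn ℝ (⊤ : ℕ∞) f M)
    (h : (z, t) ∈ M) :
    lap (fun w => f (w, t)) z =
      fderiv ℝ (fderiv ℝ f) (z, t) (1, 0) (1, 0) +
        fderiv ℝ (fderiv ℝ f) (z, t) (Complex.I, 0) (Complex.I, 0) := by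
  have hin : ∀ w : ℂ, HasFDerivAt (fun w : ℂ => (w, t)) (ContinuousLinearMap.inl ℝ ℂ ℝ) w :=
    fun w => hasFDerivAt_prodMk_left w t
  have hf1 : ContDiffOn ℝ (⊤ : ℕ∞) (fderiv ℝ f) M := hf.fderiv_of_isOpen hM (by simp)
  have hev : ∀ᶠ w in nhds z, (w, t) ∈ M :=
    (hM.preimage (by fun_prop : Continuous fun w : ℂ => (w, t))).mem_nhds h
  have h1 : fderiv ℝ (fun w => f (w, t)) =ᶠ[nhds z]
      fun w => (fderiv ℝ f (w, t)).comp (ContinuousLinearMap.inl ℝ ℂ ℝ) := by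
    filter_upwards [hev] with w hw
    exact (((hf.contDiffAt (hM.mem_nhds hw)).differentiableAt
      (by simp)).hasFDerivAt.comp w (hin w)).fderiv
  have h2 : HasFDerivAt (fun w => fderiv ℝ f (w, t))
      ((fderiv ℝ (fderiv ℝ f) (z, t)).comp (ContinuousLinearMap.inl ℝ ℂ ℝ)) z :=
    ((hf1.contDiffAt (hM.mem_nhds h)).differentiableAt (by simp)).hasFDerivAt.comp z (hin z)
  have h3 : ∀ a : ℂ, fderiv ℝ (fderiv ℝ (fun w => f (w, t))) z a a =
      fderiv ℝ (fderiv ℝ f) (z, t) (a, 0) (a, 0) := fun a => by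
    rw [h1.fderiv_eq, (h2.clm_comp (hasFDerivAt_const _ z)).fderiv]
    simp
  simp [lap, iteratedFDeriv_two_apply, h3]

lemma deriv_slice {z : ℂ} {t : ℝ} (hM : IsOpen M) (hf : ContDiffOn ℝ (⊤ : ℕ∞) f M)
    (h : (z, t) ∈ M) : deriv (fun s => f (z, s)) t = fderiv ℝ f (z, t) (0, 1) := by
  have hin : HasDerivAt (fun s : ℝ => (z, s)) ((0 : ℂ), (1 : ℝ)) t :=
    (hasDerivAt_const t z).prodMk (hasDerivAt_id t)
  exact (((hf.contDiffAt (hM.mem_nhds h)).differentiableAt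
    (by simp)).hasFDerivAt.comp_hasDerivAt t hin).deriv

lemma bilin_add_bilin_I (B : (ℂ × ℝ) →L[ℝ] (ℂ × ℝ) →L[ℝ] ℝ) (ζ : ℂ) :
    B (ζ, 0) (ζ, 0) + B (Complex.I * ζ, 0) (Complex.I * ζ, 0) =
      ‖ζ‖ ^ 2 * (B (1, 0) (1, 0) + B (Complex.I, 0) (Complex.I, 0)) := by
  have h1 : ((ζ, 0) : ℂ × ℝ) = ζ.re • (1, 0) + ζ.im • (Complex.I, 0) := by
    ext <;> simp
  have h2 : ((Complex.I * ζ, 0) : ℂ × ℝ) = (-ζ.im) • (1, 0) + ζ.re • (Complex.I, 0) := by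
    ext <;> simp [Complex.ext_iff]
  rw [h1, h2, Complex.sq_norm, Complex.normSq_apply]
  simp only [map_add, map_smul, add_apply, smul_apply,
    smul_eq_mul]
  ring

/-- First order expansion and four point expansion for a backward parabolic step. -/
theorem exists_four_point (hM : IsOpen M) (hf : ContDiffOn ℝ (⊤ : ℕ∞) f M) {K : Set (ℂ × ℝ)}
    (hK : IsCompact K) (hKM : K ⊆ M) (c : ℝ) :
    ∃ C ≥ (0:ℝ), ∃ ε₀ > (0:ℝ), ∀ ε ∈ Ioc 0 ε₀, ∀ z t, (z, t) ∈ K → ∀ ζ : ℂ, ‖ζ‖ ≤ c * ε →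
      (∀ k : ℕ, (z + Complex.I ^ k * ζ, t - ε ^ 2) ∈ M ∧
        |f (z + Complex.I ^ k * ζ, t - ε ^ 2) - f (z, t)
          - fderiv ℝ f (z, t) (Complex.I ^ k * ζ, 0)| ≤ C * ε ^ 2) ∧
      |∑ k ∈ Finset.range 4, f (z + Complex.I ^ k * ζ, t - ε ^ 2) - 4 * f (z, t)
        - ‖ζ‖ ^ 2 * lap (fun w => f (w, t)) z + 4 * ε ^ 2 * deriv (fun s => f (z, s)) t|
        ≤ C * ε ^ 3 := by
  wlog hc : 1 ≤ c generalizing c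
  · obtain ⟨C, hC, ε₀, hε₀, h⟩ := this 1 le_rfl
    exact ⟨C, hC, ε₀, hε₀, fun ε hε z t hz ζ hζ => h ε hε z t hz ζ
      (hζ.trans (by nlinarith [hε.1]))⟩
  obtain ⟨C, hC, δ, hδ, h⟩ := exists_taylor hM hf hK hKM
  refine ⟨C + C * c ^ 2 + 4 * (C * c ^ 3) + 2 * C, by positivity, min 1 (δ / c), by positivity, ?_⟩
  intro ε hε z t hz ζ hζ
  have hε0 : 0 < ε := hε.1
  have hε1 : ε ≤ 1 := hε.2.trans (min_le_left _ _)
  have hεδ : c * ε ≤ δ := by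
    have := hε.2.trans (min_le_right _ _)
    rwa [le_div_iff₀ (by positivity), mul_comm] at this
  obtain ⟨h1, h2, h3⟩ := h _ hz
  have hε32 : ε ^ 3 ≤ ε ^ 2 := pow_le_pow_of_le_one hε0.le hε1 (by norm_num)
  have hε43 : ε ^ 4 ≤ ε ^ 3 := pow_le_pow_of_le_one hε0.le hε1 (by norm_num)
  have hε21 : ε ^ 2 ≤ ε := by nlinarith
  have hvk : ∀ k : ℕ, ‖((Complex.I ^ k * ζ, -ε ^ 2) : ℂ × ℝ)‖ ≤ c * ε := fun k => by
    rw [Prod.norm_mk]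
    refine max_le (by simpa using hζ) ?_
    rw [norm_neg, Real.norm_of_nonneg (by positivity)]
    nlinarith
  set D := fderiv ℝ f (z, t)
  set B := fderiv ℝ (fderiv ℝ f) (z, t)
  have hT : ∀ k : ℕ, (z + Complex.I ^ k * ζ, t - ε ^ 2) ∈ M ∧
      |f (z + Complex.I ^ k * ζ, t - ε ^ 2) - f (z, t) - D (Complex.I ^ k * ζ, -ε ^ 2)
        - B (Complex.I ^ k * ζ, -ε ^ 2) (Complex.I ^ k * ζ, -ε ^ 2) / 2| ≤ C * (c * ε) ^ 3 := by
    intro k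
    have := h3 (Complex.I ^ k * ζ, -ε ^ 2) ((hvk k).trans hεδ)
    simp only [Prod.mk_add_mk, ← sub_eq_add_neg] at this
    exact ⟨this.1, this.2.trans (by gcongr; exact hvk k)⟩
  have hD : ∀ k : ℕ, D (Complex.I ^ k * ζ, -ε ^ 2) =
      D (Complex.I ^ k * ζ, 0) - ε ^ 2 * D (0, 1) := fun k => by
    rw [show ((Complex.I ^ k * ζ, -ε ^ 2) : ℂ × ℝ) =
      (Complex.I ^ k * ζ, 0) - (ε ^ 2) • (0, 1) by ext <;> simp]
    simp only [map_sub, map_smul, smul_eq_mul]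
  have hD1 : |D (0, 1)| ≤ C := by
    refine (D.le_opNorm (0, 1)).trans ?_
    simpa [Prod.norm_mk] using h1
  refine ⟨fun k => ⟨(hT k).1, ?_⟩, ?_⟩
  · have hB : |B (Complex.I ^ k * ζ, -ε ^ 2) (Complex.I ^ k * ζ, -ε ^ 2)| ≤
        C * (c * ε) * (c * ε) := by
      refine (B.le_opNorm₂ _ _).trans ?_
      gcongr
      exacts [hvk k, hvk k]
    have h5 := (hT k).2
    rw [hD k] at h5
    have e1 : |ε ^ 2 * D (0, 1)| ≤ ε ^ 2 * C := by
      rw [abs_mul, abs_of_nonneg (by positivity)]; gcongr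
    have e2 : C * (c * ε) ^ 3 ≤ C * c ^ 3 * ε ^ 2 := by
      rw [mul_pow, ← mul_assoc]; gcongr
    rw [abs_le] at *
    have e3 : 0 ≤ C * c ^ 3 * ε ^ 2 := by positivity
    have e4 : 0 ≤ C * ε ^ 2 := by positivity
    have e5 : 0 ≤ C * c ^ 2 * ε ^ 2 := by positivity
    constructor <;> nlinarith
  · have hI2 : Complex.I ^ 2 = -1 := Complex.I_sq
    have hI3 : Complex.I ^ 3 = -Complex.I := Complex.I_pow_three
    have hB : ∀ ξ : ℂ, B (ξ, -ε ^ 2) (ξ, -ε ^ 2) = B (ξ, 0) (ξ, 0)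
        - ε ^ 2 * (B (ξ, 0) (0, 1) + B (0, 1) (ξ, 0)) + ε ^ 4 * B (0, 1) (0, 1) := fun ξ => by
      rw [show ((ξ, -ε ^ 2) : ℂ × ℝ) = (ξ, 0) - (ε ^ 2) • (0, 1) by ext <;> simp]
      simp only [map_sub, map_smul, sub_apply, smul_apply,
        smul_eq_mul]
      ring
    have hneg : ∀ ξ : ℂ, ((-ξ, 0) : ℂ × ℝ) = -(ξ, 0) := fun ξ => by ext <;> simp
    have hB1 : |B (0, 1) (0, 1)| ≤ C := by
      refine (B.le_opNorm₂ (0, 1) (0, 1)).trans ?_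
      simpa [Prod.norm_mk] using h2
    have hlap := lap_slice hM hf (hKM hz)
    have hder := deriv_slice hM hf (hKM hz)
    have hbil := bilin_add_bilin_I B ζ
    rw [hlap, hder]
    change |_ - ‖ζ‖ ^ 2 * (B (1, 0) (1, 0) + B (Complex.I, 0) (Complex.I, 0)) +
      4 * ε ^ 2 * D (0, 1)| ≤ _
    rw [← hbil]
    have t0 := (hT 0).2
    have t1 := (hT 1).2
    have t2 := (hT 2).2
    have t3 := (hT 3).2
    rw [hD, hB] at t0 t1 t2 t3
    simp only [Finset.sum_range_succ, Finset.sum_range_zero, pow_zero, pow_one, hI2, hI3, one_mul,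
      neg_mul, hneg, map_neg, neg_apply, zero_add, neg_neg] at t0 t1 t2 t3 ⊢
    have e1 : |ε ^ 4 * B (0, 1) (0, 1)| ≤ C * ε ^ 3 := by
      rw [abs_mul, abs_of_nonneg (by positivity)]
      calc _ ≤ ε ^ 3 * C := by gcongr
        _ = _ := by ring
    have e2 : C * (c * ε) ^ 3 = C * c ^ 3 * ε ^ 3 := by ring
    have e4 : 0 ≤ C * ε ^ 3 := by positivity
    have e5 : 0 ≤ C * c ^ 2 * ε ^ 3 := by positivity
    rw [e2] at t0 t1 t2 t3
    rw [abs_le] at *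
    constructor <;> linarith

end FourPoints

section Transport

/-- The Wirtinger derivative `∂_z` read off from a real differential on `ℂ × ℝ`. -/
noncomputable def wirtinger (L : (ℂ × ℝ) →L[ℝ] ℝ) : ℂ :=
  ((L (1, 0) : ℂ) - L (Complex.I, 0) * Complex.I) / 2

lemma re_wirtinger_mul (L : (ℂ × ℝ) →L[ℝ] ℝ) (ξ : ℂ) :
    (wirtinger L * ξ).re = L (ξ, 0) / 2 := by
  have h1 : ((ξ, 0) : ℂ × ℝ) = ξ.re • (1, 0) + ξ.im • (Complex.I, 0) := by
    ext <;> simp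
  rw [h1, map_add, map_smul, map_smul, wirtinger, div_mul_eq_mul_div]
  simp [Complex.mul_re]
  ring

lemma norm_wirtinger_le (L : (ℂ × ℝ) →L[ℝ] ℝ) : ‖wirtinger L‖ ≤ ‖L‖ := by
  have h1 : ‖L (1, 0)‖ ≤ ‖L‖ := by
    simpa [Prod.norm_mk] using L.le_opNorm (1, 0)
  have h2 : ‖L (Complex.I, 0)‖ ≤ ‖L‖ := by
    simpa [Prod.norm_mk] using L.le_opNorm (Complex.I, 0)
  rw [wirtinger, norm_div]
  have : ‖(L (1, 0) : ℂ) - L (Complex.I, 0) * Complex.I‖ ≤ ‖L‖ + ‖L‖ := by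
    refine (norm_sub_le _ _).trans (add_le_add ?_ ?_)
    · rwa [Complex.norm_real]
    · rwa [norm_mul, Complex.norm_I, mul_one, Complex.norm_real]
  rw [div_le_iff₀ (by simp)]
  simpa [mul_two] using this

lemma continuous_wirtinger : Continuous wirtinger := by
  unfold wirtinger
  have h : ∀ p : ℂ × ℝ, Continuous fun L : (ℂ × ℝ) →L[ℝ] ℝ => L p := fun p =>
    (ContinuousLinearMap.apply ℝ ℝ p).continuous
  have h1 := Complex.continuous_ofReal.comp (h (1, 0))
  have h2 := Complex.continuous_ofReal.comp (h (Complex.I, 0))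
  exact (h1.sub (h2.mul continuous_const)).div_const 2

/-- A vector of constant conformal length transported along a curve so that `γ + Iᵏζ` has velocity
`γ' (1 - Iᵏ ∂_z f ζ)`. -/
lemma exists_transport {f : ℂ × ℝ → ℝ} {M : Set (ℂ × ℝ)} (hM : IsOpen M)
    (hf : ContDiffOn ℝ (⊤ : ℕ∞) f M) {γ : ℝ → ℂ} (hγ : ContDiff ℝ 1 γ) {t : ℝ}
    (hγM : ∀ s ∈ Icc (0:ℝ) 1, (γ s, t) ∈ M) (ζ₀ : ℂ) :
    ∃ ζ : ℝ → ℂ, ContDiff ℝ 1 ζ ∧ ζ 0 = ζ₀ ∧ ∀ s ∈ Icc (0:ℝ) 1,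
      deriv ζ s = -(wirtinger (fderiv ℝ f (γ s, t)) * deriv γ s) * ζ s ∧
      ‖ζ s‖ = ‖ζ₀‖ * Real.exp ((f (γ 0, t) - f (γ s, t)) / 2) := by
  set g : ℝ → ℂ := fun s => wirtinger (fderiv ℝ f (γ s, t)) * deriv γ s with hg
  have hf1 : ContDiffOn ℝ (⊤ : ℕ∞) (fderiv ℝ f) M := hf.fderiv_of_isOpen hM (by simp)
  have hgc : ContinuousOn g (Icc 0 1) := by
    refine ContinuousOn.mul ?_ (hγ.continuous_deriv le_rfl).continuousOn
    exact continuous_wirtinger.comp_continuousOn (hf1.continuousOn.comp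
      (f := fun s => (γ s, t)) (hγ.continuous.prodMk continuous_const).continuousOn hγM)
  set G : ℝ → ℂ := IccExtend zero_le_one ((Icc (0:ℝ) 1).domRestrict g)
  have hG : Continuous G := (continuousOn_iff_continuous_domRestrict.1 hgc).Icc_extend'
  have hGg : ∀ s ∈ Icc (0:ℝ) 1, G s = g s := fun s hs => by
    simp only [G, IccExtend_of_mem _ _ hs]; rfl
  have hint : ∀ s, HasDerivAt (fun s => ∫ r in (0:ℝ)..s, G r) (G s) s := fun s =>
    intervalIntegral.integral_hasDerivAt_right (hG.intervalIntegrable _ _)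
      (hG.stronglyMeasurableAtFilter _ _) hG.continuousAt
  set ζ : ℝ → ℂ := fun s => ζ₀ * Complex.exp (-∫ r in (0:ℝ)..s, G r) with hζ
  have hder : ∀ s, HasDerivAt ζ (-G s * ζ s) s := fun s => by
    have := ((hint s).neg.cexp).const_mul ζ₀
    have e : -G s * ζ s = ζ₀ * (Complex.exp (-∫ r in (0:ℝ)..s, G r) * -G s) := by
      simp only [hζ]; ring
    rw [e]
    exact this
  have hζc : Continuous ζ := continuous_iff_continuousAt.2 fun s => (hder s).continuousAt
  refine ⟨ζ, ?_, by simp [hζ], fun s hs => ⟨by rw [(hder s).deriv, hGg s hs], ?_⟩⟩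
  · rw [contDiff_one_iff_deriv]
    refine ⟨fun s => (hder s).differentiableAt, ?_⟩
    rw [show deriv ζ = fun s => -G s * ζ s from funext fun s => (hder s).deriv]
    exact hG.neg.mul hζc
  · have hN : ∀ r ∈ Icc (0:ℝ) 1, HasDerivWithinAt
        (fun r => (-∫ r in (0:ℝ)..r, G r).re + f (γ r, t) / 2) 0 (Icc 0 1) r := fun r hr => by
      have e1 : HasDerivAt (fun r => (-∫ r in (0:ℝ)..r, G r).re) (-(G r)).re r :=
        Complex.reCLM.hasFDerivAt.comp_hasDerivAt r (hint r).neg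
      have e2 : HasDerivAt (fun r => f (γ r, t)) (fderiv ℝ f (γ r, t) (deriv γ r, 0)) r :=
        ((hf.contDiffAt (hM.mem_nhds (hγM r hr))).differentiableAt
          (by simp)).hasFDerivAt.comp_hasDerivAt r
          (((hγ.differentiable one_ne_zero r).hasDerivAt).prodMk (hasDerivAt_const r t))
      have e3 := (e1.add (e2.div_const 2)).hasDerivWithinAt (s := Icc 0 1)
      have h0 : (-(G r)).re + fderiv ℝ f (γ r, t) (deriv γ r, 0) / 2 = 0 := by
        rw [hGg r hr, hg, Complex.neg_re, re_wirtinger_mul]; ring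
      rw [h0] at e3
      exact e3
    have hc := (convex_Icc (0:ℝ) 1).norm_image_sub_le_of_norm_hasDerivWithin_le
      (C := 0) hN (by simp) (x := 0) (y := s) (by simp) hs
    rw [zero_mul, norm_le_zero_iff, sub_eq_zero] at hc
    simp only [intervalIntegral.integral_same, neg_zero, Complex.zero_re, zero_add] at hc
    rw [hζ]
    simp only [norm_mul, Complex.norm_exp]
    congr 2
    linarith

end Transport

section Pointwise

lemma abs_log_norm_one_sub_add_re_le {w : ℂ} (hw : ‖w‖ ≤ 1 / 2) :
    |Real.log ‖1 - w‖ + w.re| ≤ ‖w‖ ^ 2 := by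
  have h := Complex.norm_log_one_add_sub_self_le (z := -w) (by rw [norm_neg]; linarith)
  have h1 : (Complex.log (1 + -w) - -w).re = Real.log ‖1 - w‖ + w.re := by
    rw [Complex.sub_re, Complex.log_re, Complex.neg_re, ← sub_eq_add_neg, sub_neg_eq_add]
  rw [← h1]
  refine (Complex.abs_re_le_norm _).trans (h.trans ?_)
  rw [norm_neg]
  have h2 : (1 - ‖w‖)⁻¹ ≤ 2 := by
    rw [inv_le_comm₀ (by linarith) (by norm_num)]; linarith
  nlinarith [sq_nonneg ‖w‖]

lemma prod_one_sub_I_pow_mul (b : ℂ) :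
    ∏ k ∈ Finset.range 4, (1 - Complex.I ^ k * b) = 1 - b ^ 4 := by
  simp only [Finset.prod_range_succ, Finset.prod_range_zero, pow_zero, pow_one, Complex.I_sq,
    Complex.I_pow_three]
  linear_combination (-b^2 + b^4) * Complex.I_sq

variable {T : ℝ} {M : Set (ℂ × ℝ)} {u : ℂ → ℝ → ℝ}

lemma ConfRFS.contDiffOn_log (hR : ConfRFS T M u) :
    ContDiffOn ℝ (⊤ : ℕ∞) (fun p : ℂ × ℝ => Real.log (u p.1 p.2)) M :=
  hR.smooth.log fun p hp => (hR.pos p hp).ne'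

lemma ConfRFS.hasDerivAt (hR : ConfRFS T M u) {z : ℂ} {t : ℝ} (h : (z, t) ∈ M) :
    HasDerivAt (u z) (lap (fun z => Real.log (u z t)) z) t := by
  rw [← hR.lfde _ h]
  have hin : HasDerivAt (fun s : ℝ => (z, s)) ((0 : ℂ), (1 : ℝ)) t :=
    (hasDerivAt_const t z).prodMk (hasDerivAt_id t)
  exact (((hR.smooth.contDiffAt (hR.opn.mem_nhds h)).differentiableAt
    (by simp)).hasFDerivAt.comp_hasDerivAt t hin).differentiableAt.hasDerivAt

lemma exp_estimates {X : ℕ → ℝ} {C ε : ℝ} (hC : 0 ≤ C) (hε : 0 < ε) (hε1 : ε ≤ 1)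
    (hCε : C * ε ≤ 1) (hX : ∀ k, |X k| ≤ C * ε ^ 2)
    (hS : ∑ k ∈ Finset.range 4, X k ≤ C * ε ^ 3) :
    (∀ k, |Real.exp (X k) - 1| ≤ 6 * C * ε ^ 2) ∧
      ∑ k ∈ Finset.range 4, Real.exp (X k) ≤ 4 + 6 * C * ε ^ 3 := by
  have h2 : C * ε ^ 2 ≤ 1 := by nlinarith [mul_nonneg hC hε.le]
  have h3 : (C * ε ^ 2) ^ 2 ≤ C * ε ^ 3 := by
    have : (C * ε ^ 2) ^ 2 = (C * ε ^ 3) * (C * ε) := by ring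
    rw [this]
    exact mul_le_of_le_one_right (by positivity) hCε
  refine ⟨fun k => ?_, ?_⟩
  · have := Real.abs_exp_sub_one_le ((hX k).trans h2)
    have h0 : 0 ≤ C * ε ^ 2 := by positivity
    linarith [hX k]
  · have hk : ∀ k, Real.exp (X k) ≤ 1 + X k + C * ε ^ 3 := fun k => by
      have e1 := Real.abs_exp_sub_one_sub_id_le ((hX k).trans h2)
      have e2 : X k ^ 2 ≤ (C * ε ^ 2) ^ 2 := by
        rw [← sq_abs]; gcongr; exact hX k
      have e3 := le_abs_self (Real.exp (X k) - 1 - X k)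
      linarith
    have h0 : 0 ≤ C * ε ^ 3 := by positivity
    simp only [Finset.sum_range_succ, Finset.sum_range_zero, zero_add] at hS ⊢
    linarith [hk 0, hk 1, hk 2, hk 3]

/-- The four speed ratios of a parabolic step are `1` up to second order, and their average is
`1` up to third order. -/
lemma exists_speed_ratio (hR : ConfRFS T M u) {K : Set (ℂ × ℝ)} (hK : IsCompact K)
    (hKM : K ⊆ M) :
    ∃ C ≥ (0:ℝ), ∃ ε₀ > (0:ℝ), ∀ ε ∈ Ioc 0 ε₀, ∀ z t, (z, t) ∈ K → ∀ ζ : ℂ,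
      ‖ζ‖ = 2 * ε / Real.sqrt (u z t) → ∀ b : ℂ,
      b = wirtinger (fderiv ℝ (fun p : ℂ × ℝ => Real.log (u p.1 p.2)) (z, t)) * ζ →
      ∃ E : ℕ → ℝ, (∀ k, (z + Complex.I ^ k * ζ, t - ε ^ 2) ∈ M ∧
        Real.sqrt (u (z + Complex.I ^ k * ζ) (t - ε ^ 2)) * ‖1 - Complex.I ^ k * b‖ =
          E k * Real.sqrt (u z t) ∧ |E k - 1| ≤ C * ε ^ 2) ∧
        ∑ k ∈ Finset.range 4, E k ≤ 4 + C * ε ^ 3 := by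
  set q : ℂ × ℝ → ℝ := fun p => Real.log (u p.1 p.2) with hq
  have hqs := hR.contDiffOn_log
  have hq1 : ContDiffOn ℝ (⊤ : ℕ∞) (fderiv ℝ q) M := hqs.fderiv_of_isOpen hR.opn (by simp)
  have hcu : ContinuousOn (fun p : ℂ × ℝ => 2 / Real.sqrt (u p.1 p.2)) K :=
    continuousOn_const.div (hR.smooth.continuousOn.mono hKM).sqrt
      fun p hp => (Real.sqrt_pos.2 (hR.pos p (hKM hp))).ne'
  obtain ⟨c', hc'⟩ := hK.exists_bound_of_continuousOn hcu
  obtain ⟨D', hD'⟩ := hK.exists_bound_of_continuousOn (hq1.continuousOn.mono hKM)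
  set c := max c' 0
  set D := max D' 0
  have hc0 : 0 ≤ c := le_max_right _ _
  have hD0 : 0 ≤ D := le_max_right _ _
  obtain ⟨C₀, hC₀, ε₁, hε₁, hfour⟩ := exists_four_point hR.opn hqs hK hKM c
  set d := D * c
  have hd0 : 0 ≤ d := by positivity
  set C := C₀ + d ^ 2 + 2 * d ^ 4
  have hC0 : 0 ≤ C := by positivity
  refine ⟨6 * C, by positivity, min ε₁ (min 1 (min (1 / (2 * (d + 1))) (1 / (C + 1)))),
    by positivity, fun ε hε z t hz ζ hζ b hb => ?_⟩
  have hε0 : 0 < ε := hε.1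
  have hεε₁ : ε ≤ ε₁ := hε.2.trans (min_le_left _ _)
  have hε1 : ε ≤ 1 := hε.2.trans ((min_le_right _ _).trans (min_le_left _ _))
  have hεd : d * ε ≤ 1 / 2 := by
    have := hε.2.trans ((min_le_right _ _).trans ((min_le_right _ _).trans (min_le_left _ _)))
    rw [le_div_iff₀ (by positivity)] at this
    nlinarith
  have hεC : C * ε ≤ 1 := by
    have := hε.2.trans ((min_le_right _ _).trans ((min_le_right _ _).trans (min_le_right _ _)))
    rw [le_div_iff₀ (by positivity)] at this
    nlinarith
  have hzM := hKM hz
  have hu : 0 < u z t := hR.pos _ hzM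
  have hζc : ‖ζ‖ ≤ c * ε := by
    have h1 := (le_abs_self _).trans (hc' _ hz)
    simp only at h1
    rw [hζ, mul_div_right_comm]
    gcongr
    exact h1.trans (le_max_left _ _)
  have hbd : ‖b‖ ≤ d * ε := by
    rw [hb, norm_mul]
    calc _ ≤ D * (c * ε) := by
          gcongr
          exact (norm_wirtinger_le _).trans ((hD' _ hz).trans (le_max_left _ _))
      _ = _ := by ring
  obtain ⟨hk, hsum⟩ := hfour ε ⟨hε0, hεε₁⟩ z t hz ζ hζc
  have hkM := fun k => (hk k).1
  have hbk : ∀ k : ℕ, ‖Complex.I ^ k * b‖ = ‖b‖ := fun k => by simp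
  have hne : ∀ w : ℂ, ‖w‖ ≤ 1 / 2 → 0 < ‖1 - w‖ := fun w hw => by
    have := norm_sub_norm_le (1:ℂ) w
    rw [norm_one] at this
    linarith
  have hnek : ∀ k : ℕ, 0 < ‖1 - Complex.I ^ k * b‖ := fun k => hne _ (by rw [hbk]; linarith)
  set X : ℕ → ℝ := fun k => (q (z + Complex.I ^ k * ζ, t - ε ^ 2) - q (z, t)) / 2 +
    Real.log ‖1 - Complex.I ^ k * b‖ with hX
  have hbb : ‖b‖ ^ 2 ≤ d ^ 2 * ε ^ 2 := by rw [← mul_pow]; gcongr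
  have hXk : ∀ k, |X k| ≤ C * ε ^ 2 := fun k => by
    have h1 := (hk k).2
    have h2 := abs_log_norm_one_sub_add_re_le (w := Complex.I ^ k * b) (by rw [hbk]; linarith)
    have h3 : (Complex.I ^ k * b).re = fderiv ℝ q (z, t) (Complex.I ^ k * ζ, 0) / 2 := by
      rw [← re_wirtinger_mul, hb]; ring_nf
    rw [hbk, h3] at h2
    have h4 : 0 ≤ d ^ 4 * ε ^ 2 := by positivity
    have h5 : 0 ≤ C₀ * ε ^ 2 := by positivity
    have h6 : C * ε ^ 2 = C₀ * ε ^ 2 + d ^ 2 * ε ^ 2 + 2 * (d ^ 4 * ε ^ 2) := by ring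
    rw [h6]
    simp only [hX]
    rw [abs_le] at *
    constructor <;> linarith
  have hXs : ∑ k ∈ Finset.range 4, X k ≤ C * ε ^ 3 := by
    have hlog : ∑ k ∈ Finset.range 4, Real.log ‖1 - Complex.I ^ k * b‖ = Real.log ‖1 - b ^ 4‖ := by
      rw [← Real.log_prod fun k _ => (hnek k).ne', ← norm_prod, prod_one_sub_I_pow_mul]
    have hb4 : ‖b ^ 4‖ ≤ d ^ 4 * ε ^ 3 := by
      rw [norm_pow]
      calc ‖b‖ ^ 4 ≤ (d * ε) ^ 4 := by gcongr
        _ = d ^ 4 * (ε ^ 3 * ε) := by ring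
        _ ≤ d ^ 4 * (ε ^ 3 * 1) := by gcongr
        _ = _ := by ring
    have hb4' : ‖b ^ 4‖ ≤ 1 / 2 := by
      rw [norm_pow]
      calc ‖b‖ ^ 4 ≤ (1 / 2) ^ 4 := by gcongr; linarith
        _ ≤ _ := by norm_num
    have h2 := abs_log_norm_one_sub_add_re_le hb4'
    have h3 := Complex.abs_re_le_norm (b ^ 4)
    have h4 : ‖b ^ 4‖ ^ 2 ≤ ‖b ^ 4‖ := by nlinarith [norm_nonneg (b ^ 4)]
    have hder : deriv (fun s => q (z, s)) t = lap (fun w => q (w, t)) z / u z t :=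
      ((hR.hasDerivAt hzM).log hu.ne').deriv
    have hzero : ‖ζ‖ ^ 2 * lap (fun w => q (w, t)) z =
        4 * ε ^ 2 * deriv (fun s => q (z, s)) t := by
      rw [hder, hζ, div_pow, Real.sq_sqrt hu.le]
      field_simp; ring
    have h5 : ∑ k ∈ Finset.range 4, X k =
        (∑ k ∈ Finset.range 4, q (z + Complex.I ^ k * ζ, t - ε ^ 2) - 4 * q (z, t)) / 2 +
          Real.log ‖1 - b ^ 4‖ := by
      rw [← hlog]
      simp only [hX, Finset.sum_range_succ, Finset.sum_range_zero]
      ring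
    rw [h5]
    have h6 : 0 ≤ C₀ * ε ^ 3 := by positivity
    have h7 : 0 ≤ d ^ 2 * ε ^ 3 := by positivity
    have h8 : C * ε ^ 3 = C₀ * ε ^ 3 + d ^ 2 * ε ^ 3 + 2 * (d ^ 4 * ε ^ 3) := by ring
    rw [h8]
    rw [abs_le] at h2 h3 hsum
    linarith
  obtain ⟨r1, r2⟩ := exp_estimates hC0 hε0 hε1 hεC hXk hXs
  refine ⟨fun k => Real.exp (X k), fun k => ⟨hkM k, ?_, r1 k⟩, r2⟩
  have hs : ∀ p ∈ M, Real.sqrt (u p.1 p.2) = Real.exp (q p / 2) := fun p hp => by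
    rw [Real.exp_half, Real.exp_log (hR.pos p hp)]
  rw [hs _ (hkM k), hs _ hzM, ← Real.exp_log (hnek k), ← Real.exp_add, ← Real.exp_add]
  congr 1
  simp only [hX]
  ring

end Pointwise

section Step

variable {T : ℝ} {M : Set (ℂ × ℝ)} {u : ℂ → ℝ → ℝ}

/-- A parabolic step backwards in time: a path at time `t` is pushed to four paths at time
`t - ε²` whose lengths are the same up to second order and on average up to third order. -/
theorem exists_backward_step (hR : ConfRFS T M u) {K : Set (ℂ × ℝ)} (hK : IsCompact K)
    (hKM : K ⊆ M) {A : ℝ} (hA : 0 ≤ A) :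
    ∃ C ≥ (0:ℝ), ∃ ε₀ > (0:ℝ), ∀ ε ∈ Ioc 0 ε₀, ∀ t y x ℓ, ℓ ≤ A →
      (∀ w L, L ≤ ℓ → Reach (fun z => u z t) (timeSlice M t) y w L → (w, t) ∈ K) →
      Reach (fun z => u z t) (timeSlice M t) y x ℓ →
      ∃ ζ₀ ζ₁ : ℂ, ‖ζ₀‖ = 2 * ε / Real.sqrt (u y t) ∧ ‖ζ₁‖ = 2 * ε / Real.sqrt (u x t) ∧
        ∃ ℓ' : ℕ → ℝ, (∀ k, Reach (fun z => u z (t - ε ^ 2)) (timeSlice M (t - ε ^ 2))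
          (y + Complex.I ^ k * ζ₀) (x + Complex.I ^ k * ζ₁) (ℓ' k) ∧
          |ℓ' k - ℓ| ≤ C * ε ^ 2) ∧ ∑ k ∈ Finset.range 4, ℓ' k ≤ 4 * ℓ + C * ε ^ 3 := by
  obtain ⟨C, hC, ε₀, hε₀, hE⟩ := exists_speed_ratio hR hK hKM
  refine ⟨C * A, by positivity, ε₀, hε₀, fun ε hε t y x ℓ hℓ hin hreach => ?_⟩
  obtain ⟨γ, h1, h2, h3, h4, h5⟩ := hreach
  have hε0 : 0 < ε := hε.1
  have hv := hR.continuousOn_slice t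
  have hv' := hR.continuousOn_slice (t - ε ^ 2)
  have hγK : ∀ s ∈ Icc (0:ℝ) 1, (γ s, t) ∈ K := fun s hs => by
    refine hin _ _ ?_ (h3 ▸ Reach.of_interval hv h1 hs.1
      (fun r hr => h2 r ⟨hr.1, hr.2.trans hs.2⟩) le_rfl)
    refine le_trans ?_ h5
    rw [← curveLength_add hv h1 hs.1 hs.2 h2]
    linarith [curveLength_nonneg (v := fun z => u z t) (γ := γ) hs.2]
  have hpos : ∀ s ∈ Icc (0:ℝ) 1, 0 < u (γ s) t := fun s hs => hR.pos _ (h2 s hs)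
  have h01 : (0:ℝ) ∈ Icc (0:ℝ) 1 := by simp
  have h11 : (1:ℝ) ∈ Icc (0:ℝ) 1 := by simp
  obtain ⟨ζ, hζ, hζ0, hζs⟩ := exists_transport hR.opn hR.contDiffOn_log h1 h2
    ((2 * ε / Real.sqrt (u y t) : ℝ) : ℂ)
  have hnorm : ∀ s ∈ Icc (0:ℝ) 1, ‖ζ s‖ = 2 * ε / Real.sqrt (u (γ s) t) := fun s hs => by
    have hy : 0 < u y t := h3 ▸ hpos 0 h01
    rw [(hζs s hs).2, Complex.norm_real, Real.norm_of_nonneg (by positivity), h3, sub_div,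
      Real.exp_sub, Real.exp_half, Real.exp_half, Real.exp_log hy, Real.exp_log (hpos s hs)]
    have : Real.sqrt (u y t) ≠ 0 := (Real.sqrt_pos.2 hy).ne'
    field_simp
  have hEs := fun s (hs : s ∈ Icc (0:ℝ) 1) =>
    hE ε hε (γ s) t (hγK s hs) (ζ s) (hnorm s hs) _ rfl
  choose! E hEk hEsum using hEs
  set F : ℕ → ℝ → ℂ := fun k s => γ s + Complex.I ^ k * ζ s with hF
  have hFc : ∀ k, ContDiff ℝ 1 (F k) := fun k => h1.add (contDiff_const.mul hζ)
  have hFM : ∀ k, ∀ s ∈ Icc (0:ℝ) 1, F k s ∈ timeSlice M (t - ε ^ 2) :=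
    fun k s hs => (hEk s hs k).1
  set σ : ℝ → ℝ := fun s => Real.sqrt (u (γ s) t) * ‖deriv γ s‖ with hσ
  have hσ0 : ∀ s, 0 ≤ σ s := fun s => by positivity
  have hspeed : ∀ k, ∀ s ∈ Icc (0:ℝ) 1,
      Real.sqrt (u (F k s) (t - ε ^ 2)) * ‖deriv (F k) s‖ = E s k * σ s := fun k s hs => by
    have hd : deriv (F k) s = deriv γ s * (1 - Complex.I ^ k *
        (wirtinger (fderiv ℝ (fun p : ℂ × ℝ => Real.log (u p.1 p.2)) (γ s, t)) * ζ s)) := by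
      have e1 := (h1.differentiable one_ne_zero s).hasDerivAt
      have e2 := ((hζ.differentiable one_ne_zero s).hasDerivAt).const_mul (Complex.I ^ k)
      have e3 : deriv (F k) s = deriv γ s + Complex.I ^ k * deriv ζ s := (e1.add e2).deriv
      rw [e3, (hζs s hs).1]
      ring
    rw [hd, norm_mul, mul_comm ‖deriv γ s‖, ← mul_assoc, (hEk s hs k).2.1, hσ]
    ring
  have hI : IntervalIntegrable σ volume 0 1 := intervalIntegrable_speed hv h1 zero_le_one h2
  have hIF : ∀ k, IntervalIntegrable (fun s => Real.sqrt (u (F k s) (t - ε ^ 2)) *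
      ‖deriv (F k) s‖) volume 0 1 := fun k =>
    intervalIntegrable_speed hv' (hFc k) zero_le_one (hFM k)
  set Λ := curveLength (fun z => u z t) γ 0 1 with hΛ
  have hΛ0 : 0 ≤ Λ := curveLength_nonneg zero_le_one
  have hΛσ : Λ = ∫ s in (0:ℝ)..1, σ s := rfl
  set Λ' : ℕ → ℝ := fun k => curveLength (fun z => u z (t - ε ^ 2)) (F k) 0 1 with hΛ'
  have hup : ∀ k, Λ' k ≤ (1 + C * ε ^ 2) * Λ := fun k => by
    rw [hΛσ, ← intervalIntegral.integral_const_mul]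
    refine intervalIntegral.integral_mono_on zero_le_one (hIF k) (hI.const_mul _) fun s hs => ?_
    rw [hspeed k s hs]
    have := (abs_le.1 (hEk s hs k).2.2).2
    exact mul_le_mul_of_nonneg_right (by linarith) (hσ0 s)
  have hlow : ∀ k, (1 - C * ε ^ 2) * Λ ≤ Λ' k := fun k => by
    rw [hΛσ, ← intervalIntegral.integral_const_mul]
    refine intervalIntegral.integral_mono_on zero_le_one (hI.const_mul _) (hIF k) fun s hs => ?_
    rw [hspeed k s hs]
    have := (abs_le.1 (hEk s hs k).2.2).1
    exact mul_le_mul_of_nonneg_right (by linarith) (hσ0 s)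
  have hsum : ∑ k ∈ Finset.range 4, Λ' k ≤ (4 + C * ε ^ 3) * Λ := by
    rw [hΛσ, ← intervalIntegral.integral_const_mul]
    simp only [hΛ', curveLength]
    rw [← intervalIntegral.integral_finsetSum fun k _ => hIF k]
    have hIs : IntervalIntegrable (fun s => ∑ k ∈ Finset.range 4,
        Real.sqrt (u (F k s) (t - ε ^ 2)) * ‖deriv (F k) s‖) volume 0 1 := by
      simpa only [Finset.sum_fn] using IntervalIntegrable.sum (Finset.range 4) fun k _ => hIF k
    refine intervalIntegral.integral_mono_on zero_le_one hIs (hI.const_mul _) fun s hs => ?_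
    rw [Finset.sum_congr rfl fun k _ => hspeed k s hs, ← Finset.sum_mul]
    exact mul_le_mul_of_nonneg_right (hEsum s hs) (hσ0 s)
  have hΛA : Λ ≤ A := h5.trans hℓ
  have e2 : C * ε ^ 2 * Λ ≤ C * A * ε ^ 2 := by
    rw [mul_right_comm]; gcongr
  have e3 : C * ε ^ 3 * Λ ≤ C * A * ε ^ 3 := by
    rw [mul_right_comm]; gcongr
  refine ⟨ζ 0, ζ 1, h3 ▸ hnorm 0 h01, h4 ▸ hnorm 1 h11, fun k => Λ' k + (ℓ - Λ),
    fun k => ⟨⟨F k, hFc k, hFM k, by simp [hF, h3], by simp [hF, h4], by linarith⟩, ?_⟩, ?_⟩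
  · rw [abs_le]
    constructor <;> linarith [hup k, hlow k]
  · rw [Finset.sum_add_distrib]
    simp only [Finset.sum_const, Finset.card_range, nsmul_eq_mul, Nat.cast_ofNat]
    linarith

end Step

section Barrier

/-- The logarithmic barrier blowing up when the distance `D` reaches `A`. -/
noncomputable def barrier (A D : ℝ) : ℝ := Real.log (2 * A ^ 2 / (A - D) ^ 2)

lemma exp_barrier {A D : ℝ} (hA : 0 < A) (hD : D < A) :
    Real.exp (barrier A D) = 2 * A ^ 2 / (A - D) ^ 2 := by
  have : 0 < A - D := by linarith
  exact Real.exp_log (by positivity)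

lemma barrier_mono {A D D' : ℝ} (hA : 0 < A) (hD : D < A) (h : D' ≤ D) :
    barrier A D' ≤ barrier A D := by
  have : 0 < A - D := by linarith
  have : 0 < A - D' := by linarith
  unfold barrier
  gcongr

lemma barrier_pos {A D : ℝ} (hA : 0 < A) (hD0 : 0 ≤ D) (hD : D < A) : 0 < barrier A D := by
  have h1 : 0 < A - D := by linarith
  refine Real.log_pos ?_
  rw [lt_div_iff₀ (by positivity)]
  nlinarith

lemma barrier_sub_le {A D D' : ℝ} (hA : 0 < A) (hD : D < A)
    (h : |(D' - D) / (A - D)| ≤ 1 / 2) :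
    D' < A ∧ barrier A D' - barrier A D ≤
      2 * ((D' - D) / (A - D)) + 2 * ((D' - D) / (A - D)) ^ 2 := by
  have h1 : 0 < A - D := by linarith
  set y := (D' - D) / (A - D) with hy
  have h2 : A - D' = (A - D) * (1 - y) := by rw [hy]; field_simp; ring
  have h3 : 0 < 1 - y := by linarith [(abs_le.1 h).2]
  have h4 : 0 < A - D' := by rw [h2]; positivity
  refine ⟨by linarith, ?_⟩
  have h5 := abs_log_norm_one_sub_add_re_le (w := (y : ℂ)) (by rwa [Complex.norm_real])
  rw [← Complex.ofReal_one, ← Complex.ofReal_sub, Complex.norm_real, Complex.norm_real,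
    Complex.ofReal_re, Real.norm_of_nonneg h3.le, Real.norm_eq_abs, sq_abs] at h5
  have h6 : barrier A D' = barrier A D - 2 * Real.log (1 - y) := by
    unfold barrier
    rw [h2, mul_pow, ← div_div, Real.log_div (by positivity) (by positivity), Real.log_pow]
    norm_num
  rw [h6]
  linarith [(abs_le.1 h5).1]

/-- If the average of four perturbed values satisfies the differential inequality up to an error
`O(ε³)`, then one of them does. -/
lemma exists_index_of_average {A T a b κ C η ε D w : ℝ} {D' w' : ℕ → ℝ} (hT : 0 < T)
    (hη : 0 < η) (hηD : η ≤ A - D) (hD0 : 0 ≤ D) (ha : 0 ≤ a) (hb : 0 ≤ b) (hκ : 0 ≤ κ)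
    (hC : 0 ≤ C) (hε : 0 < ε) (hε1 : ε ≤ 1) (hsmall : (a + b) * ε ≤ η / 2)
    (hA : T * (2 * κ * A + 8 * a ^ 2) ≤ 4 * A ^ 2)
    (hD' : ∀ k, |D' k - D| ≤ a * ε + b * ε ^ 2)
    (hDs : ∑ k ∈ Finset.range 4, D' k ≤ 4 * D + κ * ε ^ 2 + C * ε ^ 3)
    (hw : barrier A D ≤ w)
    (hws : 4 * w + 4 * ε ^ 2 * ((Real.exp w - 1) / T) - C * ε ^ 3 ≤ ∑ k ∈ Finset.range 4, w' k) :
    ∃ k, D' k < A ∧ w - barrier A D - (C + 2 * C / η + 8 * (2 * a * b + b ^ 2) / η ^ 2) * ε ^ 3 ≤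
      w' k - barrier A (D' k) := by
  set r := A - D with hr
  have hr0 : 0 < r := hη.trans_le hηD
  have hA0 : 0 < A := by linarith
  have hrA : r ≤ A := by linarith
  have hDA : D < A := by linarith
  have hε2 : ε ^ 2 ≤ ε := by nlinarith
  have hε43 : ε ^ 4 ≤ ε ^ 3 := pow_le_pow_of_le_one hε.le hε1 (by norm_num)
  set y : ℕ → ℝ := fun k => (D' k - D) / r with hy
  have hyk : ∀ k, |y k| ≤ (a * ε + b * ε ^ 2) / r := fun k => by
    rw [hy, abs_div, abs_of_pos hr0]
    gcongr
    exact hD' k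
  have hyh : ∀ k, |y k| ≤ 1 / 2 := fun k => by
    refine (hyk k).trans ?_
    rw [div_le_iff₀ hr0]
    nlinarith
  have hB := fun k => barrier_sub_le hA0 hDA (hyh k)
  have hysum : ∑ k ∈ Finset.range 4, y k ≤ (κ * ε ^ 2 + C * ε ^ 3) / r := by
    simp only [hy]
    rw [← Finset.sum_div]
    gcongr
    rw [Finset.sum_sub_distrib]
    simp only [Finset.sum_const, Finset.card_range, nsmul_eq_mul, Nat.cast_ofNat]
    linarith
  have hysq : ∀ k, y k ^ 2 ≤ (a ^ 2 * ε ^ 2 + (2 * a * b + b ^ 2) * ε ^ 3) / r ^ 2 := fun k => by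
    rw [← sq_abs]
    calc |y k| ^ 2 ≤ ((a * ε + b * ε ^ 2) / r) ^ 2 := by gcongr; exact hyk k
      _ = (a ^ 2 * ε ^ 2 + 2 * a * b * ε ^ 3 + b ^ 2 * ε ^ 4) / r ^ 2 := by
        rw [div_pow]; ring
      _ ≤ _ := by
        have : b ^ 2 * ε ^ 4 ≤ b ^ 2 * ε ^ 3 := mul_le_mul_of_nonneg_left hε43 (sq_nonneg b)
        exact div_le_div_of_nonneg_right (by linarith) (sq_nonneg r)
  have hexp : A ^ 2 / r ^ 2 ≤ Real.exp w - 1 := by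
    have h1 := Real.exp_le_exp.2 hw
    rw [exp_barrier hA0 hDA] at h1
    have h2 : 1 ≤ A ^ 2 / r ^ 2 := by
      rw [le_div_iff₀ (by positivity)]
      nlinarith
    have h3 : 2 * A ^ 2 / (A - D) ^ 2 = 2 * (A ^ 2 / r ^ 2) := by rw [hr]; ring
    linarith
  have hmain : ε ^ 2 * (2 * κ / r + 8 * a ^ 2 / r ^ 2) ≤ 4 * ε ^ 2 * ((Real.exp w - 1) / T) := by
    have h1 : 2 * κ / r + 8 * a ^ 2 / r ^ 2 ≤ 4 * (A ^ 2 / r ^ 2) / T := by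
      rw [show 2 * κ / r + 8 * a ^ 2 / r ^ 2 = (2 * κ * r + 8 * a ^ 2) / r ^ 2 by field_simp,
        show 4 * (A ^ 2 / r ^ 2) / T = (4 * A ^ 2 / T) / r ^ 2 by ring]
      gcongr
      rw [le_div_iff₀ hT, mul_comm]
      refine le_trans ?_ hA
      gcongr
    have h2 : 4 * (A ^ 2 / r ^ 2) / T ≤ 4 * ((Real.exp w - 1) / T) := by
      rw [mul_div_assoc]; gcongr
    nlinarith [sq_nonneg ε]
  have hCη : C * ε ^ 3 / r ≤ C / η * ε ^ 3 := by
    rw [div_mul_eq_mul_div]; gcongr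
  have hbη : (2 * a * b + b ^ 2) * ε ^ 3 / r ^ 2 ≤ (2 * a * b + b ^ 2) / η ^ 2 * ε ^ 3 := by
    rw [div_mul_eq_mul_div]; gcongr
  by_contra! hcon
  have hk := fun k => hcon k (hB k).1
  have hBk := fun k => (hB k).2
  have e1 : (κ * ε ^ 2 + C * ε ^ 3) / r = ε ^ 2 * (κ / r) + C * ε ^ 3 / r := by ring
  have e2 : (a ^ 2 * ε ^ 2 + (2 * a * b + b ^ 2) * ε ^ 3) / r ^ 2 =
    ε ^ 2 * (a ^ 2 / r ^ 2) + (2 * a * b + b ^ 2) * ε ^ 3 / r ^ 2 := by ring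
  have e3 : (C + 2 * C / η + 8 * (2 * a * b + b ^ 2) / η ^ 2) * ε ^ 3 =
    C * ε ^ 3 + 2 * (C / η * ε ^ 3) + 8 * ((2 * a * b + b ^ 2) / η ^ 2 * ε ^ 3) := by ring
  have e4 : ε ^ 2 * (2 * κ / r + 8 * a ^ 2 / r ^ 2) =
    2 * (ε ^ 2 * (κ / r)) + 8 * (ε ^ 2 * (a ^ 2 / r ^ 2)) := by ring
  have p1 : 0 ≤ C * ε ^ 3 := by positivity
  have p2 : 0 ≤ C / η * ε ^ 3 := by positivity
  have p3 : 0 ≤ (2 * a * b + b ^ 2) / η ^ 2 * ε ^ 3 := by positivity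
  rw [e1] at hysum
  rw [e2] at hysq
  rw [e4] at hmain
  change ∀ k, barrier A (D' k) - barrier A D ≤ 2 * y k + 2 * y k ^ 2 at hBk
  simp only [e3, Finset.sum_range_succ, Finset.sum_range_zero, zero_add] at *
  linarith [hk 0, hk 1, hk 2, hk 3, hBk 0, hBk 1, hBk 2, hBk 3, hysq 0, hysq 1, hysq 2, hysq 3]

end Barrier

section KeyFunction

lemma lap_eq_laplacian (f : ℂ → ℝ) (z : ℂ) : lap f z = Laplacian.laplacian f z := by
  rw [InnerProductSpace.laplacian_eq_iteratedFDeriv_complexPlane]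
  rfl

lemma lap_add {f g : ℂ → ℝ} {z : ℂ} (hf : ContDiffAt ℝ 2 f z) (hg : ContDiffAt ℝ 2 g z) :
    lap (fun z => f z + g z) z = lap f z + lap g z := by
  simp only [lap_eq_laplacian]
  exact hf.laplacian_add hg

lemma lap_sub {f g : ℂ → ℝ} {z : ℂ} (hf : ContDiffAt ℝ 2 f z) (hg : ContDiffAt ℝ 2 g z) :
    lap (fun z => f z - g z) z = lap f z - lap g z := by
  simp only [lap_eq_laplacian]
  exact hf.laplacian_sub hg

lemma lap_const (c : ℝ) (z : ℂ) : lap (fun _ => c) z = 0 := by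
  rw [lap_eq_laplacian]
  simp

variable {T : ℝ} {M : Set (ℂ × ℝ)} {u : ℂ → ℝ → ℝ} {O : Set ℂ} {H : ℂ → ℝ} {s₀ t : ℝ} {z : ℂ}

/-- The logarithm of the quotient of the expanding metric `2 (t - s₀) e^H |dz|²` and the flow. -/
noncomputable def logRatio (H : ℂ → ℝ) (u : ℂ → ℝ → ℝ) (s₀ : ℝ) (p : ℂ × ℝ) : ℝ :=
  H p.1 + Real.log (2 * (p.2 - s₀)) - Real.log (u p.1 p.2)

lemma exp_logRatio (hs : s₀ < t) (hu : 0 < u z t) :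
    Real.exp (logRatio H u s₀ (z, t)) = 2 * (t - s₀) * Real.exp (H z) / u z t := by
  have : 0 < t - s₀ := by linarith
  rw [logRatio, Real.exp_sub, Real.exp_add, Real.exp_log (by simp only; positivity),
    Real.exp_log hu]
  simp only
  ring

lemma ConfRFS.contDiffOn_logRatio (hR : ConfRFS T M u) (hH : ContDiffOn ℝ (⊤ : ℕ∞) H O) :
    ContDiffOn ℝ (⊤ : ℕ∞) (logRatio H u s₀) {p ∈ M | s₀ < p.2 ∧ p.1 ∈ O} := by
  refine ContDiffOn.sub (ContDiffOn.add ?_ ?_) (hR.contDiffOn_log.mono fun p hp => hp.1)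
  · exact hH.comp (f := Prod.fst) contDiff_fst.contDiffOn fun p hp => hp.2.2
  · refine ContDiffOn.log (by fun_prop) fun p hp => ?_
    have : 0 < p.2 - s₀ := sub_pos.2 hp.2.1
    positivity

lemma ConfRFS.isOpen_logRatio (hR : ConfRFS T M u) (hO : IsOpen O) :
    IsOpen {p ∈ M | s₀ < p.2 ∧ p.1 ∈ O} :=
  hR.opn.inter ((isOpen_lt continuous_const continuous_snd).inter (hO.preimage continuous_fst))

lemma ConfRFS.contDiffAt_log_slice (hR : ConfRFS T M u) (h : (z, t) ∈ M) :
    ContDiffAt ℝ 2 (fun w => Real.log (u w t)) z :=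
  (((hR.contDiffOn_log.contDiffAt (hR.opn.mem_nhds h)).of_le (WithTop.coe_le_coe.2 le_top)).comp z
    (f := fun w : ℂ => (w, t)) (by fun_prop))

lemma ConfRFS.logRatio_ineq (hR : ConfRFS T M u) (hO : IsOpen O)
    (hH : ContDiffOn ℝ (⊤ : ℕ∞) H O) (hlap : ∀ z ∈ O, 2 * Real.exp (H z) ≤ lap H z)
    (h : (z, t) ∈ M) (hs0 : 0 ≤ s₀) (hs : s₀ < t) (hz : z ∈ O)
    (hw : 0 ≤ logRatio H u s₀ (z, t)) :
    4 * ((Real.exp (logRatio H u s₀ (z, t)) - 1) / T) ≤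
      4 / u z t * lap (fun w => logRatio H u s₀ (w, t)) z
        - 4 * deriv (fun s => logRatio H u s₀ (z, s)) t := by
  have hu := hR.pos _ h
  simp only at hu
  have hT := (hR.sub h).2
  simp only at hT
  have hts : 0 < t - s₀ := by linarith
  have hlog := hR.contDiffAt_log_slice h
  have hH2 : ContDiffAt ℝ 2 H z := (hH.contDiffAt (hO.mem_nhds hz)).of_le (WithTop.coe_le_coe.2 le_top)
  have e1 : lap (fun w => logRatio H u s₀ (w, t)) z =
      lap H z - lap (fun w => Real.log (u w t)) z := by
    have := lap_sub (hH2.add (contDiffAt_const (c := Real.log (2 * (t - s₀))))) hlog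
    have h2 := lap_add hH2 (contDiffAt_const (c := Real.log (2 * (t - s₀))))
    rw [lap_const, add_zero] at h2
    rw [← h2]
    exact this
  have e2 : deriv (fun s => logRatio H u s₀ (z, s)) t =
      1 / (t - s₀) - lap (fun w => Real.log (u w t)) z / u z t := by
    have d1 : HasDerivAt (fun s => Real.log (2 * (s - s₀))) (2 / (2 * (t - s₀))) t := by
      have : HasDerivAt (fun s : ℝ => 2 * (s - s₀)) (2 * 1) t :=
        ((hasDerivAt_id t).sub_const s₀).const_mul 2
      rw [mul_one] at this
      exact this.log (by positivity)
    have d2 := (hR.hasDerivAt h).log hu.ne'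
    have d3 := ((hasDerivAt_const t (H z)).add d1).sub d2
    have : deriv (fun s => logRatio H u s₀ (z, s)) t = _ := d3.deriv
    rw [this]
    field_simp
    ring
  rw [e1, e2, exp_logRatio hs hu]
  have h1 : 1 ≤ 2 * (t - s₀) * Real.exp (H z) / u z t := by
    rw [← exp_logRatio hs hu]; exact Real.one_le_exp hw
  calc 4 * ((2 * (t - s₀) * Real.exp (H z) / u z t - 1) / T)
      ≤ 4 * ((2 * (t - s₀) * Real.exp (H z) / u z t - 1) / (t - s₀)) := by
        gcongr
        linarith
    _ = 4 / u z t * (2 * Real.exp (H z)) - 4 * (1 / (t - s₀)) := by field_simp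
    _ ≤ 4 / u z t * lap H z - 4 * (1 / (t - s₀)) := by
        gcongr
        exact hlap z hz
    _ = _ := by ring

end KeyFunction

section KeyStep

lemma norm_I_pow_mul (k : ℕ) (ζ : ℂ) : ‖Complex.I ^ k * ζ‖ = ‖ζ‖ := by simp

lemma abs_sq_norm_add_sub_le (x ζ : ℂ) : |‖x + ζ‖ ^ 2 - ‖x‖ ^ 2| ≤ 2 * ‖x‖ * ‖ζ‖ + ‖ζ‖ ^ 2 := by
  have h1 := norm_add_le x ζ
  have h2 := norm_sub_norm_le x (-ζ)
  rw [norm_neg, sub_neg_eq_add] at h2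
  rw [abs_le]
  constructor
  · by_cases h : ‖x‖ ≤ ‖ζ‖
    · nlinarith [norm_nonneg x, norm_nonneg ζ, sq_nonneg ‖x + ζ‖]
    · nlinarith [norm_nonneg x, norm_nonneg ζ, norm_nonneg (x + ζ)]
  · nlinarith [norm_nonneg x, norm_nonneg ζ, norm_nonneg (x + ζ)]

lemma sum_sq_norm_add_I_pow_mul (x ζ : ℂ) :
    ∑ k ∈ Finset.range 4, ‖x + Complex.I ^ k * ζ‖ ^ 2 = 4 * ‖x‖ ^ 2 + 4 * ‖ζ‖ ^ 2 := by
  simp only [Finset.sum_range_succ, Finset.sum_range_zero, pow_zero, pow_one, Complex.I_sq,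
    Complex.I_pow_three, Complex.sq_norm, Complex.normSq_apply, Complex.add_re, Complex.add_im,
    Complex.mul_re, Complex.mul_im, Complex.I_re, Complex.I_im, Complex.neg_re, Complex.neg_im,
    Complex.one_re, Complex.one_im]
  ring

variable {T : ℝ} {M : Set (ℂ × ℝ)} {u : ℂ → ℝ → ℝ} {O : Set ℂ} {H : ℂ → ℝ}
  {s₀ t₁ t₂ ρ κ A m m' : ℝ} {z₀ : ℂ} {K : Set (ℂ × ℝ)}

/-- At time `t` some point `x`, reached by a path from a point near `z₀`, violates the barrier
estimate for `logRatio` by at least `J`. -/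
def Violation (M : Set (ℂ × ℝ)) (u : ℂ → ℝ → ℝ) (H : ℂ → ℝ) (z₀ : ℂ) (s₀ ρ κ A t J : ℝ) : Prop :=
  ∃ y x ℓ, ‖y - z₀‖ ≤ ρ / 2 ∧ Reach (fun z => u z t) (timeSlice M t) y x ℓ ∧
    κ * ‖y - z₀‖ ^ 2 + ℓ < A ∧
    J ≤ logRatio H u s₀ (x, t) - barrier A (κ * ‖y - z₀‖ ^ 2 + ℓ)

set_option maxHeartbeats 2000000 in
theorem exists_violation_step (hR : ConfRFS T M u) (hE : Expanding T M) (hO : IsOpen O)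
    (hH : ContDiffOn ℝ (⊤ : ℕ∞) H O) (hlap : ∀ z ∈ O, 2 * Real.exp (H z) ≤ lap H z)
    (hMO : timeSlice M t₁ ⊆ O) (hs₀ : 0 ≤ s₀) (ht₂ : s₀ < t₂) (ht₁ : t₁ < T)
    (hρ : 0 < ρ) (hm : 0 < m) (hκ : 0 < κ) (hA0 : 0 < A)
    (hball : ∀ t ∈ Icc s₀ t₁, ∀ z ∈ closedBall z₀ ρ, (z, t) ∈ M ∧ m ≤ u z t ∧ u z t ≤ m')
    (hK : IsCompact K) (hKM : K ⊆ M)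
    (htube : ∀ t ∈ Icc s₀ t₁, ∀ y ∈ closedBall z₀ ρ, ∀ w L, L ≤ A →
      Reach (fun z => u z t) (timeSlice M t) y w L → (w, t) ∈ K)
    (hm' : 4 * Real.sqrt m' ≤ κ * ρ)
    (hA : T * (2 * (16 * κ / m) * A + 8 * (2 * κ * ρ / Real.sqrt m) ^ 2) ≤ 4 * A ^ 2) :
    ∃ C ≥ (0:ℝ), ∃ ε₀ > (0:ℝ), ∀ ε ∈ Ioc 0 ε₀, ∀ t J, t ≤ t₁ → t₂ ≤ t - ε ^ 2 → 0 ≤ J →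
      Violation M u H z₀ s₀ ρ κ A t J → Violation M u H z₀ s₀ ρ κ A (t - ε ^ 2) (J - C * ε ^ 3) := by
  set M' := {p ∈ M | s₀ < p.2 ∧ p.1 ∈ O} with hM'
  have hM'o : IsOpen M' := hR.isOpen_logRatio hO
  have hwsm := hR.contDiffOn_logRatio (s₀ := s₀) hH
  set K' := K ∩ univ ×ˢ Icc t₂ t₁ with hK'
  have hK'c : IsCompact K' := hK.inter_right (isClosed_univ.prod isClosed_Icc)
  have hK'M : K' ⊆ M' := fun p hp => by
    refine ⟨hKM hp.1, ht₂.trans_le hp.2.2.1, hMO ?_⟩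
    exact hE p.1 p.2 t₁ (hKM hp.1) hp.2.2.2 ht₁
  by_cases hKne : K.Nonempty
  swap
  · refine ⟨0, le_rfl, 1, one_pos, fun ε hε t J ht ht' hJ ⟨y, x, ℓ, h1, h2, h3, h4⟩ => ?_⟩
    refine absurd ⟨_, htube t ⟨by nlinarith [hε.1], ht⟩ y ?_ x ℓ ?_ h2⟩ hKne
    · rw [mem_closedBall, dist_eq_norm]; linarith
    · nlinarith [mul_nonneg hκ.le (sq_nonneg ‖y - z₀‖)]
  obtain ⟨p₁, hp₁, hpmin⟩ := hK.exists_isMinOn hKne (hR.smooth.continuousOn.mono hKM)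
  set m₁ := u p₁.1 p₁.2 with hm₁
  have hm₁0 : 0 < m₁ := hR.pos _ (hKM hp₁)
  have hm₁le : ∀ p ∈ K, m₁ ≤ u p.1 p.2 := fun p hp => hpmin hp
  obtain ⟨W, hW⟩ := hK'c.bddAbove_image (hwsm.continuousOn.mono hK'M)
  have hWle : ∀ p ∈ K', logRatio H u s₀ p ≤ W := fun p hp => hW ⟨p, hp, rfl⟩
  obtain ⟨C₁, hC₁, ε₁, hε₁, hback⟩ := exists_backward_step hR hK hKM hA0.le
  obtain ⟨C₂, hC₂, ε₂, hε₂, hfour⟩ := exists_four_point hM'o hwsm hK'c hK'M (2 / Real.sqrt m₁)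
  set a := 2 * κ * ρ / Real.sqrt m with ha
  set b := 4 * κ / m + C₁ with hb
  set C := C₁ + C₂ with hC
  have hsm : 0 < Real.sqrt m := Real.sqrt_pos.2 hm
  have ha0 : 0 ≤ a := by positivity
  have hb0 : 0 ≤ b := by positivity
  have hC0 : 0 ≤ C := by positivity
  set η := A * Real.exp (-W / 2) with hη
  have hη0 : 0 < η := by positivity
  refine ⟨C + 2 * C / η + 8 * (2 * a * b + b ^ 2) / η ^ 2, by positivity,
    min (min ε₁ ε₂) (min (min 1 (ρ * Real.sqrt m / 4)) (η / 2 / (a + b + 1))), by positivity,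
    fun ε hε t J ht ht' hJ ⟨y, x, ℓ, h1, h2, h3, h4⟩ => ?_⟩
  have hε0 := hε.1
  obtain ⟨⟨hεa, hεb⟩, ⟨hεc, hεd⟩, hεe⟩ :
    (ε ≤ ε₁ ∧ ε ≤ ε₂) ∧ (ε ≤ 1 ∧ ε ≤ ρ * Real.sqrt m / 4) ∧ ε ≤ η / 2 / (a + b + 1) := by
    simpa only [le_min_iff] using hε.2
  have hεsq : 0 < ε ^ 2 := by positivity
  have htt : t ∈ Icc s₀ t₁ := ⟨by linarith, ht⟩
  have htt' : t - ε ^ 2 ∈ Icc s₀ t₁ := ⟨by linarith, by linarith⟩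
  have hyball : y ∈ closedBall z₀ ρ := by rw [mem_closedBall, dist_eq_norm]; linarith
  have hκy : 0 ≤ κ * ‖y - z₀‖ ^ 2 := by positivity
  have hℓ0 : 0 ≤ ℓ := h2.nonneg
  have hℓA : ℓ ≤ A := by linarith
  have hxK : (x, t) ∈ K := htube t htt y hyball x ℓ hℓA h2
  have hxK' : (x, t) ∈ K' := ⟨hxK, mem_univ _, by simp only; linarith, ht⟩
  have hux := hR.pos _ (hKM hxK)
  simp only at hux
  obtain ⟨ζ₀, ζ₁, hζ₀, hζ₁, ℓ', hℓ', hℓs⟩ := hback ε ⟨hε0, hεa⟩ t y x ℓ hℓA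
    (fun w L hL hr => htube t htt y hyball w L (hL.trans hℓA) hr) h2
  have huy := (hball t htt y hyball).2.1
  have hζ₀le : ‖ζ₀‖ ≤ 2 * ε / Real.sqrt m := by
    rw [hζ₀]; gcongr
  have hζ₀sq : ‖ζ₀‖ ^ 2 ≤ 4 * ε ^ 2 / m := by
    calc ‖ζ₀‖ ^ 2 ≤ (2 * ε / Real.sqrt m) ^ 2 := by gcongr
      _ = _ := by rw [div_pow, Real.sq_sqrt hm.le]; ring
  have hζ₁le : ‖ζ₁‖ ≤ 2 / Real.sqrt m₁ * ε := by
    rw [hζ₁, div_mul_eq_mul_div]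
    have := hm₁le _ hxK
    have := Real.sqrt_pos.2 hm₁0
    gcongr
  have hζ₁sq : ‖ζ₁‖ ^ 2 = ε ^ 2 * (4 / u x t) := by
    rw [hζ₁, div_pow, Real.sq_sqrt hux.le]; ring
  obtain ⟨hf1, hf2⟩ := hfour ε ⟨hε0, hεb⟩ x t hxK' ζ₁ hζ₁le
  set D := κ * ‖y - z₀‖ ^ 2 + ℓ with hD
  have hD0 : 0 ≤ D := by linarith
  set w := logRatio H u s₀ (x, t) with hw
  have hwD : barrier A D ≤ w := by linarith
  have hwpos : 0 ≤ w := (barrier_pos hA0 hD0 h3).le.trans hwD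
  set Y : ℕ → ℂ := fun k => y + Complex.I ^ k * ζ₀ with hY
  set D' : ℕ → ℝ := fun k => κ * ‖Y k - z₀‖ ^ 2 + ℓ' k with hD'
  set w' : ℕ → ℝ := fun k => logRatio H u s₀ (x + Complex.I ^ k * ζ₁, t - ε ^ 2) with hw'
  have hYsub : ∀ k, Y k - z₀ = (y - z₀) + Complex.I ^ k * ζ₀ := fun k => by rw [hY]; ring
  have hηD : η ≤ A - D := by
    have hb1 : barrier A D ≤ W := hwD.trans (hWle _ hxK')
    have hb2 := Real.exp_le_exp.2 hb1
    rw [exp_barrier hA0 h3] at hb2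
    have hr : 0 < A - D := by linarith
    rw [div_le_iff₀ (by positivity)] at hb2
    refine (pow_le_pow_iff_left₀ hη0.le hr.le two_ne_zero).1 ?_
    rw [hη, mul_pow, ← Real.exp_nat_mul]
    have e1 : ((2:ℕ):ℝ) * (-W / 2) = -W := by push_cast; ring
    rw [e1, Real.exp_neg, ← div_eq_mul_inv, div_le_iff₀ (Real.exp_pos _)]
    nlinarith only [hb2, sq_nonneg A]
  have hsmall : (a + b) * ε ≤ η / 2 := by
    rw [le_div_iff₀ (by positivity)] at hεe
    linarith
  have hDk : ∀ k, |D' k - D| ≤ a * ε + b * ε ^ 2 := fun k => by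
    have e1 : D' k - D = κ * (‖Y k - z₀‖ ^ 2 - ‖y - z₀‖ ^ 2) + (ℓ' k - ℓ) := by
      simp only [hD', hD]; ring
    have e2 := abs_sq_norm_add_sub_le (y - z₀) (Complex.I ^ k * ζ₀)
    rw [← hYsub, norm_I_pow_mul] at e2
    rw [e1]
    refine (abs_add_le _ _).trans ?_
    rw [abs_mul, abs_of_pos hκ]
    calc κ * |‖Y k - z₀‖ ^ 2 - ‖y - z₀‖ ^ 2| + |ℓ' k - ℓ|
        ≤ κ * (2 * ‖y - z₀‖ * ‖ζ₀‖ + ‖ζ₀‖ ^ 2) + C₁ * ε ^ 2 := by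
          gcongr; exact (hℓ' k).2
      _ ≤ κ * (2 * (ρ / 2) * (2 * ε / Real.sqrt m) + 4 * ε ^ 2 / m) + C₁ * ε ^ 2 := by gcongr
      _ = a * ε + b * ε ^ 2 := by rw [ha, hb]; ring
  have hDs : ∑ k ∈ Finset.range 4, D' k ≤ 4 * D + 16 * κ / m * ε ^ 2 + C * ε ^ 3 := by
    have e1 : ∑ k ∈ Finset.range 4, D' k =
        κ * (4 * ‖y - z₀‖ ^ 2 + 4 * ‖ζ₀‖ ^ 2) + ∑ k ∈ Finset.range 4, ℓ' k := by
      rw [← sum_sq_norm_add_I_pow_mul, Finset.mul_sum, ← Finset.sum_add_distrib]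
      simp only [hD', hYsub]
    rw [e1]
    have e2 : κ * (4 * ‖ζ₀‖ ^ 2) ≤ κ * (4 * (4 * ε ^ 2 / m)) := by gcongr
    have e3 : κ * (4 * (4 * ε ^ 2 / m)) = 16 * κ / m * ε ^ 2 := by ring
    have e4 : 0 ≤ C₂ * ε ^ 3 := by positivity
    rw [hC]
    linarith
  have hws : 4 * w + 4 * ε ^ 2 * ((Real.exp w - 1) / T) - C * ε ^ 3 ≤
      ∑ k ∈ Finset.range 4, w' k := by
    have e1 := hR.logRatio_ineq hO hH hlap (hKM hxK) hs₀ (hK'M hxK').2.1 (hK'M hxK').2.2 hwpos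
    have e2 := (abs_le.1 hf2).1
    rw [hζ₁sq] at e2
    have e3 := mul_le_mul_of_nonneg_left e1 (sq_nonneg ε)
    have e4 : 0 ≤ C₁ * ε ^ 3 := by positivity
    rw [hC]
    simp only [hw']
    linarith
  obtain ⟨k, hk1, hk2⟩ := exists_index_of_average
    ((hs₀.trans_lt ht₂).trans_le (by linarith [htt'.2]) |>.trans ht₁)
    hη0 hηD hD0 ha0 hb0 (by positivity : 0 ≤ 16 * κ / m) hC0 hε0 hεc hsmall hA hDk hDs hwD hws
  have hfin : J - (C + 2 * C / η + 8 * (2 * a * b + b ^ 2) / η ^ 2) * ε ^ 3 ≤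
    w' k - barrier A (D' k) := by linarith
  by_cases hYk : ‖Y k - z₀‖ ≤ ρ / 2
  · exact ⟨Y k, _, ℓ' k, hYk, (hℓ' k).1, hk1, hfin⟩
  rw [not_le] at hYk
  have hYρ : ‖Y k - z₀‖ ≤ ρ := by
    have e1 : 2 * ε / Real.sqrt m ≤ ρ / 2 := by
      rw [div_le_iff₀ hsm]; linarith
    rw [hYsub]
    refine (norm_add_le _ _).trans ?_
    rw [norm_I_pow_mul]
    linarith
  have hv := hR.continuousOn_slice (t - ε ^ 2)
  have hr := (reach_of_mem_closedBall hv (fun z hz => ⟨(hball _ htt' z hz).1, (hball _ htt' z hz).2.2⟩)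
    (by rwa [mem_closedBall, dist_eq_norm] : Y k ∈ closedBall z₀ ρ)).trans hv (hℓ' k).1
  have hle : Real.sqrt m' * ‖Y k - z₀‖ + ℓ' k ≤ D' k := by
    have : Real.sqrt m' * ‖Y k - z₀‖ ≤ κ * ‖Y k - z₀‖ ^ 2 := by
      rw [sq, ← mul_assoc]
      gcongr
      nlinarith only [hm', mul_lt_mul_of_pos_left hYk hκ, Real.sqrt_nonneg m']
    simp only [hD']; linarith
  refine ⟨z₀, _, _, by simp; linarith, hr, ?_, ?_⟩
  · simp only [sub_self, norm_zero]
    linarith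
  · refine hfin.trans (sub_le_sub_left (barrier_mono hA0 hk1 ?_) _)
    simp only [sub_self, norm_zero]
    linarith

end KeyStep

section KeyEstimate

variable {T : ℝ} {M : Set (ℂ × ℝ)} {u : ℂ → ℝ → ℝ} {O : Set ℂ} {H : ℂ → ℝ}
  {s₀ t₁ t₂ ρ κ A C ε₀ : ℝ} {z₀ z₁ : ℂ}

lemma exists_violation_of_step (ht : t₂ < t₁) (hC : 0 ≤ C) (hε₀ : 0 < ε₀)
    (hstep : ∀ ε ∈ Ioc 0 ε₀, ∀ t J, t ≤ t₁ → t₂ ≤ t - ε ^ 2 → 0 ≤ J →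
      Violation M u H z₀ s₀ ρ κ A t J → Violation M u H z₀ s₀ ρ κ A (t - ε ^ 2) (J - C * ε ^ 3))
    {J : ℝ} (hJ : 0 < J) (h : Violation M u H z₀ s₀ ρ κ A t₁ J) :
    Violation M u H z₀ s₀ ρ κ A t₂ 0 := by
  have htt : 0 < t₁ - t₂ := by linarith
  set δ := min ε₀ (J / (C * (t₁ - t₂) + 1)) with hδ
  have hC1 : 0 < C * (t₁ - t₂) + 1 := by positivity
  have hδ0 : 0 < δ := lt_min hε₀ (by positivity)
  obtain ⟨n, hn⟩ := exists_nat_gt ((t₁ - t₂) / δ ^ 2)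
  have hn0 : (0:ℝ) < n := lt_of_le_of_lt (by positivity) hn
  set ε := Real.sqrt ((t₁ - t₂) / n) with hε
  have hε0 : 0 < ε := Real.sqrt_pos.2 (by positivity)
  have hε2 : ε ^ 2 = (t₁ - t₂) / n := Real.sq_sqrt (by positivity)
  have hnε : n * ε ^ 2 = t₁ - t₂ := by rw [hε2]; field_simp
  have hεδ : ε < δ := by
    rw [hε, Real.sqrt_lt' hδ0, div_lt_iff₀ hn0]
    rw [div_lt_iff₀ (by positivity)] at hn
    linarith
  have herr : (n * ε ^ 2) * (C * ε) ≤ J := by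
    rw [hnε]
    have h1 : ε ≤ J / (C * (t₁ - t₂) + 1) := hεδ.le.trans (min_le_right _ _)
    rw [le_div_iff₀ hC1] at h1
    linarith
  have key : ∀ j : ℕ, j ≤ n →
      Violation M u H z₀ s₀ ρ κ A (t₁ - j * ε ^ 2) (J - j * (C * ε ^ 3)) := by
    intro j
    induction j with
    | zero => intro _; simpa using h
    | succ j ih =>
      intro hj
      have hj' : (j:ℝ) + 1 ≤ n := by exact_mod_cast hj
      have hj0 : (0:ℝ) ≤ j := by positivity
      have hs := hstep ε ⟨hε0, hεδ.le.trans (min_le_left _ _)⟩ (t₁ - j * ε ^ 2)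
        (J - j * (C * ε ^ 3)) (by nlinarith [sq_nonneg ε]) ?_ ?_ (ih (by omega))
      · push_cast
        rw [add_mul, add_mul, one_mul, one_mul, ← sub_sub, ← sub_sub]
        exact hs
      · nlinarith [sq_nonneg ε]
      · have : (j:ℝ) * (C * ε ^ 3) ≤ n * (C * ε ^ 3) := by gcongr; linarith
        linarith
  have := key n le_rfl
  rw [hnε, sub_sub_cancel] at this
  obtain ⟨y, x, ℓ, h1, h2, h3, h4⟩ := this
  exact ⟨y, x, ℓ, h1, h2, h3, by linarith⟩

/-- Comparison of a complete spacetime with an expanding metric of curvature at most `-1/(t-s₀)`: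
only a curve leading back to time `s₀` is needed, no information at time `s₀`. -/
theorem mul_exp_le_of_lap (hR : ConfRFS T M u) (hC : ConfRFSComplete T M u) (hE : Expanding T M)
    (hO : IsOpen O) (hH : ContDiffOn ℝ (⊤ : ℕ∞) H O)
    (hlap : ∀ z ∈ O, 2 * Real.exp (H z) ≤ lap H z) (hMO : timeSlice M t₁ ⊆ O)
    (hz₀ : (z₀, s₀) ∈ M) (hs : s₀ < t₁) (ht₁ : t₁ < T)
    (hz₁ : z₁ ∈ connectedComponentIn (timeSlice M t₁) z₀) :
    (t₁ - s₀) * Real.exp (H z₁) ≤ 4 * u z₁ t₁ := by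
  have hs₀ : 0 < s₀ := (hR.sub hz₀).1
  have hT : 0 < T := by linarith
  have hz₁M : (z₁, t₁) ∈ M := connectedComponentIn_subset (timeSlice M t₁) _ hz₁
  obtain ⟨ρ, hρ, hρM⟩ := Metric.nhds_basis_closedBall.mem_iff.1
    ((hR.isOpen_timeSlice s₀).mem_nhds hz₀)
  have hB : closedBall z₀ ρ ×ˢ Icc s₀ t₁ ⊆ M := fun p hp =>
    hE p.1 s₀ p.2 (hρM hp.1) hp.2.1 (hp.2.2.trans_lt ht₁)
  have hBc : IsCompact (closedBall z₀ ρ ×ˢ Icc s₀ t₁) :=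
    (isCompact_closedBall z₀ ρ).prod isCompact_Icc
  have hBne : (closedBall z₀ ρ ×ˢ Icc s₀ t₁).Nonempty :=
    ⟨(z₀, s₀), mem_closedBall_self hρ.le, left_mem_Icc.2 hs.le⟩
  have huc := hR.smooth.continuousOn.mono hB
  obtain ⟨p, hp, hpmin⟩ := hBc.exists_isMinOn hBne huc
  obtain ⟨q, -, hqmax⟩ := hBc.exists_isMaxOn hBne huc
  obtain ⟨m, hm⟩ : ∃ m, m = u p.1 p.2 := ⟨_, rfl⟩
  obtain ⟨m', hm'⟩ : ∃ m', m' = u q.1 q.2 := ⟨_, rfl⟩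
  have hm0 : 0 < m := hm ▸ hR.pos _ (hB hp)
  have hball : ∀ t ∈ Icc s₀ t₁, ∀ z ∈ closedBall z₀ ρ, (z, t) ∈ M ∧ m ≤ u z t ∧ u z t ≤ m' :=
    fun t ht z hz => ⟨hB ⟨hz, ht⟩, hm ▸ hpmin (a := (z, t)) ⟨hz, ht⟩,
      hm' ▸ hqmax (a := (z, t)) ⟨hz, ht⟩⟩
  have hm'0 : 0 < m' := by
    have := hball s₀ (left_mem_Icc.2 hs.le) z₀ (mem_closedBall_self hρ.le)
    linarith
  have hv := fun t => hR.continuousOn_slice t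
  obtain ⟨D₀, hD₀⟩ := exists_reach_of_mem_component (hR.isOpen_timeSlice t₁) (hv t₁) hz₁
  have hD₀0 := hD₀.nonneg
  obtain ⟨κ, hκ⟩ : ∃ κ, κ = 4 * Real.sqrt m' / ρ := ⟨_, rfl⟩
  have hκ0 : 0 < κ := by have := Real.sqrt_pos.2 hm'0; rw [hκ]; positivity
  obtain ⟨P, hP⟩ : ∃ P, P = 16 * κ / m := ⟨_, rfl⟩
  obtain ⟨a, ha⟩ : ∃ a, a = 2 * κ * ρ / Real.sqrt m := ⟨_, rfl⟩
  have hP0 : 0 ≤ P := by rw [hP]; positivity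
  obtain ⟨A, hA⟩ : ∃ A, A = 2 * D₀ + 1 + T * P / 2 + 2 * T * a ^ 2 := ⟨_, rfl⟩
  have q1 : 0 ≤ T * P / 2 := by positivity
  have q2 : 0 ≤ 2 * T * a ^ 2 := by positivity
  have hA1 : 1 ≤ A := by linarith
  have hAD : 2 * D₀ + 1 ≤ A := by linarith
  have hA0 : 0 < A := by linarith
  have hAineq : T * (2 * P * A + 8 * a ^ 2) ≤ 4 * A ^ 2 := by
    have h1 : T * P / 2 + 2 * T * a ^ 2 ≤ A := by linarith
    have h2 := mul_le_mul_of_nonneg_left h1 hA0.le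
    have h3 := mul_le_mul_of_nonneg_right hA1 q2
    nlinarith
  obtain ⟨K, hK, hKM, htube⟩ := exists_tube hR hC hE hz₀ ht₁ (Real.sqrt m' * ρ + A)
  have htube' : ∀ t ∈ Icc s₀ t₁, ∀ y ∈ closedBall z₀ ρ, ∀ w L, L ≤ A →
      Reach (fun z => u z t) (timeSlice M t) y w L → (w, t) ∈ K := fun t ht y hy w L hL hr => by
    have h1 := (reach_of_mem_closedBall (hv t) (fun z hz => ⟨(hball t ht z hz).1,
      (hball t ht z hz).2.2⟩) hy).trans (hv t) hr
    refine htube t ht w (h1.mono (add_le_add ?_ hL))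
    rw [mem_closedBall, dist_eq_norm] at hy
    gcongr
  have hK'c : IsCompact (K ∩ univ ×ˢ Icc s₀ t₁) := hK.inter_right (isClosed_univ.prod isClosed_Icc)
  have hK'O : ∀ p ∈ K ∩ univ ×ˢ Icc s₀ t₁, p.1 ∈ O := fun p hp =>
    hMO (hE p.1 p.2 t₁ (hKM hp.1) hp.2.2.2 ht₁)
  have hc : ContinuousOn (fun p : ℂ × ℝ => H p.1 - Real.log (u p.1 p.2))
      (K ∩ univ ×ˢ Icc s₀ t₁) :=
    (hH.continuousOn.comp continuousOn_fst hK'O).sub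
      (hR.contDiffOn_log.continuousOn.mono (inter_subset_left.trans hKM))
  obtain ⟨W, hW⟩ := hK'c.bddAbove_image hc
  obtain ⟨t₂, ht₂⟩ : ∃ t₂, t₂ = s₀ + min ((t₁ - s₀) / 2) (Real.exp (-W) / 2) := ⟨_, rfl⟩
  have hmin : 0 < min ((t₁ - s₀) / 2) (Real.exp (-W) / 2) :=
    lt_min (by linarith) (by positivity)
  have hst₂ : s₀ < t₂ := by linarith
  have ht₂₁ : t₂ < t₁ := by
    have := min_le_left ((t₁ - s₀) / 2) (Real.exp (-W) / 2)
    linarith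
  obtain ⟨C, hC0, ε₀, hε₀, hstep⟩ := exists_violation_step (κ := κ) (A := A) hR hE hO hH hlap hMO
    hs₀.le hst₂ ht₁ hρ hm0 hκ0 hA0 hball hK hKM htube' (by rw [hκ]; field_simp; rfl)
    (by rw [← hP, ← ha]; exact hAineq)
  have hbar : Real.exp (barrier A D₀) ≤ 8 := by
    rw [exp_barrier hA0 (by linarith), div_le_iff₀ (by nlinarith)]
    nlinarith
  have hmain : logRatio H u s₀ (z₁, t₁) ≤ barrier A D₀ := by
    by_contra! hcon
    obtain ⟨y, x, ℓ, h1, h2, h3, h4⟩ := exists_violation_of_step ht₂₁ hC0 hε₀ hstep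
      (sub_pos.2 hcon) ⟨z₀, z₁, D₀, by simp; linarith, hD₀, by simp; linarith, by simp⟩
    have hy : y ∈ closedBall z₀ ρ := by rw [mem_closedBall, dist_eq_norm]; linarith
    have hℓ := h2.nonneg
    have hyy : 0 ≤ κ * ‖y - z₀‖ ^ 2 := by positivity
    have ht₂I : t₂ ∈ Icc s₀ t₁ := ⟨hst₂.le, ht₂₁.le⟩
    have hxK := htube' t₂ ht₂I y hy x ℓ (by linarith) h2
    have hWx : H x - Real.log (u x t₂) ≤ W := hW ⟨(x, t₂), ⟨hxK, mem_univ _, ht₂I⟩, rfl⟩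
    have hb := barrier_pos hA0 (by linarith) h3
    have hlog : Real.log (2 * (t₂ - s₀)) ≤ -W := by
      rw [Real.log_le_iff_le_exp (by linarith)]
      have := min_le_right ((t₁ - s₀) / 2) (Real.exp (-W) / 2)
      linarith
    simp only [logRatio] at h4
    linarith
  have hu := hR.pos _ hz₁M
  simp only at hu
  have hfin := (Real.exp_le_exp.2 hmain).trans hbar
  rw [exp_logRatio hs hu, div_le_iff₀ hu] at hfin
  linarith

end KeyEstimate

section HyperbolicMetric

/-- The Laplacian of a radial function. -/
lemma lap_radial {f f' : ℝ → ℝ} {f'' c : ℝ} {p z : ℂ}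
    (hf : ∀ᶠ s in nhds (c * ‖z - p‖ ^ 2), HasDerivAt f (f' s) s)
    (hf' : HasDerivAt f' f'' (c * ‖z - p‖ ^ 2)) :
    lap (fun w => f (c * ‖w - p‖ ^ 2)) z =
      4 * c * (f' (c * ‖z - p‖ ^ 2) + c * ‖z - p‖ ^ 2 * f'') := by
  set L : ℂ → ℂ →L[ℝ] ℝ := fun w => (2 * c) • innerSL ℝ (w - p) with hL
  have hN : ∀ w, HasFDerivAt (fun w : ℂ => c * ‖w - p‖ ^ 2) (L w) w := fun w => by
    have h1 := ((hasFDerivAt_id w).sub_const p).norm_sq.const_mul c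
    refine h1.congr_fderiv ?_
    ext x
    simp [hL]
    ring
  have hev : ∀ᶠ w in nhds z, fderiv ℝ (fun w => f (c * ‖w - p‖ ^ 2)) w =
      f' (c * ‖w - p‖ ^ 2) • L w := by
    filter_upwards [(hN z).continuousAt.eventually hf] with w hw
    exact (hw.comp_hasFDerivAt w (hN w)).fderiv
  obtain ⟨B, hB, hL'⟩ : ∃ B : ℂ →L[ℝ] ℂ →L[ℝ] ℝ, (∀ x y, B x y = 2 * c * inner ℝ x y) ∧
      HasFDerivAt L B z := by
    refine ⟨(2 * c) • innerSL ℝ, fun x y => rfl, ?_⟩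
    have : HasFDerivAt (fun w : ℂ => innerSL ℝ (w - p)) (innerSL ℝ) z :=
      (innerSL ℝ (E := ℂ)).hasFDerivAt.comp z ((hasFDerivAt_id (𝕜 := ℝ) z).sub_const p)
    exact this.const_smul (2 * c)
  have h2 := ((hf'.comp_hasFDerivAt z (hN z)).smul hL')
  have h3 : fderiv ℝ (fderiv ℝ (fun w => f (c * ‖w - p‖ ^ 2))) z = _ :=
    (Filter.EventuallyEq.fderiv_eq hev).trans h2.fderiv
  simp only [lap, iteratedFDeriv_two_apply]
  rw [h3]
  simp [hL, hB, Complex.inner, Complex.sq_norm, Complex.normSq_apply]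
  ring

lemma lap_radial_of_euler {f ψ : ℝ → ℝ} {ψ' c : ℝ} {p z : ℂ} (hc : 0 < c) (hz : z ≠ p)
    (hf : ∀ s, 0 < s → HasDerivAt f (ψ s / s) s) (hψ : HasDerivAt ψ ψ' (c * ‖z - p‖ ^ 2)) :
    lap (fun w => f (c * ‖w - p‖ ^ 2)) z = 4 * c * ψ' := by
  have hs : 0 < c * ‖z - p‖ ^ 2 := by
    have := norm_pos_iff.2 (sub_ne_zero.2 hz)
    positivity
  rw [lap_radial (f' := fun s => ψ s / s) ((eventually_gt_nhds hs).mono hf)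
    (hψ.div (hasDerivAt_id _) hs.ne')]
  generalize c * ‖z - p‖ ^ 2 = s at *
  field_simp
  ring

/-- The radial building block of an explicit metric of curvature at most `-1` on the twice punctured
plane, as a function of the squared distance. -/
noncomputable def radialPart (s : ℝ) : ℝ :=
  Real.log (1 + Real.exp (Real.log s / 6)) - 5 / 6 * Real.log s

lemma exp_radialPart {s : ℝ} : Real.exp (radialPart s) =
    (1 + Real.exp (Real.log s / 6)) / Real.exp (Real.log s / 6) ^ 5 := by
  rw [radialPart, Real.exp_sub, Real.exp_log (by positivity), ← Real.exp_nat_mul]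
  congr 2
  push_cast; ring

lemma exp_log_div_six_pow {s : ℝ} (hs : 0 < s) : Real.exp (Real.log s / 6) ^ 6 = s := by
  rw [← Real.exp_nat_mul]
  push_cast
  rw [mul_div_cancel₀ _ (by norm_num), Real.exp_log hs]

lemma lap_radialPart {c : ℝ} {p z : ℂ} (hc : 0 < c) (hz : z ≠ p) :
    lap (fun w => radialPart (c * ‖w - p‖ ^ 2)) z = c / 9 *
      (1 / (Real.exp (Real.log (c * ‖z - p‖ ^ 2) / 6) ^ 5 *
        (1 + Real.exp (Real.log (c * ‖z - p‖ ^ 2) / 6)) ^ 2)) := by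
  have hs : 0 < c * ‖z - p‖ ^ 2 := by
    have := norm_pos_iff.2 (sub_ne_zero.2 hz)
    positivity
  have ha : ∀ s : ℝ, 0 < s → HasDerivAt (fun s => Real.exp (Real.log s / 6))
      (Real.exp (Real.log s / 6) * (s⁻¹ / 6)) s := fun s hs =>
    ((Real.hasDerivAt_log hs.ne').div_const 6).exp
  have hψ : ∀ s : ℝ, 0 < s → HasDerivAt
      (fun s => Real.exp (Real.log s / 6) / (1 + Real.exp (Real.log s / 6)) / 6 - 5 / 6)
      (1 / 36 * (1 / (Real.exp (Real.log s / 6) ^ 5 * (1 + Real.exp (Real.log s / 6)) ^ 2))) s := by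
    intro s hs
    have h := (((ha s hs).div ((ha s hs).const_add 1) (by positivity)).div_const 6).sub_const (5 / 6)
    refine h.congr_deriv ?_
    have h6 := exp_log_div_six_pow hs
    set a := Real.exp (Real.log s / 6)
    have ha0 : 0 < a := Real.exp_pos _
    rw [← h6]
    field_simp
    ring
  have h := lap_radial_of_euler (f := radialPart) hc hz (fun s hs => ?_) (hψ _ hs)
  · rw [h]; ring
  · have h := (((ha s hs).const_add 1).log (by positivity)).sub
      ((Real.hasDerivAt_log hs.ne').const_mul (5 / 6))
    refine HasDerivAt.congr_deriv h ?_
    field_simp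

lemma contDiffOn_radialPart {c : ℝ} {p : ℂ} (hc : 0 < c) :
    ContDiffOn ℝ (⊤ : ℕ∞) (fun w => radialPart (c * ‖w - p‖ ^ 2)) {p}ᶜ := by
  have hs : ∀ z ∈ ({p}ᶜ : Set ℂ), c * ‖z - p‖ ^ 2 ≠ 0 := fun z hz => by
    have := norm_pos_iff.2 (sub_ne_zero.2 hz)
    positivity
  have h1 : ContDiffOn ℝ (⊤ : ℕ∞) (fun w : ℂ => c * ‖w - p‖ ^ 2) {p}ᶜ :=
    (contDiff_const.mul ((contDiff_id.sub contDiff_const).norm_sq ℝ)).contDiffOn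
  have h2 := h1.log hs
  refine ContDiffOn.sub (ContDiffOn.log ?_ fun z _ => by positivity) (contDiffOn_const.mul h2)
  exact contDiffOn_const.add (h2.div_const 6).exp

/-- The logarithm of the conformal factor of a metric of curvature at most `-1` on `ℂ ∖ {p, q}`. -/
noncomputable def logMetric (p q z : ℂ) : ℝ :=
  Real.log ((2916 * ‖q - p‖ ^ 2)⁻¹) + radialPart ((‖q - p‖ ^ 2)⁻¹ * ‖z - p‖ ^ 2)
    + radialPart ((‖q - p‖ ^ 2)⁻¹ * ‖z - q‖ ^ 2)

lemma isOpen_compl_pair (p q : ℂ) : IsOpen ({p}ᶜ ∩ {q}ᶜ : Set ℂ) :=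
  isOpen_compl_singleton.inter isOpen_compl_singleton

variable {p q z : ℂ}

lemma contDiffOn_logMetric (hpq : p ≠ q) :
    ContDiffOn ℝ (⊤ : ℕ∞) (logMetric p q) ({p}ᶜ ∩ {q}ᶜ) := by
  have hc : 0 < (‖q - p‖ ^ 2)⁻¹ := by
    have := norm_pos_iff.2 (sub_ne_zero.2 hpq.symm)
    positivity
  exact (contDiffOn_const.add ((contDiffOn_radialPart hc).mono inter_subset_left)).add
    ((contDiffOn_radialPart hc).mono inter_subset_right)

lemma exp_logMetric (hpq : p ≠ q) : Real.exp (logMetric p q z) = (2916 * ‖q - p‖ ^ 2)⁻¹ *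
    Real.exp (radialPart ((‖q - p‖ ^ 2)⁻¹ * ‖z - p‖ ^ 2)) *
      Real.exp (radialPart ((‖q - p‖ ^ 2)⁻¹ * ‖z - q‖ ^ 2)) := by
  have := norm_pos_iff.2 (sub_ne_zero.2 hpq.symm)
  rw [logMetric, Real.exp_add, Real.exp_add, Real.exp_log (by positivity)]

lemma rational_ineq_aux {a b : ℝ} (hb : 0 < b) (hab : b ≤ a) (h : 1 ≤ a ^ 3 + b ^ 3) :
    (1 + a) * (1 + b) ^ 3 ≤ 162 * a ^ 5 := by
  have ha : 0 < a := hb.trans_le hab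
  have h1 : b ^ 3 ≤ a ^ 3 := by gcongr
  have h2 : 3 / 4 ≤ a := by
    by_contra! hcon
    have : a ^ 3 < (3 / 4) ^ 3 := by gcongr
    norm_num at this
    linarith
  have h3 : 1 + a ≤ 7 / 3 * a := by linarith
  calc (1 + a) * (1 + b) ^ 3 ≤ (7 / 3 * a) * (7 / 3 * a) ^ 3 := by
        gcongr; linarith
    _ = (7 / 3) ^ 4 * a ^ 4 * 1 := by ring
    _ ≤ (7 / 3) ^ 4 * a ^ 4 * (4 / 3 * a) := by gcongr; linarith
    _ = (7 / 3) ^ 4 * (4 / 3) * a ^ 5 := by ring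
    _ ≤ 162 * a ^ 5 := by gcongr; norm_num

lemma rational_ineq {a b : ℝ} (ha : 0 < a) (hb : 0 < b) (h : 1 ≤ a ^ 3 + b ^ 3) :
    (1 + a) * (1 + b) / (162 * (a ^ 5 * b ^ 5)) ≤
      1 / (a ^ 5 * (1 + a) ^ 2) + 1 / (b ^ 5 * (1 + b) ^ 2) := by
  wlog hab : b ≤ a generalizing a b
  · have := this hb ha (by linarith) (by linarith)
    rw [add_comm (1 / (a ^ 5 * _))]
    refine le_trans (le_of_eq ?_) this
    ring
  have h1 := rational_ineq_aux hb hab h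
  have h2 : (1 + a) * (1 + b) / (162 * (a ^ 5 * b ^ 5)) ≤ 1 / (b ^ 5 * (1 + b) ^ 2) := by
    rw [div_le_div_iff₀ (by positivity) (by positivity)]
    have := mul_le_mul_of_nonneg_left h1 (pow_pos hb 5).le
    nlinarith
  have h3 : 0 ≤ 1 / (a ^ 5 * (1 + a) ^ 2) := by positivity
  linarith

lemma lap_logMetric (hpq : p ≠ q) (hz : z ∈ ({p}ᶜ ∩ {q}ᶜ : Set ℂ)) :
    2 * Real.exp (logMetric p q z) ≤ lap (logMetric p q) z := by
  have hl := norm_pos_iff.2 (sub_ne_zero.2 hpq.symm)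
  have hzp := norm_pos_iff.2 (sub_ne_zero.2 hz.1)
  have hzq := norm_pos_iff.2 (sub_ne_zero.2 hz.2)
  have hc : 0 < (‖q - p‖ ^ 2)⁻¹ := by positivity
  have c1 : ContDiffAt ℝ 2 (fun w => radialPart ((‖q - p‖ ^ 2)⁻¹ * ‖w - p‖ ^ 2)) z :=
    ((contDiffOn_radialPart hc).contDiffAt (isOpen_compl_singleton.mem_nhds hz.1)).of_le
      (WithTop.coe_le_coe.2 le_top)
  have c2 : ContDiffAt ℝ 2 (fun w => radialPart ((‖q - p‖ ^ 2)⁻¹ * ‖w - q‖ ^ 2)) z :=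
    ((contDiffOn_radialPart hc).contDiffAt (isOpen_compl_singleton.mem_nhds hz.2)).of_le
      (WithTop.coe_le_coe.2 le_top)
  have e1 : lap (logMetric p q) z = _ + _ := lap_add (contDiffAt_const.add c1) c2
  have e2 : lap (fun z => Real.log ((2916 * ‖q - p‖ ^ 2)⁻¹) +
    radialPart ((‖q - p‖ ^ 2)⁻¹ * ‖z - p‖ ^ 2)) z = _ + _ := lap_add contDiffAt_const c1
  rw [e1, e2, lap_const, zero_add, lap_radialPart hc hz.1, lap_radialPart hc hz.2,
    exp_logMetric hpq, exp_radialPart, exp_radialPart]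
  have ha6 := exp_log_div_six_pow (by positivity : 0 < (‖q - p‖ ^ 2)⁻¹ * ‖z - p‖ ^ 2)
  have hb6 := exp_log_div_six_pow (by positivity : 0 < (‖q - p‖ ^ 2)⁻¹ * ‖z - q‖ ^ 2)
  set a := Real.exp (Real.log ((‖q - p‖ ^ 2)⁻¹ * ‖z - p‖ ^ 2) / 6)
  set b := Real.exp (Real.log ((‖q - p‖ ^ 2)⁻¹ * ‖z - q‖ ^ 2) / 6)
  have ha : 0 < a := Real.exp_pos _
  have hb : 0 < b := Real.exp_pos _
  have ha3 : a ^ 3 = ‖z - p‖ / ‖q - p‖ := by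
    refine (pow_left_inj₀ (by positivity) (by positivity) two_ne_zero).1 ?_
    rw [← pow_mul, ha6, div_pow]; field_simp
  have hb3 : b ^ 3 = ‖z - q‖ / ‖q - p‖ := by
    refine (pow_left_inj₀ (by positivity) (by positivity) two_ne_zero).1 ?_
    rw [← pow_mul, hb6, div_pow]; field_simp
  have hab : 1 ≤ a ^ 3 + b ^ 3 := by
    rw [ha3, hb3, ← add_div, le_div_iff₀ hl, one_mul]
    have := norm_sub_le (z - p) (z - q)
    rwa [sub_sub_sub_cancel_left] at this
  have := mul_le_mul_of_nonneg_left (rational_ineq ha hb hab) (by positivity :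
    0 ≤ (‖q - p‖ ^ 2)⁻¹ / 9)
  refine le_trans (le_of_eq ?_) (this.trans (le_of_eq (by ring)))
  field_simp
  norm_num

lemma le_exp_logMetric (hpq : p ≠ q) (hz : ‖z - p‖ = ‖q - p‖) (hzq : z ≠ q) :
    (2916 * ‖q - p‖ ^ 2)⁻¹ ≤ Real.exp (logMetric p q z) := by
  have hl := norm_pos_iff.2 (sub_ne_zero.2 hpq.symm)
  have hzq := norm_pos_iff.2 (sub_ne_zero.2 hzq)
  have e1 : (‖q - p‖ ^ 2)⁻¹ * ‖z - p‖ ^ 2 = 1 := by rw [hz]; field_simp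
  rw [exp_logMetric hpq, e1, exp_radialPart, exp_radialPart, Real.log_one, zero_div, Real.exp_zero,
    mul_assoc]
  have hb6 := exp_log_div_six_pow (by positivity : 0 < (‖q - p‖ ^ 2)⁻¹ * ‖z - q‖ ^ 2)
  set b := Real.exp (Real.log ((‖q - p‖ ^ 2)⁻¹ * ‖z - q‖ ^ 2) / 6)
  have hb : 0 < b := Real.exp_pos _
  have hb4 : b ^ 6 ≤ 4 := by
    have h1 : ‖z - q‖ ≤ 2 * ‖q - p‖ := by
      have := norm_sub_le (z - p) (q - p)
      rw [sub_sub_sub_cancel_right, hz] at this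
      linarith
    rw [hb6, inv_mul_le_iff₀ (by positivity)]
    nlinarith
  have hb5 : b ^ 5 ≤ 2 * (1 + b) := by
    rcases le_total b 1 with h | h
    · have := pow_le_one₀ (n := 5) hb.le h
      linarith
    · have : b ^ 5 ≤ b ^ 6 := pow_le_pow_right₀ h (by norm_num)
      linarith
  refine le_mul_of_one_le_right (by positivity) ?_
  rw [one_pow, div_one, mul_div_assoc', one_le_div (by positivity)]
  linarith

end HyperbolicMetric

section Topology

variable {T : ℝ} {M : Set (ℂ × ℝ)} {u : ℂ → ℝ → ℝ} {p z : ℂ} {t r : ℝ}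

/-- In an exhausting spacetime, every circle around a missing point contains a missing point. -/
lemma exists_notMem_sphere (hR : ConfRFS T M u) (hE : Expanding T M)
    (hcts : ContinuousSpacetime T M) (hexh : (⋃ t ∈ Ioo (0:ℝ) T, timeSlice M t) = univ)
    (ht : t ∈ Ioo 0 T) (hp : (p, t) ∉ M) (hr : 0 < r) : ∃ q, ‖q - p‖ = r ∧ (q, t) ∉ M := by
  by_contra! hcon
  set S := {s | s ∈ Ioo 0 T ∧ closedBall p r ⊆ timeSlice M s} with hS
  have hlow : ∀ s ∈ S, t ≤ s := fun s hs => by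
    by_contra! hst
    exact hp (hE p s t (hs.2 (mem_closedBall_self hr.le)) hst.le ht.2)
  have hne : S.Nonempty := by
    have : Nonempty (Ioo 0 T) := ⟨⟨t, ht⟩⟩
    obtain ⟨s, hs⟩ := (isCompact_closedBall p r).elim_directed_cover
      (fun s : Ioo 0 T => timeSlice M s) (fun s => hR.isOpen_timeSlice s)
      (fun z _ => by
        have : z ∈ (⋃ t ∈ Ioo (0:ℝ) T, timeSlice M t) := hexh ▸ mem_univ z
        simpa using this)
      (fun a b => by
        rcases le_total a b with h | h
        · exact ⟨b, fun z hz => hE z a b hz h b.2.2, subset_rfl⟩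
        · exact ⟨a, subset_rfl, fun z hz => hE z b a hz h a.2.2⟩)
    exact ⟨s, s.2, hs⟩
  have hbdd : BddBelow S := ⟨t, hlow⟩
  set σ := sInf S with hσ
  have htσ : t ≤ σ := le_csInf hne hlow
  have hσT : σ < T := by
    obtain ⟨s, hs⟩ := hne
    exact (csInf_le hbdd hs).trans_lt hs.1.2
  have hσI : σ ∈ Ioo 0 T := ⟨ht.1.trans_le htσ, hσT⟩
  have habove : ∀ s ∈ Ioo σ T, closedBall p r ⊆ timeSlice M s := fun s hs z hz => by
    obtain ⟨s', hs', hlt⟩ := exists_lt_of_csInf_lt hne hs.1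
    exact hE z s' s (hs'.2 hz) hlt.le hs.2
  have hσS : closedBall p r ⊆ timeSlice M σ := by
    intro z hz
    rcases (mem_closedBall.1 hz).lt_or_eq with h | h
    · rw [hcts σ hσI]
      refine interior_maximal (s := ⋂ t ∈ Ioo σ T, timeSlice M t) ?_ isOpen_ball (mem_ball.2 h)
      exact subset_iInter₂ fun s hs => ball_subset_closedBall.trans (habove s hs)
    · rw [dist_eq_norm] at h
      exact hE z t σ (hcon z h) htσ hσT
  have hlt : t < σ := by
    refine htσ.lt_of_ne fun h => hp ?_
    rw [h]
    exact hσS (mem_closedBall_self hr.le)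
  obtain ⟨δ, hδ, hδM⟩ := ((isCompact_closedBall p r).prod
    (isCompact_singleton (x := σ))).exists_thickening_subset_open hR.opn
    (fun x hx => by rw [← show x.2 = σ from hx.2] at hσS; exact hσS hx.1)
  obtain ⟨s, hs⟩ : ∃ s, s = max ((t + σ) / 2) (σ - δ / 2) := ⟨_, rfl⟩
  have hsσ : s < σ := by rw [hs]; exact max_lt (by linarith) (by linarith)
  have hs1 : (t + σ) / 2 ≤ s := hs ▸ le_max_left _ _
  have hs2 : σ - δ / 2 ≤ s := hs ▸ le_max_right _ _
  refine hsσ.not_ge (csInf_le hbdd ⟨⟨by linarith [ht.1], hsσ.trans hσT⟩, fun z hz => hδM ?_⟩)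
  refine mem_thickening_iff.2 ⟨(z, σ), ⟨hz, rfl⟩, ?_⟩
  rw [Prod.dist_eq, dist_self, max_eq_right dist_nonneg, Real.dist_eq, abs_lt]
  constructor <;> linarith

/-- In an initially determined spacetime every point can be traced back to arbitrarily early
times. -/
lemma exists_mem_component_early (hR : ConfRFS T M u) (hE : Expanding T M)
    (hid : InitiallyDetermined M) (h : (z, t) ∈ M) {τ : ℝ} (hτ : 0 < τ) :
    ∃ z₀ s₀, s₀ < τ ∧ (z₀, s₀) ∈ M ∧ z ∈ connectedComponentIn (timeSlice M t) z₀ := by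
  have hh := hid _ h
  rw [hindsight] at hh
  have hself : TimePreservingFrom M t z t :=
    ⟨fun _ => z, continuousOn_const, fun r hr => by
      rw [Icc_self, mem_singleton_iff] at hr
      rw [hr]
      exact h, rfl⟩
  have hne : {s : ℝ | 0 < s ∧ s ≤ t ∧ TimePreservingFrom M s z t}.Nonempty :=
    ⟨t, by exact ⟨(hR.sub h).1, le_rfl, hself⟩⟩
  obtain ⟨s, hs, hsτ⟩ := exists_lt_of_csInf_lt hne (hh.trans_lt hτ)
  obtain ⟨-, hst, γ, hγ, hγM, hγt⟩ := hs
  have hsI : s ∈ Icc s t := left_mem_Icc.2 hst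
  refine ⟨γ s, s, hsτ, hγM s hsI, ?_⟩
  have himg : γ '' Icc s t ⊆ timeSlice M t := by
    rintro _ ⟨r, hr, rfl⟩
    exact hE _ r t (hγM r hr) hr.2 (hR.sub h).2
  exact (isPreconnected_Icc.image γ hγ).subset_connectedComponentIn ⟨s, hsI, rfl⟩ himg
    ⟨t, right_mem_Icc.2 hst, hγt⟩

/-- The conformal factor is large near points outside of the spacetime. -/
theorem lower_bound_of_notMem (hR : ConfRFS T M u) (hC : ConfRFSComplete T M u)
    (hE : Expanding T M) (hcts : ContinuousSpacetime T M) (hid : InitiallyDetermined M)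
    (hexh : (⋃ t ∈ Ioo (0:ℝ) T, timeSlice M t) = univ) (h : (z, t) ∈ M) (hp : (p, t) ∉ M) :
    t / 23328 / ‖z - p‖ ^ 2 ≤ u z t := by
  have ht := hR.sub h
  have hzp : z ≠ p := fun e => hp (e ▸ h)
  have hn := norm_pos_iff.2 (sub_ne_zero.2 hzp)
  obtain ⟨q, hq, hqM⟩ := exists_notMem_sphere hR hE hcts hexh ht hp hn
  have hpq : p ≠ q := fun e => by
    rw [← hq, e, sub_self, norm_zero] at hn
    exact hn.false
  have hzq : z ≠ q := fun e => hqM (e ▸ h)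
  obtain ⟨z₀, s₀, hs₀, hz₀, hz⟩ := exists_mem_component_early hR hE hid h (half_pos ht.1)
  simp only at hs₀
  have key := mul_exp_le_of_lap hR hC hE (isOpen_compl_pair p q) (contDiffOn_logMetric hpq)
    (fun w hw => lap_logMetric hpq hw)
    (fun w hw => ⟨fun e => hp (e ▸ hw), fun e => hqM (e ▸ hw)⟩) hz₀
    (by linarith [ht.1]) ht.2 hz
  have hexp := le_exp_logMetric hpq hq.symm hzq
  rw [hq] at hexp
  have h1 : t / 2 * (2916 * ‖z - p‖ ^ 2)⁻¹ ≤ (t - s₀) * Real.exp (logMetric p q z) := by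
    gcongr
    · linarith [ht.1]
    · linarith
  have h2 : t / 23328 / ‖z - p‖ ^ 2 = t / 2 * (2916 * ‖z - p‖ ^ 2)⁻¹ / 4 := by
    field_simp
    ring
  rw [h2]
  linarith

end Topology

section Conclusion

variable {T : ℝ} {M : Set (ℂ × ℝ)} {u : ℂ → ℝ → ℝ} {p z : ℂ} {s t δ a : ℝ}

/-- A smooth function that vanishes at a point and is non-negative nearby at earlier times is a
supersolution of every heat equation at that point. -/
lemma deriv_le_lap_of_touching {f : ℂ × ℝ → ℝ} (hM : IsOpen M)
    (hf : ContDiffOn ℝ (⊤ : ℕ∞) f M) (h : (z, t) ∈ M) (h0 : f (z, t) = 0)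
    (hnear : ∀ᶠ q in nhds (z, t), q.2 < t → 0 ≤ f q) {c : ℝ} (hc : 0 ≤ c) :
    4 * deriv (fun s => f (z, s)) t ≤ c ^ 2 * lap (fun w => f (w, t)) z := by
  obtain ⟨C, hC, ε₀, hε₀, hfour⟩ := exists_four_point hM hf (isCompact_singleton (x := (z, t)))
    (singleton_subset_iff.2 h) c
  obtain ⟨r, hr, hball⟩ := Metric.eventually_nhds_iff.1 hnear
  by_contra! hlt
  set g := 4 * deriv (fun s => f (z, s)) t - c ^ 2 * lap (fun w => f (w, t)) z with hg
  have hg0 : 0 < g := sub_pos.2 hlt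
  obtain ⟨ε, hε, hεle, hε1, hεr, hεg⟩ :
      ∃ ε : ℝ, 0 < ε ∧ ε ≤ ε₀ ∧ ε ≤ 1 ∧ (c + 1) * ε < r ∧ C * ε < g := by
    have e1 : 0 < r / (2 * (c + 1)) := by positivity
    have e2 : 0 < g / (2 * (C + 1)) := by positivity
    refine ⟨min (min ε₀ 1) (min (r / (2 * (c + 1))) (g / (2 * (C + 1)))), by positivity,
      (min_le_left _ _).trans (min_le_left _ _), (min_le_left _ _).trans (min_le_right _ _), ?_, ?_⟩
    · have := (min_le_right (min ε₀ 1) _).trans (min_le_left (r / (2 * (c + 1))) (g / (2 * (C + 1))))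
      rw [le_div_iff₀ (by positivity)] at this
      linarith
    · have := (min_le_right (min ε₀ 1) _).trans (min_le_right (r / (2 * (c + 1))) (g / (2 * (C + 1))))
      rw [le_div_iff₀ (by positivity)] at this
      have e3 : 0 < min (min ε₀ 1) (min (r / (2 * (c + 1))) (g / (2 * (C + 1)))) := by positivity
      nlinarith only [this, e3, hC, hg0]
  have hζ : ‖((c * ε : ℝ) : ℂ)‖ = c * ε := by
    rw [Complex.norm_real, Real.norm_of_nonneg (by positivity)]
  have key := (abs_le.1 (hfour ε ⟨hε, hεle⟩ z t rfl ((c * ε : ℝ) : ℂ) hζ.le).2).2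
  have hsum : 0 ≤ ∑ k ∈ Finset.range 4,
      f (z + Complex.I ^ k * ((c * ε : ℝ) : ℂ), t - ε ^ 2) := by
    refine Finset.sum_nonneg fun k _ => hball ?_ (by simp only; nlinarith)
    rw [Prod.dist_eq, max_lt_iff, dist_eq_norm, dist_eq_norm, add_sub_cancel_left, norm_I_pow_mul,
      hζ, Real.norm_eq_abs, sub_sub_cancel_left, abs_neg, abs_of_nonneg (sq_nonneg ε)]
    constructor <;> nlinarith
  rw [hζ, h0] at key
  have : ε ^ 2 * g ≤ ε ^ 2 * (C * ε) := by rw [hg]; linarith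
  exact (le_of_mul_le_mul_left this (by positivity)).not_gt hεg

/-- The spatial Laplacian of the logarithm of the barrier's denominator. -/
lemma lap_log_sq_norm_add (hδ : 0 < δ) :
    lap (fun w => Real.log (‖w - p‖ ^ 2 + δ ^ 2)) z = 4 * δ ^ 2 / (‖z - p‖ ^ 2 + δ ^ 2) ^ 2 := by
  have hpos : 0 < ‖z - p‖ ^ 2 + δ ^ 2 := by positivity
  have h := lap_radial (f := fun r => Real.log (r + δ ^ 2)) (f' := fun r => (r + δ ^ 2)⁻¹)
    (f'' := -1 / (‖z - p‖ ^ 2 + δ ^ 2) ^ 2) (c := 1) (p := p) (z := z) ?_ ?_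
  · simp only [one_mul] at h
    rw [h]
    field_simp
    ring
  · rw [one_mul]
    have : ∀ᶠ r in nhds (‖z - p‖ ^ 2), 0 < r + δ ^ 2 :=
      (continuous_id.add continuous_const).continuousAt.eventually_const_lt hpos
    filter_upwards [this] with r hr
    simpa using ((hasDerivAt_id r).add_const (δ ^ 2)).log hr.ne'
  · rw [one_mul]
    exact ((hasDerivAt_id _).add_const (δ ^ 2)).inv hpos.ne'

/-- A solution cannot touch the barrier `(a - 5 t) / (‖z - p‖² + δ²)` from above. -/
lemma ConfRFS.not_touching (hR : ConfRFS T M u) (h : (z, t) ∈ M) (hδ : 0 < δ) (ha : 0 < a - 5 * t)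
    (heq : u z t * (‖z - p‖ ^ 2 + δ ^ 2) = a - 5 * t)
    (hnear : ∀ᶠ q in nhds (z, t), q ∈ M → q.2 < t →
      a - 5 * q.2 < u q.1 q.2 * (‖q.1 - p‖ ^ 2 + δ ^ 2)) : False := by
  have hden : ∀ w : ℂ, 0 < ‖w - p‖ ^ 2 + δ ^ 2 := fun w => by positivity
  set M' := M ∩ {q | 0 < a - 5 * q.2} with hM'
  have hM'o : IsOpen M' := hR.opn.inter
    (isOpen_lt continuous_const (continuous_const.sub (continuous_const.mul continuous_snd)))
  have hu := hR.pos _ h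
  simp only at hu
  have hcl : ContDiff ℝ (⊤ : ℕ∞) fun w : ℂ => Real.log (‖w - p‖ ^ 2 + δ ^ 2) :=
    (((contDiff_id.sub contDiff_const).norm_sq ℝ).add contDiff_const).log fun w => (hden w).ne'
  set f : ℂ × ℝ → ℝ := fun q => Real.log (u q.1 q.2) +
    Real.log (‖q.1 - p‖ ^ 2 + δ ^ 2) - Real.log (a - 5 * q.2) with hf
  have hfs : ContDiffOn ℝ (⊤ : ℕ∞) f M' := by
    refine ((hR.contDiffOn_log.mono inter_subset_left).add
      (hcl.comp contDiff_fst).contDiffOn).sub ?_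
    exact (contDiff_const.sub (contDiff_const.mul contDiff_snd)).contDiffOn.log
      fun q hq => (show 0 < a - 5 * q.2 from hq.2).ne'
  have hfq : ∀ q ∈ M', f q = Real.log (u q.1 q.2 * (‖q.1 - p‖ ^ 2 + δ ^ 2)) -
      Real.log (a - 5 * q.2) := fun q hq => by
    rw [Real.log_mul (hR.pos q hq.1).ne' (hden _).ne']
  have hmem : (z, t) ∈ M' := ⟨h, ha⟩
  have h0 : f (z, t) = 0 := by
    rw [hfq _ hmem]
    simp only [heq, sub_self]
  have hn : ∀ᶠ q in nhds (z, t), q.2 < t → 0 ≤ f q := by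
    filter_upwards [hnear, hM'o.mem_nhds hmem] with q hq hqM hqt
    rw [hfq q hqM, sub_nonneg]
    exact Real.log_le_log hqM.2 (hq hqM.1 hqt).le
  have key := deriv_le_lap_of_touching hM'o hfs hmem h0 hn (Real.sqrt_nonneg (4 / u z t))
  rw [Real.sq_sqrt (by positivity)] at key
  have hd : deriv (fun s => f (z, s)) t =
      lap (fun w => Real.log (u w t)) z / u z t + 5 / (a - 5 * t) := by
    have h1 := (hR.hasDerivAt h).log hu.ne'
    have h2 : HasDerivAt (fun s => a - 5 * s) (-5) t := by
      simpa using ((hasDerivAt_id t).const_mul 5).const_sub a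
    have h3 := (h1.add_const (Real.log (‖z - p‖ ^ 2 + δ ^ 2))).sub (h2.log ha.ne')
    have h4 : deriv (fun s => f (z, s)) t = _ := h3.deriv
    rw [h4]
    ring
  have hl : lap (fun w => f (w, t)) z =
      lap (fun w => Real.log (u w t)) z + 4 * δ ^ 2 / (‖z - p‖ ^ 2 + δ ^ 2) ^ 2 := by
    have e1 := hR.contDiffAt_log_slice h
    have e2 : ContDiffAt ℝ 2 (fun w : ℂ => Real.log (‖w - p‖ ^ 2 + δ ^ 2)) z :=
      hcl.contDiffAt.of_le (WithTop.coe_le_coe.2 le_top)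
    have e3 := lap_sub (e1.add e2) (contDiffAt_const (c := Real.log (a - 5 * t)))
    have e4 : lap (fun w => f (w, t)) z = _ := e3
    have e5 : lap (fun w => Real.log (u w t) + Real.log (‖w - p‖ ^ 2 + δ ^ 2)) z = _ :=
      lap_add e1 e2
    rw [lap_const, sub_zero] at e4
    rw [e4, ← lap_log_sq_norm_add hδ, ← e5]
  rw [hd, hl] at key
  have hD := hden z
  have e1 : u z t = (a - 5 * t) / (‖z - p‖ ^ 2 + δ ^ 2) := by
    rw [eq_div_iff hD.ne', heq]
  have e2 : 4 / u z t * (4 * δ ^ 2 / (‖z - p‖ ^ 2 + δ ^ 2) ^ 2) =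
      16 * (δ ^ 2 / (‖z - p‖ ^ 2 + δ ^ 2)) / (a - 5 * t) := by
    rw [e1]
    field_simp
    norm_num
  have e3 : δ ^ 2 / (‖z - p‖ ^ 2 + δ ^ 2) ≤ 1 := by
    rw [div_le_one hD]
    linarith [sq_nonneg ‖z - p‖]
  have e4 : 16 * (δ ^ 2 / (‖z - p‖ ^ 2 + δ ^ 2)) / (a - 5 * t) ≤ 16 * 1 / (a - 5 * t) := by
    gcongr
  have e5 : 4 / u z t * lap (fun w => Real.log (u w t)) z =
      4 * (lap (fun w => Real.log (u w t)) z / u z t) := by ring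
  rw [mul_add, mul_add, e2, e5] at key
  have e6 : 4 * (5 / (a - 5 * t)) = 16 * 1 / (a - 5 * t) + 4 / (a - 5 * t) := by ring
  have e7 : 0 < 4 / (a - 5 * t) := by positivity
  linarith

/-- Arbitrarily close to a missing point of a continuous spacetime there are points missing at
strictly later times. -/
lemma exists_notMem_later (hcts : ContinuousSpacetime T M) (ht : t ∈ Ioo 0 T) (hp : (p, t) ∉ M)
    (hδ : 0 < δ) : ∃ q τ, ‖q - p‖ < δ ∧ τ ∈ Ioo t T ∧ (q, τ) ∉ M := by
  by_contra! hcon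
  refine hp (show p ∈ timeSlice M t from ?_)
  rw [hcts t ht]
  refine interior_maximal (s := ⋂ t' ∈ Ioo t T, timeSlice M t') ?_ isOpen_ball (mem_ball_self hδ)
  exact subset_iInter₂ fun τ hτ q hq => hcon q τ (by rwa [mem_ball, dist_eq_norm] at hq) hτ

lemma mul_lower_bound_of_notMem (hR : ConfRFS T M u) (hC : ConfRFSComplete T M u)
    (hE : Expanding T M) (hcts : ContinuousSpacetime T M) (hid : InitiallyDetermined M)
    (hexh : (⋃ t ∈ Ioo (0:ℝ) T, timeSlice M t) = univ) (h : (z, t) ∈ M) (hp : (p, t) ∉ M) :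
    t / 23328 ≤ u z t * ‖z - p‖ ^ 2 := by
  have hn := norm_pos_iff.2 (sub_ne_zero.2 fun e : z = p => hp (e ▸ h))
  exact (div_le_iff₀ (by positivity)).1 (lower_bound_of_notMem hR hC hE hcts hid hexh h hp)

end Conclusion

section Barrier

variable {T : ℝ} {M : Set (ℂ × ℝ)} {u : ℂ → ℝ → ℝ} {p z z' : ℂ} {s t t' δ : ℝ}

/-- If `p` is missing at time `s` and a nearby point is missing at the later time `t'`, then the
barriers stay below the solution near `p` for a time that does not depend on `δ`. -/
theorem barrier_lt_of_notMem (hR : ConfRFS T M u) (hC : ConfRFSComplete T M u)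
    (hE : Expanding T M) (hcts : ContinuousSpacetime T M) (hid : InitiallyDetermined M)
    (hexh : (⋃ t ∈ Ioo (0:ℝ) T, timeSlice M t) = univ) (hs : 0 < s) (hp : (p, s) ∉ M)
    (ht' : t' < T) (hz' : ‖z' - p‖ < 1) (hz'M : (z', t') ∉ M) (hδ : 0 < δ)
    (hst : s ≤ t) (htt' : t ≤ t') (hts : t ≤ s + s / 23328 / 80) (h : (z, t) ∈ M)
    (hz : ‖z - p‖ ≤ 1) :
    s / 23328 / 8 + 5 * s - 5 * t < u z t * (‖z - p‖ ^ 2 + δ ^ 2) := by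
  set b := s / 23328 / 8 with hb
  have hb0 : 0 < b := by positivity
  set a := b + 5 * s with ha
  set G : ℂ × ℝ → ℝ := fun q => u q.1 q.2 * (‖q.1 - p‖ ^ 2 + δ ^ 2) - (a - 5 * q.2) with hG
  have hGc : ContinuousOn G M := by
    refine (hR.smooth.continuousOn.mul (Continuous.continuousOn ?_)).sub (Continuous.continuousOn ?_)
    all_goals fun_prop
  have hlow : ∀ {w q : ℂ} {r : ℝ}, s ≤ r → (w, r) ∈ M → (q, r) ∉ M →
      8 * b ≤ u w r * ‖w - q‖ ^ 2 := fun {w q r} hr hw hq => by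
    have := mul_lower_bound_of_notMem hR hC hE hcts hid hexh hw hq
    rw [hb]
    linarith
  set B := closedBall p 1 ×ˢ Icc s t with hB
  have hBc : IsCompact B := (isCompact_closedBall p 1).prod isCompact_Icc
  have hBT : ∀ q ∈ B, q.2 ∈ Ioo 0 T := fun q hq =>
    ⟨hs.trans_le hq.2.1, (hq.2.2.trans htt').trans_lt ht'⟩
  set E := {q ∈ B | q ∈ M ∧ G q ≤ 0} with hEdef
  have hEc : IsCompact E := by
    refine hBc.of_isClosed_subset (isClosed_of_closure_subset fun q hq => ?_) fun q hq => hq.1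
    rw [mem_closure_iff_frequently] at hq
    have hqB : q ∈ B := hBc.isClosed.mem_of_frequently_of_tendsto (hq.mono fun x hx => hx.1) tendsto_id
    have hqT := hBT q hqB
    have hqM : q ∈ M := by
      by_contra hqM
      obtain ⟨w, τ, hw, hτ, hwM⟩ := exists_notMem_later hcts hqT hqM hδ
      have hev : ∀ᶠ x in nhds q, ‖x.1 - q.1‖ < δ ∧ x.2 < τ := by
        have h1 : ContinuousAt (fun x : ℂ × ℝ => ‖x.1 - q.1‖) q := by fun_prop
        exact (h1.eventually_lt_const (by simpa using hδ)).and
          (continuousAt_snd.eventually_lt_const hτ.1)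
      obtain ⟨x, ⟨hxB, hxM, hxG⟩, hx1, hx2⟩ := (hq.and_eventually hev).exists
      have hl := hlow hxB.2.1 hxM fun hc => hwM (hE w x.2 τ hc hx2.le hτ.2)
      have hn : ‖x.1 - w‖ ≤ 2 * δ := by
        have := norm_sub_le (x.1 - q.1) (w - q.1)
        rw [sub_sub_sub_cancel_right] at this
        linarith
      have hux := hR.pos x hxM
      have h1 : u x.1 x.2 * ‖x.1 - w‖ ^ 2 ≤ u x.1 x.2 * (2 * δ) ^ 2 := by gcongr
      have h2 : 0 ≤ u x.1 x.2 * ‖x.1 - p‖ ^ 2 := by positivity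
      simp only [hG] at hxG
      have h3 := hxB.2.1
      nlinarith only [hl, h1, h2, hxG, h3, ha, hb0]
    refine ⟨hqB, hqM, ?_⟩
    by_contra! hGq
    have := (hGc.continuousAt (hR.opn.mem_nhds hqM)).eventually_const_lt hGq
    obtain ⟨x, hx, hx'⟩ := (hq.and_eventually this).exists
    exact hx.2.2.not_gt hx'
  by_contra! hcon
  have hne : E.Nonempty :=
    ⟨(z, t), ⟨by rwa [mem_closedBall, dist_eq_norm], hst, le_rfl⟩, h, by simp only [hG]; linarith⟩
  obtain ⟨⟨z₁, τ⟩, ⟨hqB, hqM, hqG⟩, hmin⟩ := hEc.exists_isMinOn hne continuous_snd.continuousOn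
  have hsτ : s ≤ τ := hqB.2.1
  have hτt : τ ≤ t := hqB.2.2
  have hz₁ : ‖z₁ - p‖ ≤ 1 := by simpa [dist_eq_norm] using hqB.1
  have hpos := hR.pos _ hqM
  simp only [hG] at hqG hpos
  have hδsq : 0 ≤ u z₁ τ * δ ^ 2 := by positivity
  have hτs : s < τ := by
    refine hsτ.lt_of_ne fun he => ?_
    have hl := hlow hsτ hqM (he ▸ hp)
    nlinarith only [hl, hδsq, hqG, hsτ, ha, hb0]
  have hz₁' : ‖z₁ - p‖ < 1 := by
    refine hz₁.lt_of_ne fun he => ?_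
    have hl := hlow hsτ hqM fun hc => hz'M (hE z' τ t' hc (hτt.trans htt') ht')
    have hn : ‖z₁ - z'‖ ≤ 2 := by
      have := norm_sub_le (z₁ - p) (z' - p)
      rw [sub_sub_sub_cancel_right] at this
      linarith
    have h1 : u z₁ τ * ‖z₁ - z'‖ ^ 2 ≤ u z₁ τ * 2 ^ 2 := by gcongr
    rw [he] at hqG
    nlinarith only [hl, h1, hδsq, hqG, hsτ, ha, hb0]
  have hnear : ∀ᶠ q in nhds (z₁, τ), q ∈ M → q.2 < τ →
      a - 5 * q.2 < u q.1 q.2 * (‖q.1 - p‖ ^ 2 + δ ^ 2) := by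
    have h1 : ContinuousAt (fun x : ℂ × ℝ => ‖x.1 - p‖) (z₁, τ) := by fun_prop
    filter_upwards [h1.eventually_lt_const hz₁',
      (continuousAt_snd (p := (z₁, τ))).eventually_const_lt hτs] with q hq1 hq2 hqM' hqτ
    by_contra! hc
    have : τ ≤ q.2 := hmin ⟨⟨by rw [mem_closedBall, dist_eq_norm]; exact hq1.le, hq2.le,
      hqτ.le.trans hτt⟩, hqM', sub_nonpos.2 hc⟩
    exact this.not_gt hqτ
  have hge : 0 ≤ G (z₁, τ) := by
    by_contra! hlt
    have hev := ((hGc.continuousAt (hR.opn.mem_nhds hqM)).eventually_lt_const hlt).and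
      (hnear.and (hR.opn.mem_nhds hqM))
    have hline : Tendsto (fun r : ℝ => (z₁, r)) (nhdsWithin τ (Iio τ)) (nhds (z₁, τ)) :=
      (Continuous.prodMk_right z₁).continuousAt.tendsto.mono_left nhdsWithin_le_nhds
    obtain ⟨r, ⟨hr1, hr2, hr3⟩, hr4⟩ := ((hline.eventually hev).and self_mem_nhdsWithin).exists
    have := hr2 hr3 hr4
    simp only [hG] at hr1
    linarith
  have heq : u z₁ τ * (‖z₁ - p‖ ^ 2 + δ ^ 2) = a - 5 * τ := by
    simp only [hG] at hge
    linarith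
  refine hR.not_touching hqM hδ ?_ heq hnear
  have : s / 23328 / 80 = b / 10 := by rw [hb]; ring
  linarith

end Barrier

/-- Rigidity of spacetimes in the plane: a complete, expanding, continuous and
initially determined conformal Ricci flow spacetime in `ℂ × (0,T)` whose slices exhaust the
plane is the whole cylinder `ℂ × (0,T)`. -/
theorem rigidity_in_plane
    (T : ℝ) (hT : 0 < T) (M : Set (ℂ × ℝ)) (u : ℂ → ℝ → ℝ)
    (hRF : ConfRFS T M u)
    (hcomp : ConfRFSComplete T M u)
    (hexp : Expanding T M) (hcts : ContinuousSpacetime T M)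
    (hid : InitiallyDetermined M)
    (hexh : (⋃ t ∈ Ioo (0:ℝ) T, timeSlice M t) = univ) :
    M = (univ : Set ℂ) ×ˢ Ioo 0 T := by
  refine Subset.antisymm (fun q hq => ⟨mem_univ _, hRF.sub hq⟩) ?_
  rintro ⟨p, t⟩ ⟨-, ht⟩
  simp only at ht
  by_contra hp
  set S := {r | r ∈ Ioo 0 T ∧ (p, r) ∉ M} with hS
  obtain ⟨t₁, ht₁, hpt₁⟩ : ∃ t₁ ∈ Ioo 0 T, (p, t₁) ∈ M := by
    have : p ∈ (⋃ t ∈ Ioo (0:ℝ) T, timeSlice M t) := hexh ▸ mem_univ p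
    simp only [mem_iUnion₂, exists_prop] at this
    exact this
  have hub : ∀ r ∈ S, r ≤ t₁ := fun r hr => by
    by_contra! hlt
    exact hr.2 (hexp p t₁ r hpt₁ hlt.le hr.1.2)
  have hne : S.Nonempty := ⟨t, ht, hp⟩
  have hbdd : BddAbove S := ⟨t₁, hub⟩
  set s := sSup S with hs
  have hts : t ≤ s := le_csSup hbdd ⟨ht, hp⟩
  have hs0 : 0 < s := ht.1.trans_le hts
  have hsT : s < T := (csSup_le hne hub).trans_lt ht₁.2
  have hps : (p, s) ∉ M := fun hc => by
    have hline : Tendsto (fun r : ℝ => (p, r)) (nhdsWithin s (Iio s)) (nhds (p, s)) :=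
      (Continuous.prodMk_right p).continuousAt.tendsto.mono_left nhdsWithin_le_nhds
    obtain ⟨r, hr, hrs⟩ :=
      ((hline.eventually (hRF.opn.mem_nhds hc)).and self_mem_nhdsWithin).exists
    obtain ⟨r', hr', hlt⟩ := exists_lt_of_lt_csSup hne (mem_Iio.1 hrs)
    exact hr'.2 (hexp p r r' hr hlt.le hr'.1.2)
  obtain ⟨z', t', hz', ht', hz'M⟩ := exists_notMem_later hcts ⟨hs0, hsT⟩ hps one_pos
  obtain ⟨τ, hτ⟩ : ∃ τ, τ = min t' (s + s / 23328 / 80) := ⟨_, rfl⟩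
  have hb0 : 0 < s / 23328 / 80 := by positivity
  have hsτ : s < τ := by rw [hτ]; exact lt_min ht'.1 (by linarith)
  have hτt' : τ ≤ t' := hτ ▸ min_le_left _ _
  have hτs : τ ≤ s + s / 23328 / 80 := hτ ▸ min_le_right _ _
  have hpτ : (p, τ) ∈ M := by
    by_contra hc
    exact hsτ.not_ge (le_csSup hbdd ⟨⟨hs0.trans hsτ, hτt'.trans_lt ht'.2⟩, hc⟩)
  have hlt : ∀ δ ∈ Ioc (0:ℝ) 1, s / 23328 / 80 ≤ u p τ * δ ^ 2 := fun δ hδ => by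
    have := barrier_lt_of_notMem hRF hcomp hexp hcts hid hexh hs0 hps ht'.2 hz' hz'M hδ.1
      hsτ.le hτt' hτs hpτ (by simp)
    rw [sub_self, norm_zero, zero_pow two_ne_zero, zero_add] at this
    linarith
  have hlim : Tendsto (fun δ : ℝ => u p τ * δ ^ 2) (nhdsWithin 0 (Ioi 0)) (nhds 0) := by
    have : Continuous fun δ : ℝ => u p τ * δ ^ 2 := by fun_prop
    simpa using (this.tendsto 0).mono_left nhdsWithin_le_nhds
  refine hb0.not_ge (ge_of_tendsto hlim ?_)
  filter_upwards [Ioc_mem_nhdsGT one_pos] with δ hδ using hlt δ hδ
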